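/- Let Ω and Ω̃ be Jordan domains in ℂ, let S be a relative Schottky set in Ω whose 2-dimensional Lebesgue measure is zero, let S̃ be a relative Schottky set in Ω̃, and let f : S → S̃ be a locally quasisymmetric homeomorphism. Then f preserves Hausdorff dimension: dim_H(f(A)) = dim_H(A) for every subset A ⊆ S; in particular dim_H(S̃) = dim_H(S). -/

import Mathlib

open Set Metric MeasureTheory Filter
open scoped NNReal ENNReal Topology

noncomputable section

/-- A (nonempty, open, connected) domain in the complex plane. -/
def IsPlaneDomain (Ω : Set ℂ) : Prop := IsOpen Ω ∧ IsConnected Ω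

/-- A family of open round discs (given by centers `c` and radii `r`) whose closures
are contained in `Ω` and are pairwise disjoint. -/
def IsSchottkyFamily {I : Type*} (Ω : Set ℂ) (c : I → ℂ) (r : I → ℝ) : Prop :=
  (∀ i, 0 < r i) ∧ (∀ i, closedBall (c i) (r i) ⊆ Ω) ∧
    Pairwise fun i j => Disjoint (closedBall (c i) (r i)) (closedBall (c j) (r j))

/-- `S` is a relative Schottky set in the domain `Ω`. -/
def IsRelativeSchottkySet (Ω S : Set ℂ) : Prop :=
  IsPlaneDomain Ω ∧
    ∃ (I : Type) (c : I → ℂ) (r : I → ℝ),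
      IsSchottkyFamily Ω c r ∧ S = Ω \ ⋃ i, ball (c i) (r i)

/-- A Jordan domain: a bounded domain whose boundary is an embedded circle, and which is
a connected component of the complement of its boundary. -/
def IsJordanDomain (Ω : Set ℂ) : Prop :=
  IsPlaneDomain Ω ∧ Bornology.IsBounded Ω ∧
    (∃ γ : ℂ → ℂ, ContinuousOn γ (sphere (0 : ℂ) 1) ∧ InjOn γ (sphere (0 : ℂ) 1) ∧
      γ '' sphere (0 : ℂ) 1 = frontier Ω) ∧
    ∀ p ∈ Ω, connectedComponentIn (frontier Ω)ᶜ p = Ω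

/-- `f : ℂ → ℂ` restricts to a homeomorphism from `S` onto `T`. -/
def IsHomeoOn (f : ℂ → ℂ) (S T : Set ℂ) : Prop :=
  ∃ e : S ≃ₜ T, ∀ z : S, (e z : ℂ) = f (z : ℂ)

/-- `f` is `η`-quasisymmetric on `X`. -/
def QuasisymmetricWith (η : ℝ≥0 ≃ₜ ℝ≥0) (f : ℂ → ℂ) (X : Set ℂ) : Prop :=
  ∀ p ∈ X, ∀ q ∈ X, ∀ s ∈ X, ∀ t : ℝ≥0,
    dist p q ≤ (t : ℝ) * dist p s → dist (f p) (f q) ≤ (η t : ℝ) * dist (f p) (f s)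

/-- `f` is locally quasisymmetric on `X`: its restriction to every compact subset of `X`
is quasisymmetric. -/
def LocallyQuasisymmetricOn (f : ℂ → ℂ) (X : Set ℂ) : Prop :=
  ∀ K ⊆ X, IsCompact K → ∃ η : ℝ≥0 ≃ₜ ℝ≥0, QuasisymmetricWith η f K

/-- `f` is locally bi-Lipschitz on `S`. -/
def LocallyBiLipschitzOn (f : ℂ → ℂ) (S : Set ℂ) : Prop :=
  ∀ p ∈ S, ∃ U ∈ 𝓝[S] p, ∃ L : ℝ, 1 ≤ L ∧
    ∀ x ∈ U, ∀ y ∈ U,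
      dist x y / L ≤ dist (f x) (f y) ∧ dist (f x) (f y) ≤ L * dist x y

/-- A fixed smooth bump function on the line, normalized to have integral one. -/
def lineBump (x : ℝ) : ℝ :=
  (⟨1 / 4, 1 / 2, by norm_num, by norm_num⟩ : ContDiffBump (0 : ℝ)).normed volume x

/-- A fixed smooth bump function on the plane. -/
def planeBump (w : ℂ) : ℝ := lineBump w.re * lineBump w.im

/-- A primitive of `planeBump` in the horizontal direction. -/
def planePrimitive (w : ℂ) : ℝ := (∫ t in (-1 : ℝ)..w.re, lineBump t) * lineBump w.im

/-- The Jacobian determinant of a planar map. -/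
def jac (H : ℂ → ℂ) (z : ℂ) : ℝ :=
  (fderiv ℝ H z 1).re * (fderiv ℝ H z Complex.I).im -
    (fderiv ℝ H z Complex.I).re * (fderiv ℝ H z 1).im

/-- The degree integral of a planar map over a set. -/
def smoothDegree (H : ℂ → ℂ) (U : Set ℂ) : ℝ := ∫ z in U, planeBump (H z) * jac H z

lemma contDiff_lineBump {n : ℕ∞} : ContDiff ℝ n lineBump := ContDiffBump.contDiff_normed _

lemma lineBump_nonneg (x : ℝ) : 0 ≤ lineBump x := ContDiffBump.nonneg_normed _ _

lemma lineBump_eq_zero {x : ℝ} (hx : 1 / 2 ≤ |x|) : lineBump x = 0 := by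
  have h := ContDiffBump.support_normed_eq
    (⟨1 / 4, 1 / 2, by norm_num, by norm_num⟩ : ContDiffBump (0 : ℝ)) (μ := volume)
  by_contra h'
  have : x ∈ Function.support lineBump := h'
  unfold lineBump at this
  rw [h] at this
  simp at this
  linarith

lemma integral_lineBump : ∫ x, lineBump x = 1 := ContDiffBump.integral_normed _

lemma planeBump_nonneg (w : ℂ) : 0 ≤ planeBump w :=
  mul_nonneg (lineBump_nonneg _) (lineBump_nonneg _)

lemma planeBump_eq_zero {w : ℂ} (hw : 1 ≤ ‖w‖) : planeBump w = 0 := by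
  unfold planeBump
  rcases le_or_gt (1 / 2) |w.re| with h | h
  · rw [lineBump_eq_zero h, zero_mul]
  rcases le_or_gt (1 / 2) |w.im| with h' | h'
  · rw [lineBump_eq_zero h', mul_zero]
  have := Complex.norm_le_abs_re_add_abs_im w
  linarith

lemma contDiff_planeBump : ContDiff ℝ 1 planeBump := by
  unfold planeBump
  exact (contDiff_lineBump (n := 1)).comp Complex.reCLM.contDiff |>.mul
    ((contDiff_lineBump (n := 1)).comp Complex.imCLM.contDiff)

lemma continuous_planeBump : Continuous planeBump := contDiff_planeBump.continuous

lemma hasCompactSupport_planeBump : HasCompactSupport planeBump := by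
  refine HasCompactSupport.intro (isCompact_closedBall (0 : ℂ) 1) fun x hx => ?_
  apply planeBump_eq_zero
  simp at hx
  exact hx.le

lemma integral_planeBump : ∫ w, planeBump w = 1 := by
  have h := (Complex.volume_preserving_equiv_real_prod).integral_comp
    (Complex.measurableEquivRealProd.measurableEmbedding)
    (fun p : ℝ × ℝ => lineBump p.1 * lineBump p.2)
  have h2 : ∫ w, planeBump w = ∫ p : ℝ × ℝ, lineBump p.1 * lineBump p.2 := by
    rw [← h]; rfl
  rw [h2, Measure.volume_eq_prod, integral_prod_mul (f := lineBump) (g := lineBump),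
    integral_lineBump, one_mul]

lemma hasDerivAt_integral_lineBump (x : ℝ) :
    HasDerivAt (fun x => ∫ t in (-1 : ℝ)..x, lineBump t) (lineBump x) x := by
  have hc : Continuous lineBump := (contDiff_lineBump (n := 1)).continuous
  exact intervalIntegral.integral_hasDerivAt_right (hc.intervalIntegrable _ _)
    hc.stronglyMeasurable.stronglyMeasurableAtFilter hc.continuousAt

lemma contDiff_planePrimitive : ContDiff ℝ 1 planePrimitive := by
  unfold planePrimitive
  have h : ContDiff ℝ 1 (fun x => ∫ t in (-1 : ℝ)..x, lineBump t) := by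
    rw [contDiff_one_iff_deriv]
    refine ⟨fun x => (hasDerivAt_integral_lineBump x).differentiableAt, ?_⟩
    have : deriv (fun x => ∫ t in (-1 : ℝ)..x, lineBump t) = lineBump :=
      funext fun x => (hasDerivAt_integral_lineBump x).deriv
    rw [this]
    exact (contDiff_lineBump (n := 1)).continuous
  exact (h.comp Complex.reCLM.contDiff).mul
    ((contDiff_lineBump (n := 1)).comp Complex.imCLM.contDiff)

lemma fderiv_planePrimitive (w : ℂ) :
    ∃ β : ℝ, ∀ ζ : ℂ, fderiv ℝ planePrimitive w ζ = planeBump w * ζ.re + β * ζ.im := by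
  set E : ℝ → ℝ := fun x => ∫ t in (-1 : ℝ)..x, lineBump t with hE
  have hd1 : HasFDerivAt (fun w : ℂ => E w.re) (lineBump w.re • Complex.reCLM) w :=
    (hasDerivAt_integral_lineBump w.re).comp_hasFDerivAt w Complex.reCLM.hasFDerivAt
  have hb : HasDerivAt lineBump (deriv lineBump w.im) w.im :=
    ((contDiff_lineBump (n := 1)).differentiable (by simp)).differentiableAt.hasDerivAt
  have hd2 : HasFDerivAt (fun w : ℂ => lineBump w.im) (deriv lineBump w.im • Complex.imCLM) w :=
    hb.comp_hasFDerivAt w Complex.imCLM.hasFDerivAt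
  have hd := hd1.mul hd2
  refine ⟨E w.re * deriv lineBump w.im, fun ζ => ?_⟩
  have : fderiv ℝ planePrimitive w = _ := hd.fderiv
  rw [this]
  simp [planeBump]
  ring

lemma integral_fderiv_apply_eq_zero {X : ℂ → ℝ} (hX : ContDiff ℝ 1 X) (hc : HasCompactSupport X)
    (v : ℂ) : Integrable (fun z => fderiv ℝ X z v) ∧ ∫ z, fderiv ℝ X z v = 0 := by
  have h1 : Integrable (fun z => fderiv ℝ X z v) := by
    refine Continuous.integrable_of_hasCompactSupport ?_ ?_
    · exact (hX.continuous_fderiv (by simp)).clm_apply continuous_const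
    · exact hc.fderiv_apply (𝕜 := ℝ) v
  refine ⟨h1, ?_⟩
  have := integral_mul_fderiv_eq_neg_fderiv_mul_of_integrable (μ := (volume : Measure ℂ))
    (f := fun _ => (1 : ℝ)) (g := X) (v := v) (by simp) (by simpa using h1)
    (by simpa using hX.continuous.integrable_of_hasCompactSupport hc)
    (fun x _ => by simp) (fun x _ => (hX.differentiable (by simp)) x)
  simpa using this

/-- The vector fields whose divergence is the degree density. -/
def degreeField (H : ℂ → ℂ) (v z : ℂ) : ℝ := planePrimitive (H z) * (fderiv ℝ H z v).im

lemma contDiffAt_degreeField {H : ℂ → ℂ} {z : ℂ} (hH : ContDiffAt ℝ 2 H z) (v : ℂ) :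
    ContDiffAt ℝ 1 (degreeField H v) z := by
  have h1 : ContDiffAt ℝ 1 (fderiv ℝ H) z := hH.fderiv_right (by norm_num)
  have h2 : ContDiffAt ℝ 1 (fun z => fderiv ℝ H z v) z := h1.clm_apply contDiffAt_const
  have h3 : ContDiffAt ℝ 1 (fun z => (fderiv ℝ H z v).im) z :=
    Complex.imCLM.contDiff.contDiffAt.comp z h2
  have h4 : ContDiffAt ℝ 1 (fun z => planePrimitive (H z)) z :=
    contDiff_planePrimitive.contDiffAt.comp z (hH.of_le (by norm_num))
  exact h4.mul h3

lemma degreeField_div {H : ℂ → ℂ} {z : ℂ} (hH : ContDiffAt ℝ 2 H z) :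
    fderiv ℝ (degreeField H Complex.I) z 1 - fderiv ℝ (degreeField H 1) z Complex.I =
      planeBump (H z) * jac H z := by
  have h1 : ContDiffAt ℝ 1 (fderiv ℝ H) z := hH.fderiv_right (by norm_num)
  have h1' : HasFDerivAt (fderiv ℝ H) (fderiv ℝ (fderiv ℝ H) z) z :=
    (h1.differentiableAt (by simp)).hasFDerivAt
  have hH' : HasFDerivAt H (fderiv ℝ H z) z := (hH.differentiableAt (by simp)).hasFDerivAt
  have hA : HasFDerivAt (fun z => planePrimitive (H z))
      ((fderiv ℝ planePrimitive (H z)).comp (fderiv ℝ H z)) z :=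
    ((contDiff_planePrimitive.differentiable (by simp)) (H z)).hasFDerivAt.comp z hH'
  have key : ∀ v w : ℂ, fderiv ℝ (degreeField H v) z w =
      planePrimitive (H z) * (fderiv ℝ (fderiv ℝ H) z w v).im +
        (fderiv ℝ H z v).im * fderiv ℝ planePrimitive (H z) (fderiv ℝ H z w) := by
    intro v w
    have h2 : HasFDerivAt (fun z => fderiv ℝ H z v)
        ((ContinuousLinearMap.apply ℝ ℂ v).comp (fderiv ℝ (fderiv ℝ H) z)) z :=
      (ContinuousLinearMap.apply ℝ ℂ v).hasFDerivAt.comp z h1'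
    have h3 : HasFDerivAt (fun z => (fderiv ℝ H z v).im)
        (Complex.imCLM.comp ((ContinuousLinearMap.apply ℝ ℂ v).comp (fderiv ℝ (fderiv ℝ H) z))) z :=
      Complex.imCLM.hasFDerivAt.comp z h2
    have : fderiv ℝ (degreeField H v) z = _ := (hA.mul h3).fderiv
    rw [this]
    simp
  have hsymm : fderiv ℝ (fderiv ℝ H) z 1 Complex.I = fderiv ℝ (fderiv ℝ H) z Complex.I 1 :=
    (hH.isSymmSndFDerivAt (by simp)) 1 Complex.I
  obtain ⟨β, hβ⟩ := fderiv_planePrimitive (H z)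
  rw [key, key, hsymm, hβ, hβ, jac]
  ring

lemma jac_congr {H H' : ℂ → ℂ} {z : ℂ} (h : H =ᶠ[𝓝 z] H') : jac H z = jac H' z := by
  unfold jac; rw [h.fderiv_eq]

lemma degreeField_congr {H H' : ℂ → ℂ} {z : ℂ} (h : H =ᶠ[𝓝 z] H') (v : ℂ) :
    degreeField H v z = degreeField H' v z := by
  unfold degreeField; rw [h.fderiv_eq, h.eq_of_nhds]

lemma continuousAt_jac {H : ℂ → ℂ} {z : ℂ} (hH : ContDiffAt ℝ 1 H z) : ContinuousAt (jac H) z := by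
  have h1 : ContinuousAt (fderiv ℝ H) z := (hH.fderiv_right (m := 0) (by norm_num)).continuousAt
  unfold jac
  fun_prop

/-- If a map is bounded below by one on the boundary, then its degree density is integrable. -/
lemma integrable_degree_density {U : Set ℂ} (hU : IsOpen U) (hb : Bornology.IsBounded U)
    {H : ℂ → ℂ} (hH : ContDiffOn ℝ 1 H U) (hc : ContinuousOn H (closure U))
    (h1 : ∀ z ∈ frontier U, 1 < ‖H z‖) :
    IntegrableOn (fun z => planeBump (H z) * jac H z) U := by
  set K : Set ℂ := closure U ∩ {z | ‖H z‖ ≤ 1} with hK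
  have hKc : IsCompact K := by
    refine hb.isCompact_closure.of_isClosed_subset ?_ inter_subset_left
    exact hc.norm.preimage_isClosed_of_isClosed isClosed_closure isClosed_Iic
  have hKU : K ⊆ U := by
    rintro z ⟨hz, hz'⟩
    by_contra hzU
    have : z ∈ frontier U := by rw [hU.frontier_eq]; exact ⟨hz, hzU⟩
    exact absurd (h1 z this) (not_lt.2 hz')
  have hcont : ContinuousOn (fun z => planeBump (H z) * jac H z) U := by
    intro z hz
    have hz' : ContDiffAt ℝ 1 H z := hH.contDiffAt (hU.mem_nhds hz)
    exact ((continuous_planeBump.continuousAt.comp hz'.continuousAt).mul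
      (continuousAt_jac hz')).continuousWithinAt
  have : IntegrableOn (fun z => planeBump (H z) * jac H z) K :=
    (hcont.mono hKU).integrableOn_compact hKc
  refine this.of_forall_sdiff_eq_zero hU.measurableSet ?_
  rintro z ⟨hz, hzK⟩
  have : 1 < ‖H z‖ := by
    by_contra h
    exact hzK ⟨subset_closure hz, not_lt.1 h⟩
  rw [planeBump_eq_zero this.le, zero_mul]

lemma smoothDegree_eq_of_eq_off_compact {U K : Set ℂ} (hU : IsOpen U) (hK : IsCompact K)
    (hKU : K ⊆ U) {H H' : ℂ → ℂ} (hH : ContDiffOn ℝ 2 H U) (hH' : ContDiffOn ℝ 2 H' U)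
    (heq : ∀ z ∈ U \ K, H z = H' z)
    (hi : IntegrableOn (fun z => planeBump (H z) * jac H z) U)
    (hi' : IntegrableOn (fun z => planeBump (H' z) * jac H' z) U) :
    smoothDegree H U = smoothDegree H' U := by
  have hev : ∀ z ∈ U \ K, H =ᶠ[𝓝 z] H' := by
    intro z hz
    filter_upwards [(hU.sdiff hK.isClosed).mem_nhds hz] with w hw using heq w hw
  set X : ℂ → ℂ → ℝ := fun v => U.indicator (fun z => degreeField H v z - degreeField H' v z)
    with hX
  have hX0 : ∀ v z, z ∉ K → X v z = 0 := by
    intro v z hz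
    by_cases hzU : z ∈ U
    · simp only [hX, indicator_of_mem hzU]
      rw [degreeField_congr (hev z ⟨hzU, hz⟩), sub_self]
    · simp [hX, hzU]
  have hXev : ∀ v, ∀ z ∈ U, X v =ᶠ[𝓝 z] fun z => degreeField H v z - degreeField H' v z := by
    intro v z hz
    filter_upwards [hU.mem_nhds hz] with w hw
    simp [hX, hw]
  have hXC : ∀ v, ContDiff ℝ 1 (X v) := by
    intro v
    rw [contDiff_iff_contDiffAt]
    intro z
    by_cases hz : z ∈ U
    · exact ((contDiffAt_degreeField (hH.contDiffAt (hU.mem_nhds hz)) v).sub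
        (contDiffAt_degreeField (hH'.contDiffAt (hU.mem_nhds hz)) v)).congr_of_eventuallyEq
        (hXev v z hz)
    · have : X v =ᶠ[𝓝 z] fun _ => 0 := by
        filter_upwards [hK.isClosed.isOpen_compl.mem_nhds (fun h => hz (hKU h))] with w hw
          using hX0 v w hw
      exact contDiffAt_const.congr_of_eventuallyEq this
  have hXs : ∀ v, HasCompactSupport (X v) := fun v => HasCompactSupport.intro hK (hX0 v)
  have hd : ∀ v, ∀ z ∈ U, ∀ w, fderiv ℝ (X v) z w =
      fderiv ℝ (degreeField H v) z w - fderiv ℝ (degreeField H' v) z w := by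
    intro v z hz w
    have d1 := (contDiffAt_degreeField (hH.contDiffAt (hU.mem_nhds hz)) v).differentiableAt
      (by simp)
    have d2 := (contDiffAt_degreeField (hH'.contDiffAt (hU.mem_nhds hz)) v).differentiableAt
      (by simp)
    rw [(hXev v z hz).fderiv_eq, fderiv_fun_sub d1 d2]
    rfl
  have hd0 : ∀ v, ∀ z, z ∉ U → ∀ w, fderiv ℝ (X v) z w = 0 := by
    intro v z hz w
    have : X v =ᶠ[𝓝 z] fun _ => 0 := by
      filter_upwards [hK.isClosed.isOpen_compl.mem_nhds (fun h => hz (hKU h))] with w hw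
        using hX0 v w hw
    rw [this.fderiv_eq]; simp
  have e1 := integral_fderiv_apply_eq_zero (hXC Complex.I) (hXs Complex.I) 1
  have e2 := integral_fderiv_apply_eq_zero (hXC 1) (hXs 1) Complex.I
  have e3 : ∫ z, (fderiv ℝ (X Complex.I) z 1 - fderiv ℝ (X 1) z Complex.I) = 0 := by
    rw [integral_sub e1.1 e2.1, e1.2, e2.2, sub_self]
  rw [← sub_eq_zero, smoothDegree, smoothDegree, ← integral_sub hi hi', ← e3]
  rw [← setIntegral_eq_integral_of_forall_compl_eq_zero (s := U)
    (f := fun z => fderiv ℝ (X Complex.I) z 1 - fderiv ℝ (X 1) z Complex.I)]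
  · refine setIntegral_congr_fun hU.measurableSet fun z hz => ?_
    rw [hd _ z hz, hd _ z hz, ← degreeField_div (hH.contDiffAt (hU.mem_nhds hz)),
      ← degreeField_div (hH'.contDiffAt (hU.mem_nhds hz))]
    ring
  · intro z hz
    rw [hd0 _ z hz, hd0 _ z hz, sub_self]

/-- Homotopy invariance of the degree integral along segments. -/
lemma smoothDegree_eq_of_segment {U : Set ℂ} (hU : IsOpen U) (hb : Bornology.IsBounded U)
    {H H' : ℂ → ℂ} (hH : ContDiffOn ℝ 2 H U) (hH' : ContDiffOn ℝ 2 H' U)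
    (hc : ContinuousOn H (closure U)) (hc' : ContinuousOn H' (closure U))
    (hseg : ∀ z ∈ frontier U, ∀ t ∈ Icc (0 : ℝ) 1, 1 < ‖H z + t * (H' z - H z)‖) :
    smoothDegree H U = smoothDegree H' U := by
  set K : Set ℂ := Prod.fst '' ((closure U ×ˢ Icc (0 : ℝ) 1) ∩
    {p : ℂ × ℝ | ‖H p.1 + (p.2 : ℂ) * (H' p.1 - H p.1)‖ ≤ 1}) with hKdef
  have hKc : IsCompact K := by
    apply IsCompact.image _ continuous_fst
    refine (hb.isCompact_closure.prod isCompact_Icc).of_isClosed_subset ?_ inter_subset_left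
    have hcl : IsClosed (closure U ×ˢ Icc (0 : ℝ) 1) := isClosed_closure.prod isClosed_Icc
    refine ContinuousOn.preimage_isClosed_of_isClosed (t := Iic (1 : ℝ))
      (f := fun p : ℂ × ℝ => ‖H p.1 + (p.2 : ℂ) * (H' p.1 - H p.1)‖) ?_ hcl isClosed_Iic
    have f1 : ContinuousOn (fun p : ℂ × ℝ => H p.1) (closure U ×ˢ Icc (0 : ℝ) 1) :=
      hc.comp continuousOn_fst fun p hp => hp.1
    have f2 : ContinuousOn (fun p : ℂ × ℝ => H' p.1) (closure U ×ˢ Icc (0 : ℝ) 1) :=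
      hc'.comp continuousOn_fst fun p hp => hp.1
    have f3 : ContinuousOn (fun p : ℂ × ℝ => (p.2 : ℂ)) (closure U ×ˢ Icc (0 : ℝ) 1) :=
      (Complex.continuous_ofReal.comp continuous_snd).continuousOn
    exact (f1.add (f3.mul (f2.sub f1))).norm
  have hKU : K ⊆ U := by
    rintro z ⟨⟨z', t⟩, ⟨⟨hz, ht⟩, hz'⟩, rfl⟩
    by_contra hzU
    have : z' ∈ frontier U := by rw [hU.frontier_eq]; exact ⟨hz, hzU⟩
    exact absurd (hseg z' this t ht) (not_lt.2 hz')
  obtain ⟨L, hLc, hKL, hLU⟩ := exists_compact_between hKc hU hKU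
  obtain ⟨L', hLc', hLL', hLU'⟩ := exists_compact_between hLc hU hLU
  obtain ⟨χ, hχ, hχ1, hχ0⟩ : ∃ χ : ℂ → ℝ, ContDiff ℝ 2 χ ∧ (∀ z ∈ L, χ z = 1) ∧
      (∀ z, z ∉ L' → χ z = 0) ∧ (∀ z, χ z ∈ Icc (0 : ℝ) 1) := by
    obtain ⟨f, hf1, hf2, hf3, hf4⟩ := exists_contMDiff_support_eq_eq_one_iff
      (modelWithCornersSelf ℝ ℂ) (n := 2) isOpen_interior hLc.isClosed hLL'
    refine ⟨f, hf1.contDiff, fun z hz => (hf4 z).1 hz, fun z hz => ?_,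
      fun z => hf2 (mem_range_self z)⟩
    by_contra h
    have : z ∈ Function.support f := h
    rw [hf3] at this
    exact hz (interior_subset this)
  set H₂ : ℂ → ℂ := fun z => H z + χ z * (H' z - H z) with hH₂
  have hχC : ContDiff ℝ 2 (fun z => (χ z : ℂ)) := Complex.ofRealCLM.contDiff.comp hχ
  have hH₂C : ContDiffOn ℝ 2 H₂ U := hH.add (hχC.contDiffOn.mul (hH'.sub hH))
  have hH₂c : ContinuousOn H₂ (closure U) := hc.add (hχC.continuous.continuousOn.mul (hc'.sub hc))
  have b0 : ∀ z ∈ frontier U, 1 < ‖H z‖ := fun z hz => by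
    simpa using hseg z hz 0 (by simp)
  have b1 : ∀ z ∈ frontier U, 1 < ‖H' z‖ := fun z hz => by
    simpa using hseg z hz 1 (by simp)
  have b2 : ∀ z ∈ frontier U, 1 < ‖H₂ z‖ := fun z hz => hseg z hz (χ z) (hχ0.2 z)
  have one2 : (1 : WithTop ℕ∞) ≤ 2 := by norm_num
  have i0 := integrable_degree_density hU hb (hH.of_le one2) hc b0
  have i2 := integrable_degree_density hU hb (hH₂C.of_le one2) hH₂c b2
  have s1 : smoothDegree H U = smoothDegree H₂ U := by
    refine smoothDegree_eq_of_eq_off_compact hU hLc' hLU' hH hH₂C (fun z hz => ?_) i0 i2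
    simp [hH₂, hχ0.1 z hz.2]
  rw [s1]
  refine setIntegral_congr_fun hU.measurableSet fun z hz => ?_
  by_cases hzK : z ∈ K
  · have : H₂ =ᶠ[𝓝 z] H' := by
      filter_upwards [isOpen_interior.mem_nhds (hKL hzK)] with w hw
      simp [hH₂, hχ1 w (interior_subset hw)]
    rw [jac_congr this, this.eq_of_nhds]
  · have hbig : ∀ t ∈ Icc (0 : ℝ) 1, 1 < ‖H z + t * (H' z - H z)‖ := by
      intro t ht
      by_contra h
      exact hzK ⟨(z, t), ⟨⟨subset_closure hz, ht⟩, not_lt.1 h⟩, rfl⟩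
    have h2 := hbig _ (hχ0.2 z)
    have h1 := hbig 1 (by simp)
    simp only [Complex.ofReal_one, one_mul, add_sub_cancel] at h1
    rw [planeBump_eq_zero h2.le, planeBump_eq_zero h1.le, zero_mul, zero_mul]

/-- `H` is a smooth map on `U` that is close on the frontier of `U` to a large multiple of `G`. -/
def IsDegreeApprox (G : ℂ → ℂ) (U : Set ℂ) (H : ℂ → ℂ) : Prop :=
  ContDiffOn ℝ 2 H U ∧ ContinuousOn H (closure U) ∧
    ∃ s : ℝ, 0 < s ∧ ∀ z ∈ frontier U, 2 < s * ‖G z‖ ∧ ‖H z - s * G z‖ < s * ‖G z‖ / 2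

open Classical in
/-- The degree over zero of a continuous map, which depends only on boundary values. -/
def planeDegree (G : ℂ → ℂ) (U : Set ℂ) : ℝ :=
  if h : ∃ H, IsDegreeApprox G U H then smoothDegree h.choose U else 0

lemma IsDegreeApprox.smoothDegree_eq {G : ℂ → ℂ} {U : Set ℂ} (hU : IsOpen U)
    (hb : Bornology.IsBounded U) {H H' : ℂ → ℂ} (h : IsDegreeApprox G U H)
    (h' : IsDegreeApprox G U H') : smoothDegree H U = smoothDegree H' U := by
  obtain ⟨h1, h2, s, hs, h3⟩ := h
  obtain ⟨h1', h2', s', hs', h3'⟩ := h'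
  refine smoothDegree_eq_of_segment hU hb h1 h1' h2 h2' fun z hz t ht => ?_
  obtain ⟨a1, a2⟩ := h3 z hz
  obtain ⟨b1, b2⟩ := h3' z hz
  set w := H z + t * (H' z - H z) with hw
  have e1 : w - ((s + t * (s' - s) : ℝ) : ℂ) * G z =
      ((1 - t : ℝ) : ℂ) * (H z - s * G z) + (t : ℂ) * (H' z - s' * G z) := by
    rw [hw]; push_cast; ring
  have e2 : ‖w - ((s + t * (s' - s) : ℝ) : ℂ) * G z‖ ≤
      (1 - t) * (s * ‖G z‖ / 2) + t * (s' * ‖G z‖ / 2) := by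
    rw [e1]
    refine (norm_add_le _ _).trans ?_
    rw [norm_mul, norm_mul, Complex.norm_of_nonneg ht.1, Complex.norm_of_nonneg (by linarith [ht.2])]
    have := ht.1
    have := ht.2
    gcongr
  have e3 : ‖((s + t * (s' - s) : ℝ) : ℂ) * G z‖ = (s + t * (s' - s)) * ‖G z‖ := by
    rw [norm_mul, Complex.norm_of_nonneg]
    nlinarith [ht.1, ht.2]
  have e4 := norm_sub_norm_le (((s + t * (s' - s) : ℝ) : ℂ) * G z) w
  rw [norm_sub_rev] at e4
  have e5 : 0 < (1 - t) * (s * ‖G z‖ - 2) + t * (s' * ‖G z‖ - 2) := by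
    rcases ht.1.eq_or_lt with rfl | h
    · linarith
    · have := mul_nonneg (sub_nonneg.2 ht.2) (sub_nonneg.2 a1.le)
      have := mul_pos h (sub_pos.2 b1)
      linarith
  rw [e3] at e4
  linarith

lemma planeDegree_eq {G : ℂ → ℂ} {U : Set ℂ} (hU : IsOpen U)
    (hb : Bornology.IsBounded U) {H : ℂ → ℂ} (h : IsDegreeApprox G U H) :
    planeDegree G U = smoothDegree H U := by
  have h' : ∃ H, IsDegreeApprox G U H := ⟨H, h⟩
  rw [planeDegree, dif_pos h']
  exact h'.choose_spec.smoothDegree_eq hU hb h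

lemma isCompact_frontier_of_isBounded {U : Set ℂ} (hb : Bornology.IsBounded U) :
    IsCompact (frontier U) :=
  hb.isCompact_closure.of_isClosed_subset isClosed_frontier frontier_subset_closure

lemma exists_pos_lt_norm_of_isCompact {G : ℂ → ℂ} {K : Set ℂ} (hK : IsCompact K)
    (hG : ContinuousOn G K) (h0 : ∀ z ∈ K, G z ≠ 0) : ∃ m : ℝ, 0 < m ∧ ∀ z ∈ K, m < ‖G z‖ := by
  rcases K.eq_empty_or_nonempty with rfl | hne
  · exact ⟨1, one_pos, by simp⟩
  obtain ⟨x, hx, hmin⟩ := hK.exists_isMinOn hne hG.norm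
  have := norm_pos_iff.2 (h0 x hx)
  refine ⟨‖G x‖ / 2, by positivity, fun z hz => ?_⟩
  have := hmin hz
  simp only [mem_ofPred_eq] at this
  linarith

lemma exists_contDiff_close {G : ℂ → ℂ} {K : Set ℂ} (hK : IsClosed K)
    (hG : ContinuousOn G K) {δ : ℝ} (hδ : 0 < δ) :
    ∃ H : ℂ → ℂ, ContDiff ℝ 2 H ∧ ∀ z ∈ K, ‖H z - G z‖ < δ := by
  obtain ⟨g, hg⟩ := ContinuousMap.exists_restrict_eq hK (⟨K.domRestrict G, hG.domRestrict⟩ : C(K, ℂ))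
  obtain ⟨H, hH, hH', -⟩ := g.continuous.exists_contDiff_approx 2 (ε := fun _ => δ)
    continuous_const (fun _ => hδ)
  refine ⟨H, hH, fun z hz => ?_⟩
  have : g z = G z := DFunLike.congr_fun hg ⟨z, hz⟩
  rw [← this, ← dist_eq_norm]
  exact hH' z

lemma isDegreeApprox_of_close {G H : ℂ → ℂ} {U : Set ℂ} {m δ : ℝ} (hm : 0 < m) (hδ : 2 * δ ≤ m)
    (hH : ContDiffOn ℝ 2 H U) (hc : ContinuousOn H (closure U))
    (hmG : ∀ z ∈ frontier U, m < ‖G z‖) (hGH : ∀ z ∈ frontier U, ‖H z - G z‖ < δ) {s : ℝ}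
    (hs : 2 ≤ s * m) :
    IsDegreeApprox G U (fun z => s * H z) := by
  have hs0 : 0 < s := by
    by_contra h
    nlinarith [not_lt.1 h]
  refine ⟨contDiffOn_const.mul hH, continuousOn_const.mul hc, s, hs0, fun z hz => ?_⟩
  have h1 := hmG z hz
  have h2 := hGH z hz
  refine ⟨by nlinarith, ?_⟩
  rw [← mul_sub, norm_mul, Complex.norm_of_nonneg hs0.le]
  nlinarith

lemma planeDegree_eq_of_segment {U : Set ℂ} (hU : IsOpen U) (hb : Bornology.IsBounded U)
    {G G' : ℂ → ℂ} (hG : ContinuousOn G (frontier U)) (hG' : ContinuousOn G' (frontier U))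
    (hseg : ∀ z ∈ frontier U, ∀ t ∈ Icc (0 : ℝ) 1, G z + t * (G' z - G z) ≠ 0) :
    planeDegree G U = planeDegree G' U := by
  have hF := isCompact_frontier_of_isBounded hb
  obtain ⟨m, hm, hmle⟩ : ∃ m : ℝ, 0 < m ∧
      ∀ z ∈ frontier U, ∀ t ∈ Icc (0 : ℝ) 1, m < ‖G z + t * (G' z - G z)‖ := by
    rcases (frontier U).eq_empty_or_nonempty with h | hne
    · exact ⟨1, one_pos, by simp [h]⟩
    have hcont : ContinuousOn (fun p : ℂ × ℝ => ‖G p.1 + p.2 * (G' p.1 - G p.1)‖)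
        (frontier U ×ˢ Icc (0 : ℝ) 1) := by
      have f1 : ContinuousOn (fun p : ℂ × ℝ => G p.1) (frontier U ×ˢ Icc (0 : ℝ) 1) :=
        hG.comp continuousOn_fst fun p hp => hp.1
      have f2 : ContinuousOn (fun p : ℂ × ℝ => G' p.1) (frontier U ×ˢ Icc (0 : ℝ) 1) :=
        hG'.comp continuousOn_fst fun p hp => hp.1
      have f3 : ContinuousOn (fun p : ℂ × ℝ => (p.2 : ℂ)) (frontier U ×ˢ Icc (0 : ℝ) 1) :=
        (Complex.continuous_ofReal.comp continuous_snd).continuousOn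
      exact (f1.add (f3.mul (f2.sub f1))).norm
    obtain ⟨x, hx, hmin⟩ := (hF.prod isCompact_Icc).exists_isMinOn
      (hne.prod (nonempty_Icc.2 zero_le_one)) hcont
    have h0 := norm_pos_iff.2 (hseg x.1 hx.1 x.2 hx.2)
    refine ⟨_, half_pos h0, fun z hz t ht => ?_⟩
    have := hmin (show (z, t) ∈ _ from ⟨hz, ht⟩)
    simp only [mem_ofPred_eq] at this
    linarith
  obtain ⟨H, hH, hHG⟩ := exists_contDiff_close hF.isClosed hG (half_pos hm)
  obtain ⟨H', hH', hHG'⟩ := exists_contDiff_close hF.isClosed hG' (half_pos hm)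
  have b0 : ∀ z ∈ frontier U, m < ‖G z‖ := fun z hz => by
    simpa using hmle z hz 0 (by simp)
  have b1 : ∀ z ∈ frontier U, m < ‖G' z‖ := fun z hz => by
    simpa using hmle z hz 1 (by simp)
  have hs : 2 ≤ (3 / m) * m := by rw [div_mul_cancel₀ _ hm.ne']; norm_num
  have A := isDegreeApprox_of_close hm (by linarith) hH.contDiffOn hH.continuous.continuousOn b0 hHG
    hs
  have A' := isDegreeApprox_of_close hm (by linarith) hH'.contDiffOn hH'.continuous.continuousOn b1
    hHG' hs
  rw [planeDegree_eq hU hb A, planeDegree_eq hU hb A']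
  refine smoothDegree_eq_of_segment hU hb A.1 A'.1 A.2.1 A'.2.1 fun z hz t ht => ?_
  have h1 := hmle z hz t ht
  have h2 := hHG z hz
  have h3 := hHG' z hz
  have e : ‖(G z + t * (G' z - G z)) - (H z + t * (H' z - H z))‖ ≤ m / 2 := by
    have : (G z + t * (G' z - G z)) - (H z + t * (H' z - H z)) =
      ((1 - t : ℝ) : ℂ) * (-(H z - G z)) + (t : ℂ) * (-(H' z - G' z)) := by push_cast; ring
    rw [this]
    refine (norm_add_le _ _).trans ?_
    rw [norm_mul, norm_mul, Complex.norm_of_nonneg ht.1, norm_neg, norm_neg,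
      Complex.norm_of_nonneg (by linarith [ht.2])]
    nlinarith [ht.1, ht.2]
  have e' := norm_sub_norm_le (G z + t * (G' z - G z)) (H z + t * (H' z - H z))
  have : ((3 / m : ℝ) : ℂ) * H z + t * (((3 / m : ℝ) : ℂ) * H' z - ((3 / m : ℝ) : ℂ) * H z) =
    ((3 / m : ℝ) : ℂ) * (H z + t * (H' z - H z)) := by ring
  rw [this, norm_mul, Complex.norm_of_nonneg (by positivity)]
  have h5 : m / 2 < ‖H z + t * (H' z - H z)‖ := by linarith
  calc (1 : ℝ) < 3 / m * (m / 2) := by field_simp; norm_num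
    _ < _ := by gcongr

lemma planeDegree_congr {U : Set ℂ} (hU : IsOpen U) (hb : Bornology.IsBounded U)
    {G G' : ℂ → ℂ} (hG : ContinuousOn G (frontier U)) (h : EqOn G G' (frontier U))
    (h0 : ∀ z ∈ frontier U, G z ≠ 0) : planeDegree G U = planeDegree G' U := by
  refine planeDegree_eq_of_segment hU hb hG (hG.congr h.symm) fun z hz t _ => ?_
  rw [h hz, sub_self, mul_zero, add_zero, ← h hz]
  exact h0 z hz

lemma planeDegree_homotopy {X : Type*} [TopologicalSpace X] {E : Set X} (hE : IsPreconnected E)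
    {U : Set ℂ} (hU : IsOpen U) (hb : Bornology.IsBounded U) {G : X → ℂ → ℂ}
    (hG : ContinuousOn (Function.uncurry G) (E ×ˢ frontier U))
    (h0 : ∀ e ∈ E, ∀ z ∈ frontier U, G e z ≠ 0) {x y : X} (hx : x ∈ E) (hy : y ∈ E) :
    planeDegree (G x) U = planeDegree (G y) U := by
  have hF := isCompact_frontier_of_isBounded hb
  have hcont : ∀ e ∈ E, ContinuousOn (G e) (frontier U) := fun e he =>
    hG.comp (f := fun z => (e, z)) (by fun_prop) fun z hz => ⟨he, hz⟩
  refine IsPreconnected.induction₂ hE (fun a b => planeDegree (G a) U = planeDegree (G b) U)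
    (fun e he => ?_) (fun _ _ _ _ _ _ h1 h2 => h1.trans h2) (fun _ _ _ _ h => h.symm) hx hy
  obtain ⟨m, hm, hmle⟩ := exists_pos_lt_norm_of_isCompact hF (hcont e he) (h0 e he)
  obtain ⟨v, hv, hv'⟩ := hF.mem_uniformity_of_prod hG he (dist_mem_uniformity hm)
  filter_upwards [hv, self_mem_nhdsWithin] with b hb' hbE
  refine planeDegree_eq_of_segment hU hb (hcont e he) (hcont b hbE) fun z hz t ht h => ?_
  have h1 : dist (G b z) (G e z) < m := hv' b hb' z hz
  have h2 := hmle z hz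
  rw [dist_eq_norm] at h1
  have : G e z = -(t * (G b z - G e z)) := by linear_combination h
  rw [this, norm_neg, norm_mul, Complex.norm_of_nonneg ht.1] at h2
  nlinarith [ht.1, ht.2, norm_nonneg (G b z - G e z)]

lemma planeDegree_excision {U V : Set ℂ} (hU : IsOpen U) (hb : Bornology.IsBounded U)
    (hV : IsOpen V) (hVU : V ⊆ U) {G : ℂ → ℂ} (hG : ContinuousOn G (closure U))
    (h0 : ∀ z ∈ closure U, G z = 0 → z ∈ V) : planeDegree G U = planeDegree G V := by
  set K := closure U \ V with hK
  have hKc : IsCompact K := hb.isCompact_closure.diff hV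
  have hGK : ContinuousOn G K := hG.mono sdiff_subset
  obtain ⟨m, hm, hmle⟩ := exists_pos_lt_norm_of_isCompact hKc hGK fun z hz h => hz.2 (h0 z hz.1 h)
  have hUK : frontier U ⊆ K := by
    intro z hz
    rw [hU.frontier_eq] at hz
    exact ⟨hz.1, fun h => hz.2 (hVU h)⟩
  have hVK : frontier V ⊆ K := by
    intro z hz
    rw [hV.frontier_eq] at hz
    exact ⟨closure_mono hVU hz.1, hz.2⟩
  obtain ⟨H, hH, hHG⟩ := exists_contDiff_close hKc.isClosed hGK (half_pos hm)
  have hs : 2 ≤ (3 / m) * m := by rw [div_mul_cancel₀ _ hm.ne']; norm_num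
  have A := isDegreeApprox_of_close (U := U) hm (by linarith) hH.contDiffOn
    hH.continuous.continuousOn (fun z hz => hmle z (hUK hz)) (fun z hz => hHG z (hUK hz)) hs
  have A' := isDegreeApprox_of_close (U := V) hm (by linarith) hH.contDiffOn
    hH.continuous.continuousOn (fun z hz => hmle z (hVK hz)) (fun z hz => hHG z (hVK hz)) hs
  rw [planeDegree_eq hU hb A, planeDegree_eq hV (hb.subset hVU) A']
  refine setIntegral_eq_of_subset_of_forall_sdiff_eq_zero hU.measurableSet hVU fun z hz => ?_
  have hzK : z ∈ K := ⟨subset_closure hz.1, hz.2⟩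
  have h1 := hmle z hzK
  have h2 := hHG z hzK
  have e' := norm_sub_norm_le (G z) (H z)
  rw [norm_sub_rev] at e'
  rw [planeBump_eq_zero, zero_mul]
  rw [norm_mul, Complex.norm_of_nonneg (by positivity)]
  calc (1 : ℝ) ≤ 3 / m * (m / 2) := by field_simp; norm_num
    _ ≤ _ := by gcongr; linarith

lemma jac_const_mul (s : ℝ) {H : ℂ → ℂ} {z : ℂ} (hH : DifferentiableAt ℝ H z) :
    jac (fun z => s * H z) z = s ^ 2 * jac H z := by
  have : fderiv ℝ (fun z => (s : ℂ) * H z) z = (s : ℂ) • fderiv ℝ H z :=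
    fderiv_const_mul hH (s : ℂ)
  unfold jac
  rw [this]
  simp
  ring

lemma planeDegree_nonneg {U : Set ℂ} (hU : IsOpen U) (hb : Bornology.IsBounded U) {G : ℂ → ℂ}
    (hG : ContDiffOn ℝ 2 G U) (hc : ContinuousOn G (closure U))
    (h0 : ∀ z ∈ frontier U, G z ≠ 0) (hJ : ∀ z ∈ U, 0 ≤ jac G z) : 0 ≤ planeDegree G U := by
  have hF := isCompact_frontier_of_isBounded hb
  obtain ⟨m, hm, hmle⟩ := exists_pos_lt_norm_of_isCompact hF (hc.mono frontier_subset_closure) h0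
  have hs : 2 ≤ (3 / m) * m := by rw [div_mul_cancel₀ _ hm.ne']; norm_num
  have A := isDegreeApprox_of_close hm (δ := m / 2) (by linarith) hG hc hmle
    (fun z hz => by simpa using hm) hs
  rw [planeDegree_eq hU hb A]
  refine setIntegral_nonneg hU.measurableSet fun z hz => ?_
  rw [jac_const_mul _ ((hG.contDiffAt (hU.mem_nhds hz)).differentiableAt (by simp))]
  exact mul_nonneg (planeBump_nonneg _) (mul_nonneg (sq_nonneg _) (hJ z hz))

lemma jac_of_hasDerivAt {G : ℂ → ℂ} {z g : ℂ} (h : HasDerivAt G g z) : jac G z = ‖g‖ ^ 2 := by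
  have : HasFDerivAt G _ z := (h.hasFDerivAt.restrictScalars ℝ)
  unfold jac
  rw [this.fderiv, ← Complex.normSq_eq_norm_sq, Complex.normSq_apply]
  simp

lemma planeBump_scale_integral {s : ℝ} (hs : 0 < s) (c : ℂ) :
    ∫ z, planeBump (s * (z - c)) = (s ^ 2)⁻¹ := by
  rw [integral_sub_right_eq_self (fun z => planeBump (s * z)) c]
  have := Measure.integral_comp_smul (volume : Measure ℂ) planeBump s
  simp only [Complex.real_smul, Complex.finrank_real_complex, integral_planeBump] at this
  rw [this, abs_of_pos (by positivity)]
  simp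

lemma planeDegree_sub {U : Set ℂ} (hU : IsOpen U) (hb : Bornology.IsBounded U) {c : ℂ}
    (hc : c ∈ U) : planeDegree (fun z => z - c) U = 1 := by
  obtain ⟨m, hm, hmU⟩ := Metric.isOpen_iff.1 hU c hc
  have hfar : ∀ z, z ∉ U → m ≤ ‖z - c‖ := fun z hz => by
    by_contra h
    exact hz (hmU (by rw [mem_ball, dist_eq_norm]; exact not_le.1 h))
  have hd : ContDiff ℝ 2 (fun z : ℂ => z - c) := contDiff_id.sub contDiff_const
  have A := isDegreeApprox_of_close (G := fun z => z - c) (H := fun z => z - c) (U := U)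
    (m := m / 2) (δ := m / 4) (s := 4 / m) (half_pos hm) (by linarith) hd.contDiffOn
    hd.continuous.continuousOn
    (fun z hz => by
      rw [hU.frontier_eq] at hz
      have := hfar z hz.2
      linarith) (fun z hz => by simpa using hm) (by field_simp; norm_num)
  rw [planeDegree_eq hU hb A, smoothDegree, setIntegral_eq_integral_of_forall_compl_eq_zero]
  · have : ∀ z, jac (fun z => ((4 / m : ℝ) : ℂ) * (z - c)) z = (4 / m) ^ 2 := by
      intro z
      rw [jac_const_mul _ (by fun_prop), jac_of_hasDerivAt ((hasDerivAt_id' z).sub_const c)]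
      simp
    simp_rw [this]
    rw [integral_mul_const, planeBump_scale_integral (by positivity)]
    field_simp
  · intro z hz
    rw [planeBump_eq_zero, zero_mul]
    rw [norm_mul, Complex.norm_of_nonneg (by positivity)]
    calc (1 : ℝ) ≤ 4 / m * m := by field_simp; norm_num
      _ ≤ _ := by gcongr; exact hfar z hz

lemma planeDegree_mul_sub {U : Set ℂ} (hU : IsOpen U) (hb : Bornology.IsBounded U) {c a : ℂ}
    (hc : c ∈ U) (ha : a ≠ 0) : planeDegree (fun z => a * (z - c)) U = 1 := by
  have hE : IsPreconnected ({0}ᶜ : Set ℂ) :=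
    (isConnected_compl_singleton_of_one_lt_rank (by simp) _).isPreconnected
  rw [← planeDegree_sub hU hb hc]
  have := planeDegree_homotopy hE hU hb (G := fun a z => a * (z - c))
    (by unfold Function.uncurry; fun_prop) (fun e he z hz h => ?_) (x := a) (y := 1) ha (by simp)
  · simpa using this
  · rcases mul_eq_zero.1 h with h | h
    · exact he h
    · rw [hU.frontier_eq, sub_eq_zero.1 h] at hz
      exact hz.2 hc

lemma planeDegree_conj_sub {U : Set ℂ} (hU : IsOpen U) (hb : Bornology.IsBounded U) {c : ℂ}
    (hc : c ∈ U) : planeDegree (fun z => (starRingEnd ℂ) (z - c)) U = -1 := by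
  obtain ⟨m, hm, hmU⟩ := Metric.isOpen_iff.1 hU c hc
  have hfar : ∀ z, z ∉ U → m ≤ ‖z - c‖ := fun z hz => by
    by_contra h
    exact hz (hmU (by rw [mem_ball, dist_eq_norm]; exact not_le.1 h))
  have hd : ContDiff ℝ 2 (fun z : ℂ => (starRingEnd ℂ) (z - c)) :=
    Complex.conjCLE.contDiff.comp (contDiff_id.sub contDiff_const)
  have A := isDegreeApprox_of_close (G := fun z => (starRingEnd ℂ) (z - c))
    (H := fun z => (starRingEnd ℂ) (z - c)) (U := U)
    (m := m / 2) (δ := m / 4) (s := 4 / m) (half_pos hm) (by linarith) hd.contDiffOn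
    hd.continuous.continuousOn
    (fun z hz => by
      rw [hU.frontier_eq] at hz
      have := hfar z hz.2
      rw [Complex.norm_conj]
      linarith) (fun z hz => by simpa using hm) (by field_simp; norm_num)
  rw [planeDegree_eq hU hb A, smoothDegree, setIntegral_eq_integral_of_forall_compl_eq_zero]
  · have : ∀ z, jac (fun z => ((4 / m : ℝ) : ℂ) * (starRingEnd ℂ) (z - c)) z = -(4 / m) ^ 2 := by
      intro z
      rw [jac_const_mul _ (hd.differentiable (by simp) z)]
      have h1 : HasFDerivAt (fun z : ℂ => z - c) (ContinuousLinearMap.id ℝ ℂ) z :=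
        (hasFDerivAt_id z).sub_const c
      have h2 : HasFDerivAt (fun z : ℂ => (starRingEnd ℂ) (z - c))
          ((Complex.conjCLE : ℂ →L[ℝ] ℂ).comp (ContinuousLinearMap.id ℝ ℂ)) z :=
        (Complex.conjCLE : ℂ →L[ℝ] ℂ).hasFDerivAt.comp z h1
      unfold jac
      rw [h2.fderiv]
      simp
    simp_rw [this]
    have e : ∀ z, planeBump (((4 / m : ℝ) : ℂ) * (starRingEnd ℂ) (z - c)) =
        lineBump ((4 / m : ℝ) * (z - c).re) * lineBump (-((4 / m : ℝ) * (z - c).im)) := by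
      intro z
      rw [planeBump, Complex.re_ofReal_mul, Complex.im_ofReal_mul, Complex.conj_re, Complex.conj_im,
        mul_neg]
    have heven : ∀ x, lineBump (-x) = lineBump x := fun x => ContDiffBump.normed_neg _ x
    have e' : ∀ z, planeBump (((4 / m : ℝ) : ℂ) * (starRingEnd ℂ) (z - c)) =
        planeBump (((4 / m : ℝ) : ℂ) * (z - c)) := by
      intro z
      rw [e, heven, planeBump, Complex.re_ofReal_mul, Complex.im_ofReal_mul]
    simp_rw [e']
    rw [integral_mul_const, planeBump_scale_integral (by positivity)]
    field_simp
  · intro z hz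
    rw [planeBump_eq_zero, zero_mul]
    rw [norm_mul, Complex.norm_of_nonneg (by positivity), Complex.norm_conj]
    calc (1 : ℝ) ≤ 4 / m * m := by field_simp; norm_num
      _ ≤ _ := by gcongr; exact hfar z hz

/-- `f` maps the circle `∂B(c, r)` onto `∂B(c', r')` with an increasing lift to the line. -/
def IsPosOriented (f : ℂ → ℂ) (c : ℂ) (r : ℝ) (c' : ℂ) (r' : ℝ) : Prop :=
  ∃ φ : ℝ → ℝ, Continuous φ ∧ StrictMono φ ∧ (∀ θ, φ (θ + 2 * Real.pi) = φ θ + 2 * Real.pi) ∧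
    ∀ θ : ℝ, f (c + r * Complex.exp (θ * Complex.I)) = c' + r' * Complex.exp (φ θ * Complex.I)

lemma mem_sphere_circle (c : ℂ) {r : ℝ} (hr : 0 ≤ r) (θ : ℝ) :
    c + r * Complex.exp (θ * Complex.I) ∈ sphere c r := by
  rw [mem_sphere, dist_eq_norm, add_sub_cancel_left, norm_mul, Complex.norm_exp_ofReal_mul_I,
    mul_one, Complex.norm_of_nonneg hr]

lemma exp_ofReal_mul_I_eq_iff {x y : ℝ} :
    Complex.exp (x * Complex.I) = Complex.exp (y * Complex.I) ↔
      ∃ n : ℤ, x = y + n * (2 * Real.pi) := by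
  rw [Complex.exp_eq_exp_iff_exists_int]
  refine exists_congr fun n => ⟨fun h => ?_, fun h => ?_⟩
  · have := congrArg Complex.im h
    simpa using this
  · rw [h]; push_cast; ring

lemma exists_circle_lift {f : ℂ → ℂ} {c c' : ℂ} {r r' : ℝ} (hr : 0 < r) (hr' : 0 < r')
    (hc : ContinuousOn f (sphere c r)) (hm : MapsTo f (sphere c r) (sphere c' r')) :
    ∃ φ : ℝ → ℝ, Continuous φ ∧
      ∀ θ : ℝ, f (c + r * Complex.exp (θ * Complex.I)) = c' + r' * Complex.exp (φ θ * Complex.I) := by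
  have hn : ∀ θ : ℝ, (f (c + r * Complex.exp (θ * Complex.I)) - c') / r' ∈ Submonoid.unitSphere ℂ := by
    intro θ
    rw [← SetLike.mem_coe, Submonoid.coe_unitSphere, mem_sphere_zero_iff_norm, norm_div, ← dist_eq_norm,
      mem_sphere.1 (hm (mem_sphere_circle c hr.le θ)), Complex.norm_of_nonneg hr'.le,
      div_self hr'.ne']
  have hcont : Continuous fun θ : ℝ => (f (c + r * Complex.exp (θ * Complex.I)) - c') / r' := by
    have : Continuous fun θ : ℝ => f (c + r * Complex.exp (θ * Complex.I)) :=
      hc.comp_continuous (by fun_prop) fun θ => mem_sphere_circle c hr.le θ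
    exact (this.sub continuous_const).div_const _
  set h : C(ℝ, Circle) := ⟨fun θ => ⟨_, hn θ⟩, hcont.subtype_mk _⟩ with hh
  obtain ⟨e₀, he₀⟩ := Circle.exp_surjective (h 0)
  obtain ⟨F, ⟨-, hF⟩, -⟩ := Circle.isCoveringMap_exp.existsUnique_continuousMap_lifts h 0 e₀ he₀
  refine ⟨F, F.continuous, fun θ => ?_⟩
  have h1 := congrArg (fun z : Circle => (z : ℂ)) (congrFun hF θ)
  simp only [Function.comp_apply, Circle.coe_exp] at h1
  rw [h1]
  change _ = c' + r' * ((f (c + r * Complex.exp (θ * Complex.I)) - c') / r')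
  have : (r' : ℂ) ≠ 0 := by exact_mod_cast hr'.ne'
  field_simp
  ring

lemma exists_oriented_lift {f : ℂ → ℂ} {c c' : ℂ} {r r' : ℝ} (hr : 0 < r) (hr' : 0 < r')
    (hc : ContinuousOn f (sphere c r)) (hm : MapsTo f (sphere c r) (sphere c' r'))
    (hi : InjOn f (sphere c r)) :
    IsPosOriented f c r c' r' ∨
      IsPosOriented (fun z => (starRingEnd ℂ) (f z)) c r ((starRingEnd ℂ) c') r' := by
  obtain ⟨φ, hφ, hφf⟩ := exists_circle_lift hr hr' hc hm
  have hpi := Real.two_pi_pos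
  have hr0 : (r : ℂ) ≠ 0 := by exact_mod_cast hr.ne'
  have hr0' : (r' : ℂ) ≠ 0 := by exact_mod_cast hr'.ne'
  have hinj : ∀ x y : ℝ, (∃ n : ℤ, φ x = φ y + n * (2 * Real.pi)) →
      ∃ n : ℤ, x = y + n * (2 * Real.pi) := by
    intro x y h
    rw [← exp_ofReal_mul_I_eq_iff] at h ⊢
    have := hi (mem_sphere_circle c hr.le x) (mem_sphere_circle c hr.le y) (by
      rw [hφf, hφf, h])
    exact mul_left_cancel₀ hr0 (add_left_cancel this)
  have hper : ∀ x : ℝ, ∃ n : ℤ, φ (x + 2 * Real.pi) = φ x + n * (2 * Real.pi) := by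
    intro x
    rw [← exp_ofReal_mul_I_eq_iff]
    have h1 := hφf (x + 2 * Real.pi)
    have h2 : Complex.exp ((x + 2 * Real.pi : ℝ) * Complex.I) = Complex.exp (x * Complex.I) :=
      exp_ofReal_mul_I_eq_iff.2 ⟨1, by simp⟩
    rw [h2, hφf x] at h1
    exact (mul_left_cancel₀ hr0' (add_left_cancel h1)).symm
  -- no two points at distance less than `2π` have equivalent images
  have hne : ∀ x y : ℝ, x < y → y < x + 2 * Real.pi → ∀ n : ℤ, φ x ≠ φ y + n * (2 * Real.pi) := by
    intro x y h1 h2 n h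
    obtain ⟨k, hk⟩ := hinj x y ⟨n, h⟩
    have h3 : (-1 : ℝ) < k := by
      by_contra h'
      nlinarith [not_lt.1 h']
    have h4 : (k : ℝ) < 0 := by
      by_contra h'
      nlinarith [not_lt.1 h']
    have h3' : (-1 : ℤ) < k := by exact_mod_cast h3
    have h4' : k < (0 : ℤ) := by exact_mod_cast h4
    omega
  choose N hN using hper
  -- the winding number is nonzero
  have hN0 : ∀ x, N x ≠ 0 := by
    intro x h0
    have hx := hN x
    rw [h0] at hx
    simp only [Int.cast_zero, zero_mul, add_zero] at hx
    have hp := Real.pi_pos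
    have hA : φ x ≠ φ (x + Real.pi) := by
      simpa using hne x (x + Real.pi) (by linarith) (by linarith) 0
    set v := (φ x + φ (x + Real.pi)) / 2 with hv
    have key : ∃ s ∈ Icc x (x + Real.pi), φ s = v := by
      rcases lt_or_gt_of_ne hA with h | h
      · exact intermediate_value_Icc (by linarith) hφ.continuousOn ⟨by linarith, by linarith⟩
      · exact intermediate_value_Icc' (by linarith) hφ.continuousOn ⟨by linarith, by linarith⟩
    have key' : ∃ s ∈ Icc (x + Real.pi) (x + 2 * Real.pi), φ s = v := by
      rcases lt_or_gt_of_ne hA with h | h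
      · exact intermediate_value_Icc' (by linarith) hφ.continuousOn ⟨by linarith, by linarith⟩
      · exact intermediate_value_Icc (by linarith) hφ.continuousOn ⟨by linarith, by linarith⟩
    obtain ⟨s, hs, hsv⟩ := key
    obtain ⟨s', hs', hsv'⟩ := key'
    have e1 : s ≠ x := by rintro rfl; apply hA; linarith
    have e2 : s ≠ x + Real.pi := by rintro rfl; apply hA; linarith
    have e3 : s' ≠ x + 2 * Real.pi := by rintro rfl; apply hA; linarith
    have l1 := lt_of_le_of_ne hs.1 e1.symm
    have l2 := lt_of_le_of_ne hs.2 e2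
    have l3 := lt_of_le_of_ne hs'.2 e3
    exact hne s s' (by linarith [hs'.1]) (by linarith) 0 (by rw [hsv, hsv']; simp)
  -- injectivity
  have hmono : StrictMono φ ∨ StrictAnti φ := by
    have hNc : ∀ x, N x = N 0 := by
      intro x
      have hc : Continuous fun x => (φ (x + 2 * Real.pi) - φ x) / (2 * Real.pi) := by fun_prop
      have : ∀ x, (φ (x + 2 * Real.pi) - φ x) / (2 * Real.pi) = N x := by
        intro x; rw [hN x]; field_simp; ring
      simp_rw [this] at hc
      have hcN : Continuous N := by
        rw [Int.isClosedEmbedding_coe_real.isInducing.continuous_iff]; exact hc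
      exact PreconnectedSpace.constant inferInstance hcN
    refine hφ.strictMono_of_inj fun x y hxy => ?_
    obtain ⟨k, hk⟩ := hinj x y ⟨0, by simp [hxy]⟩
    have hmul : ∀ k : ℕ, ∀ y, φ (y + k * (2 * Real.pi)) = φ y + k * (N 0 * (2 * Real.pi)) := by
      intro k
      induction k with
      | zero => simp
      | succ k ih =>
        intro y
        have := hN (y + k * (2 * Real.pi))
        rw [ih, hNc (y + k * (2 * Real.pi))] at this
        push_cast
        rw [show y + ((k : ℝ) + 1) * (2 * Real.pi) = y + k * (2 * Real.pi) + 2 * Real.pi by ring,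
          this]
        ring
    have hN0' : (N 0 : ℝ) ≠ 0 := by exact_mod_cast hN0 0
    rcases le_total 0 k with h | h
    · obtain ⟨m, rfl⟩ := Int.eq_ofNat_of_zero_le h
      have := hmul m y
      have e : x = y + (m : ℝ) * (2 * Real.pi) := by simpa using hk
      rw [← e, hxy] at this
      have h0 : (m : ℝ) * (N 0 * (2 * Real.pi)) = 0 := by linarith
      have : (m : ℝ) = 0 := by simpa [hN0 0, Real.pi_ne_zero] using h0
      rw [e, this]; simp
    · obtain ⟨m, hm'⟩ := Int.eq_ofNat_of_zero_le (neg_nonneg.2 h)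
      have := hmul m x
      have hkm : (k : ℝ) = -(m : ℝ) := by
        have : k = -(m : ℤ) := by omega
        rw [this]; simp
      have e : y = x + (m : ℝ) * (2 * Real.pi) := by rw [hk, hkm]; ring
      rw [← e, hxy] at this
      have h0 : (m : ℝ) * (N 0 * (2 * Real.pi)) = 0 := by linarith
      have : (m : ℝ) = 0 := by simpa [hN0 0, Real.pi_ne_zero] using h0
      rw [e, this]; simp
  rcases hmono with hmono | hanti
  · refine Or.inl ⟨φ, hφ, hmono, fun x => ?_, hφf⟩
    have h1 : φ x < φ (x + 2 * Real.pi) := hmono (by linarith)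
    rw [hN x] at h1 ⊢
    have h2 : (0 : ℝ) < N x := by
      by_contra h'
      nlinarith [not_lt.1 h']
    have h3 : ¬ (1 : ℤ) < N x := by
      intro h
      have h' : (1 : ℝ) < N x := by exact_mod_cast h
      obtain ⟨s, hs, hsv⟩ : φ x + 2 * Real.pi ∈ φ '' Ioo x (x + 2 * Real.pi) :=
        intermediate_value_Ioo (by linarith) hφ.continuousOn
          ⟨by linarith, by rw [hN x]; nlinarith⟩
      exact hne x s hs.1 hs.2 (-1) (by rw [hsv]; push_cast; ring)
    have h2' : (0 : ℤ) < N x := by exact_mod_cast h2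
    have : N x = 1 := by omega
    rw [this]; simp
  · right
    refine ⟨fun x => -φ x, hφ.neg, fun x y h => neg_lt_neg (hanti h), fun x => ?_, fun θ => ?_⟩
    · have h1 : φ (x + 2 * Real.pi) < φ x := hanti (by linarith)
      rw [hN x] at h1
      simp only [hN x]
      have h2 : (N x : ℝ) < 0 := by
        by_contra h'
        nlinarith [not_lt.1 h']
      have h3 : ¬ N x < (-1 : ℤ) := by
        intro h
        have h' : (N x : ℝ) < -1 := by exact_mod_cast h
        obtain ⟨s, hs, hsv⟩ : φ x - 2 * Real.pi ∈ φ '' Ioo x (x + 2 * Real.pi) :=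
          intermediate_value_Ioo' (by linarith) hφ.continuousOn
            ⟨by rw [hN x]; nlinarith, by linarith⟩
        exact hne x s hs.1 hs.2 1 (by rw [hsv]; push_cast; ring)
      have h2' : N x < (0 : ℤ) := by exact_mod_cast h2
      have : N x = -1 := by omega
      rw [this]; push_cast; ring
    · simp only [hφf, map_add, map_mul, Complex.conj_ofReal, ← Complex.exp_conj, Complex.conj_I]
      push_cast
      ring_nf

/-- The angular displacement of a positively oriented circle homeomorphism. -/
lemma IsPosOriented.exists_phase {f : ℂ → ℂ} {c c' : ℂ} {r r' : ℝ}
    (h : IsPosOriented f c r c' r') :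
    ∃ P : ℂ → ℝ, ContinuousOn P (sphere 0 1) ∧
      (∀ u ∈ sphere (0 : ℂ) 1, f (c + r * u) = c' + r' * (u * Complex.exp (P u * Complex.I))) ∧
      ∀ u ∈ sphere (0 : ℂ) 1, ∀ v ∈ sphere (0 : ℂ) 1, u ≠ v →
        ∃ θ₁ θ₂ : ℝ, u = Complex.exp (θ₁ * Complex.I) ∧ v = Complex.exp (θ₂ * Complex.I) ∧
          θ₁ < θ₂ ∧ θ₂ < θ₁ + 2 * Real.pi ∧
          -(θ₂ - θ₁) < P v - P u ∧ P v - P u < 2 * Real.pi - (θ₂ - θ₁) := by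
  obtain ⟨φ, hφ, hmono, hper, hφf⟩ := h
  have hψ : Function.Periodic (fun θ => φ θ - θ) (2 * Real.pi) := fun θ => by
    simp only [hper]; ring
  set L : Real.Angle → ℝ := hψ.lift with hL
  have hLc : Continuous L := by
    refine Continuous.quotient_liftOn' (hφ.sub continuous_id) _
  have hP : ∀ θ : ℝ, L (Complex.arg (Complex.exp (θ * Complex.I))) = φ θ - θ := by
    intro θ
    have h1 : ((Complex.arg (Complex.exp (θ * Complex.I)) : ℝ) : Real.Angle) = (θ : Real.Angle) := by
      rw [Complex.exp_mul_I]
      have := Complex.arg_cos_add_sin_mul_I_coe_angle (θ : Real.Angle)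
      simpa using this
    rw [h1]
    exact hψ.lift_coe θ
  have harg : ∀ u ∈ sphere (0 : ℂ) 1, Complex.exp (Complex.arg u * Complex.I) = u := by
    intro u hu
    have := Complex.norm_mul_exp_arg_mul_I u
    rwa [mem_sphere_zero_iff_norm.1 hu, Complex.ofReal_one, one_mul] at this
  refine ⟨fun u => L (Complex.arg u), ?_, ?_, ?_⟩
  · intro u hu
    have : u ≠ 0 := by rintro rfl; simp at hu
    exact (hLc.continuousAt.comp (Complex.continuousAt_arg_coe_angle this)).continuousWithinAt
  · intro u hu
    obtain ⟨θ, rfl⟩ : ∃ θ : ℝ, Complex.exp (θ * Complex.I) = u := ⟨_, harg u hu⟩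
    simp only [hφf, hP]
    rw [← Complex.exp_add]
    congr 3
    push_cast; ring
  · intro u hu v hv huv
    obtain ⟨θ₁, h1, θ₂, h2, h3, h4⟩ : ∃ θ₁ : ℝ, u = Complex.exp (θ₁ * Complex.I) ∧
        ∃ θ₂ : ℝ, v = Complex.exp (θ₂ * Complex.I) ∧ θ₁ < θ₂ ∧ θ₂ < θ₁ + 2 * Real.pi := by
      have b1 := Complex.neg_pi_lt_arg u
      have b2 := Complex.arg_le_pi u
      have b3 := Complex.neg_pi_lt_arg v
      have b4 := Complex.arg_le_pi v
      refine ⟨Complex.arg u, (harg u hu).symm, ?_⟩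
      rcases lt_trichotomy (Complex.arg u) (Complex.arg v) with h | h | h
      · exact ⟨Complex.arg v, (harg v hv).symm, h, by linarith⟩
      · exact absurd ((harg u hu).symm.trans (by rw [h, harg v hv])) huv
      · refine ⟨Complex.arg v + 2 * Real.pi, ?_, by linarith, by linarith⟩
        rw [exp_ofReal_mul_I_eq_iff.2 ⟨1, by rw [Int.cast_one, one_mul]⟩, harg v hv]
    refine ⟨θ₁, θ₂, h1, h2, h3, h4, ?_⟩
    rw [h1, h2]
    simp only [hP]
    have e1 := hmono h3
    have e2 := hmono h4
    rw [hper] at e2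
    constructor <;> linarith

lemma one_sub_mul_conj_mem_slitPlane {s u : ℂ} (hs : ‖s‖ < 1) (hu : ‖u‖ ≤ 1) :
    1 - s * (starRingEnd ℂ) u ∈ Complex.slitPlane := by
  left
  have h1 : (s * (starRingEnd ℂ) u).re ≤ ‖s * (starRingEnd ℂ) u‖ := Complex.re_le_norm _
  rw [norm_mul, Complex.norm_conj] at h1
  have : ‖s‖ * ‖u‖ < 1 := by nlinarith [norm_nonneg s, norm_nonneg u]
  simp only [Complex.sub_re, Complex.one_re]
  linarith

lemma mul_exp_two_arg {s u : ℂ} (hs : ‖s‖ < 1) (hu : ‖u‖ = 1) :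
    u * Complex.exp ((2 * Complex.arg (1 - s * (starRingEnd ℂ) u) : ℝ) * Complex.I) =
      (u - s) / (1 - (starRingEnd ℂ) s * u) := by
  set w := 1 - s * (starRingEnd ℂ) u with hw
  have hw0 : w ≠ 0 := Complex.slitPlane_ne_zero (one_sub_mul_conj_mem_slitPlane hs hu.le)
  have hcw : (starRingEnd ℂ) w = 1 - (starRingEnd ℂ) s * u := by
    simp [hw]
  have hcw0 : (starRingEnd ℂ) w ≠ 0 := by simpa using hw0
  rw [← hcw, eq_div_iff hcw0]
  have h1 := Complex.norm_mul_exp_arg_mul_I w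
  have h2 : (starRingEnd ℂ) w = ‖w‖ * Complex.exp (-(Complex.arg w * Complex.I)) := by
    have h3 := congrArg (starRingEnd ℂ) h1
    rw [map_mul, Complex.conj_ofReal, ← Complex.exp_conj, map_mul, Complex.conj_ofReal,
      Complex.conj_I, mul_neg] at h3
    exact h3.symm
  have h3 : Complex.exp ((2 * Complex.arg w : ℝ) * Complex.I) *
      Complex.exp (-(Complex.arg w * Complex.I)) = Complex.exp (Complex.arg w * Complex.I) := by
    rw [← Complex.exp_add]
    congr 1
    push_cast
    ring
  have h4 : u * (starRingEnd ℂ) u = 1 := by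
    rw [Complex.mul_conj, Complex.normSq_eq_norm_sq, hu]; simp
  calc _ = u * (‖w‖ * (Complex.exp ((2 * Complex.arg w : ℝ) * Complex.I) *
      Complex.exp (-(Complex.arg w * Complex.I)))) := by rw [h2]; ring
    _ = u * w := by rw [h3, h1]
    _ = u - s := by rw [hw]; linear_combination -s * h4

/-- Boundary rotations of disc automorphisms interpolate any two admissible displacements. -/
lemma exists_arg_interpolation {θ₁ θ₂ p q : ℝ} (h1 : θ₁ < θ₂) (h2 : θ₂ < θ₁ + 2 * Real.pi)
    (h3 : -(θ₂ - θ₁) < q - p) (h4 : q - p < 2 * Real.pi - (θ₂ - θ₁)) :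
    ∃ (s : ℂ) (β : ℝ), ‖s‖ < 1 ∧
      β + 2 * Complex.arg (1 - s * (starRingEnd ℂ) (Complex.exp (θ₁ * Complex.I))) = p ∧
      β + 2 * Complex.arg (1 - s * (starRingEnd ℂ) (Complex.exp (θ₂ * Complex.I))) = q := by
  set m := (θ₂ - θ₁) / 4 with hm
  have hm0 : 0 < m := by rw [hm]; linarith
  have hm1 : m < Real.pi / 2 := by rw [hm]; linarith
  have hsin : 0 < Real.sin m := Real.sin_pos_of_pos_of_lt_pi hm0 (by linarith)
  have hcos : 0 < Real.cos m := Real.cos_pos_of_mem_Ioo ⟨by linarith, hm1⟩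
  set w : ℝ → ℂ := fun σ => 1 - σ * Complex.exp (-(2 * m : ℝ) * Complex.I) with hwdef
  have hre : ∀ σ, (w σ).re = 1 - σ * Real.cos (2 * m) := by
    intro σ
    simp only [hwdef, Complex.sub_re, Complex.one_re, Complex.re_ofReal_mul]
    rw [← Complex.ofReal_neg, Complex.exp_ofReal_mul_I_re, Real.cos_neg]
  have him : ∀ σ, (w σ).im = σ * Real.sin (2 * m) := by
    intro σ
    simp only [hwdef, Complex.sub_im, Complex.one_im, Complex.im_ofReal_mul]
    rw [← Complex.ofReal_neg, Complex.exp_ofReal_mul_I_im, Real.sin_neg]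
    ring
  have hcos2 : |Real.cos (2 * m)| < 1 := by
    rw [abs_lt, Real.cos_two_mul]
    have := Real.sin_sq_add_cos_sq m
    constructor <;> nlinarith
  have hslit : ∀ σ ∈ Icc (-1 : ℝ) 1, w σ ∈ Complex.slitPlane := by
    intro σ hσ
    left
    rw [hre]
    have : |σ * Real.cos (2 * m)| < 1 := by
      rw [abs_mul]
      have := abs_le.2 hσ
      nlinarith [abs_nonneg σ, abs_nonneg (Real.cos (2 * m))]
    linarith [(abs_lt.1 this).2]
  have hcont : ContinuousOn (fun σ => 4 * Complex.arg (w σ)) (Icc (-1) 1) := by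
    intro σ hσ
    refine ContinuousAt.continuousWithinAt ?_
    have hwc : Continuous w := by fun_prop
    exact continuousAt_const.mul
      (ContinuousAt.comp (Complex.continuousAt_arg (hslit σ hσ)) hwc.continuousAt)
  have e1 : Complex.arg (w 1) = Real.pi / 2 - m := by
    have : w 1 = (2 * Real.sin m : ℝ) * ((Real.cos (Real.pi / 2 - m) : ℝ) +
        (Real.sin (Real.pi / 2 - m) : ℝ) * Complex.I) := by
      apply Complex.ext
      · rw [hre, Complex.re_ofReal_mul, Real.cos_two_mul, Real.cos_pi_div_two_sub,
          Complex.add_re, Complex.ofReal_re, Complex.re_ofReal_mul, Complex.I_re]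
        have := Real.sin_sq_add_cos_sq m
        nlinarith
      · rw [him, Complex.im_ofReal_mul, Real.sin_two_mul, Real.sin_pi_div_two_sub,
          Complex.add_im, Complex.ofReal_im, Complex.im_ofReal_mul, Complex.I_im]
        ring
    rw [this, Complex.ofReal_cos, Complex.ofReal_sin,
      Complex.arg_mul_cos_add_sin_mul_I (by positivity)]
    constructor <;> linarith
  have e2 : Complex.arg (w (-1)) = - m := by
    have : w (-1) = (2 * Real.cos m : ℝ) * ((Real.cos (-m) : ℝ) +
        (Real.sin (-m) : ℝ) * Complex.I) := by
      apply Complex.ext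
      · rw [hre, Complex.re_ofReal_mul, Real.cos_two_mul, Real.cos_neg,
          Complex.add_re, Complex.ofReal_re, Complex.re_ofReal_mul, Complex.I_re]
        ring
      · rw [him, Complex.im_ofReal_mul, Real.sin_two_mul, Real.sin_neg,
          Complex.add_im, Complex.ofReal_im, Complex.im_ofReal_mul, Complex.I_im]
        ring
    rw [this, Complex.ofReal_cos, Complex.ofReal_sin,
      Complex.arg_mul_cos_add_sin_mul_I (by positivity)]
    constructor <;> linarith
  obtain ⟨σ, hσ, hσq⟩ : q - p ∈ (fun σ => 4 * Complex.arg (w σ)) '' Ioo (-1) 1 := by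
    refine intermediate_value_Ioo (by norm_num) hcont ⟨?_, ?_⟩
    · simp only [e2]; rw [hm]; linarith
    · simp only [e1]; rw [hm]; linarith
  simp only at hσq
  have hslitσ := hslit σ ⟨hσ.1.le, hσ.2.le⟩
  have harg : Complex.arg ((starRingEnd ℂ) (w σ)) = -Complex.arg (w σ) := by
    rw [Complex.arg_conj, if_neg (Complex.slitPlane_arg_ne_pi hslitσ)]
  have k1 : 1 - σ * Complex.exp (((θ₁ + θ₂) / 2 : ℝ) * Complex.I) *
      (starRingEnd ℂ) (Complex.exp (θ₁ * Complex.I)) = (starRingEnd ℂ) (w σ) := by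
    simp only [hwdef, ← Complex.exp_conj, map_sub, map_one, map_mul, Complex.conj_ofReal,
      Complex.conj_I, mul_assoc, ← Complex.exp_add, map_neg]
    congr 3
    rw [hm]
    push_cast
    ring
  have k2 : 1 - σ * Complex.exp (((θ₁ + θ₂) / 2 : ℝ) * Complex.I) *
      (starRingEnd ℂ) (Complex.exp (θ₂ * Complex.I)) = w σ := by
    simp only [hwdef, ← Complex.exp_conj, map_mul, Complex.conj_ofReal,
      Complex.conj_I, mul_assoc, ← Complex.exp_add]
    congr 3
    rw [hm]
    push_cast
    ring
  refine ⟨σ * Complex.exp (((θ₁ + θ₂) / 2 : ℝ) * Complex.I), p + 2 * Complex.arg (w σ), ?_, ?_, ?_⟩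
  · rw [norm_mul, Complex.norm_exp_ofReal_mul_I, mul_one, Complex.norm_real, Real.norm_eq_abs,
      abs_lt]
    exact hσ
  · rw [k1, harg]; ring
  · rw [k2]; linarith

lemma frontier_ball' {c : ℂ} {r : ℝ} (hr : 0 < r) : frontier (ball c r) = sphere c r :=
  frontier_ball c hr.ne'

lemma eq_add_mul_of_mem_sphere {c z : ℂ} {r : ℝ} (hr : 0 < r) (hz : z ∈ sphere c r) :
    (z - c) / r ∈ sphere (0 : ℂ) 1 ∧ z = c + r * ((z - c) / r) := by
  have hr0 : (r : ℂ) ≠ 0 := by exact_mod_cast hr.ne'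
  constructor
  · rw [mem_sphere_zero_iff_norm, norm_div, ← dist_eq_norm, mem_sphere.1 hz,
      Complex.norm_of_nonneg hr.le, div_self hr.ne']
  · field_simp; ring

/-- Replacing the phase of a circle map: no new zeros are created if the phases agree at the points
where the affine map meets the circle. -/
lemma planeDegree_phase_homotopy {F : ℂ → ℂ} {c c' : ℂ} {r r' : ℝ} (hr : 0 < r)
    {P Q : ℂ → ℝ} (hP : ContinuousOn P (sphere 0 1)) (hQ : ContinuousOn Q (sphere 0 1))
    (hF : ∀ u ∈ sphere (0 : ℂ) 1, F (c + r * u) = c' + r' * (u * Complex.exp (P u * Complex.I)))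
    {A : ℂ → ℂ} (hA : Continuous A)
    (h : ∀ u ∈ sphere (0 : ℂ) 1, ‖A (c + r * u) - c'‖ = |r'| →
      F (c + r * u) ≠ A (c + r * u) ∧ Q u = P u) :
    planeDegree (fun z => F z - A z) (ball c r) =
      planeDegree (fun z => c' + r' * ((z - c) / r * Complex.exp (Q ((z - c) / r) * Complex.I)) -
        A z) (ball c r) := by
  set W : ℝ → ℂ → ℂ := fun t z => c' + r' * ((z - c) / r *
    Complex.exp ((P ((z - c) / r) + t * (Q ((z - c) / r) - P ((z - c) / r)) : ℝ) * Complex.I)) - A z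
    with hW
  have hu : ∀ z ∈ sphere c r, (z - c) / r ∈ sphere (0 : ℂ) 1 := fun z hz =>
    (eq_add_mul_of_mem_sphere hr hz).1
  have hWc : ContinuousOn (Function.uncurry W) (Icc (0 : ℝ) 1 ×ˢ sphere c r) := by
    have h1 : ContinuousOn (fun p : ℝ × ℂ => (p.2 - c) / r) (Icc (0 : ℝ) 1 ×ˢ sphere c r) :=
      ((continuous_snd.sub continuous_const).div_const _).continuousOn
    have hP' := hP.comp h1 fun p hp => hu p.2 hp.2
    have hQ' := hQ.comp h1 fun p hp => hu p.2 hp.2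
    have h2 : ContinuousOn (fun p : ℝ × ℂ => P ((p.2 - c) / r) + p.1 * (Q ((p.2 - c) / r) -
        P ((p.2 - c) / r))) (Icc (0 : ℝ) 1 ×ˢ sphere c r) :=
      hP'.add (continuousOn_fst.mul (hQ'.sub hP'))
    have h3 := Complex.continuous_exp.comp_continuousOn
      ((Complex.continuous_ofReal.comp_continuousOn h2).mul
        (continuousOn_const (c := Complex.I)))
    exact (continuousOn_const.add (continuousOn_const.mul (h1.mul h3))).sub
      (hA.comp continuous_snd).continuousOn
  have hW0 : ∀ t ∈ Icc (0 : ℝ) 1, ∀ z ∈ sphere c r, W t z ≠ 0 := by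
    intro t _ z hz h0
    obtain ⟨hus, hz'⟩ := eq_add_mul_of_mem_sphere hr hz
    set u := (z - c) / r with hudef
    have h1 : A z - c' = r' * (u * Complex.exp ((P u + t * (Q u - P u) : ℝ) * Complex.I)) := by
      simp only [hW] at h0
      linear_combination -h0
    have h2 : ‖A z - c'‖ = |r'| := by
      rw [h1, norm_mul, norm_mul, Complex.norm_exp_ofReal_mul_I, mem_sphere_zero_iff_norm.1 hus,
        Complex.norm_real, Real.norm_eq_abs]
      ring
    rw [hz'] at h2
    obtain ⟨h3, h4⟩ := h u hus h2
    apply h3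
    rw [hF u hus, ← hz']
    rw [h4, sub_self, mul_zero, add_zero] at h1
    linear_combination -h1
  have key := planeDegree_homotopy isPreconnected_Icc isOpen_ball isBounded_ball (U := ball c r)
    (G := W) (by rwa [frontier_ball' hr]) (by rwa [frontier_ball' hr]) (x := 0) (y := 1)
    (by simp) (by simp)
  rw [← planeDegree_congr isOpen_ball isBounded_ball (G := W 0) (G' := fun z => F z - A z), key]
  · congr 1
    funext z
    simp only [hW]
    congr 6
    ring_nf
  · rw [frontier_ball' hr]
    exact hWc.comp (f := fun z => ((0 : ℝ), z)) (by fun_prop) fun z hz => ⟨by simp, hz⟩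
  · rw [frontier_ball' hr]
    intro z hz
    obtain ⟨hus, hz'⟩ := eq_add_mul_of_mem_sphere hr hz
    have e := hF _ hus
    rw [← hz'] at e
    simp only [hW, e, zero_mul, add_zero]
  · rw [frontier_ball' hr]
    exact hW0 0 (by simp)

lemma planeDegree_sub_center {F : ℂ → ℂ} {c c' : ℂ} {r r' : ℝ} (hr : 0 < r) (hr' : 0 < r')
    (h : IsPosOriented F c r c' r') : planeDegree (fun z => F z - c') (ball c r) = 1 := by
  obtain ⟨P, hP, hPF, -⟩ := h.exists_phase
  rw [planeDegree_phase_homotopy hr hP (continuousOn_const (c := (0 : ℝ))) hPF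
    (continuous_const (y := c')) (fun u _ h => by simp at h; exact absurd h.symm (abs_pos.2 hr'.ne').ne')]
  have : (fun z => c' + r' * ((z - c) / r * Complex.exp ((0 : ℝ) * Complex.I)) - c') =
      fun z => ((r' : ℂ) / r) * (z - c) := by
    funext z; simp; ring
  rw [this]
  refine planeDegree_mul_sub isOpen_ball isBounded_ball (mem_ball_self hr) ?_
  have hr0 : (r : ℂ) ≠ 0 := by exact_mod_cast hr.ne'
  have hr0' : (r' : ℂ) ≠ 0 := by exact_mod_cast hr'.ne'
  exact div_ne_zero hr0' hr0

lemma planeDegree_nonneg_of_mobius {c c' a d s : ℂ} {r r' β : ℝ} (hr : 0 < r) (hs : ‖s‖ < 1)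
    (h0 : ∀ z ∈ sphere c r, c' + r' * ((z - c) / r * Complex.exp ((β + 2 * Complex.arg
      (1 - s * (starRingEnd ℂ) ((z - c) / r)) : ℝ) * Complex.I)) - (a * z + d) ≠ 0) :
    0 ≤ planeDegree (fun z => c' + r' * ((z - c) / r * Complex.exp ((β + 2 * Complex.arg
      (1 - s * (starRingEnd ℂ) ((z - c) / r)) : ℝ) * Complex.I)) - (a * z + d)) (ball c r) := by
  set M : ℂ → ℂ := fun z => c' + r' * Complex.exp (β * Complex.I) *
    (((z - c) / r - s) / (1 - (starRingEnd ℂ) s * ((z - c) / r))) - (a * z + d) with hM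
  have hr0 : (r : ℂ) ≠ 0 := by exact_mod_cast hr.ne'
  have hden : ∀ z ∈ closedBall c r, 1 - (starRingEnd ℂ) s * ((z - c) / r) ≠ 0 := by
    intro z hz h
    have h1 : ‖(z - c) / r‖ ≤ 1 := by
      rw [norm_div, Complex.norm_of_nonneg hr.le, div_le_one hr, ← dist_eq_norm]
      exact hz
    have h2 : ‖(starRingEnd ℂ) s * ((z - c) / r)‖ = 1 := by
      rw [← sub_eq_zero.1 h]; simp
    rw [norm_mul, Complex.norm_conj] at h2
    nlinarith [norm_nonneg s, norm_nonneg ((z - c) / r)]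
  have heq : ∀ z ∈ sphere c r, c' + r' * ((z - c) / r * Complex.exp ((β + 2 * Complex.arg
      (1 - s * (starRingEnd ℂ) ((z - c) / r)) : ℝ) * Complex.I)) - (a * z + d) = M z := by
    intro z hz
    have hus := mem_sphere_zero_iff_norm.1 (eq_add_mul_of_mem_sphere hr hz).1
    simp only [hM]
    rw [← mul_exp_two_arg hs hus, Complex.ofReal_add, add_mul, Complex.exp_add]
    ring
  have hMc : ContinuousOn M (closedBall c r) := by
    refine (continuousOn_const.add (continuousOn_const.mul (ContinuousOn.div ?_ ?_ hden))).sub ?_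
    all_goals fun_prop
  have hdiff : DifferentiableOn ℂ M (ball c r) := by
    refine ((differentiableOn_const _).add ((differentiableOn_const _).mul
      (DifferentiableOn.div ?_ ?_ fun z hz => hden z (ball_subset_closedBall hz)))).sub ?_
    · exact ((differentiable_id.sub_const c).div_const _).sub_const s |>.differentiableOn
    · exact (((differentiable_id.sub_const c).div_const _).const_mul _).const_sub 1
        |>.differentiableOn
    · exact ((differentiable_id.const_mul a).add_const d).differentiableOn
  have hC2 : ContDiffOn ℝ 2 M (ball c r) :=
    (hdiff.contDiffOn isOpen_ball (n := 2)).restrict_scalars ℝ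
  have hfr : ContinuousOn M (frontier (ball c r)) := by
    rw [frontier_ball' hr]; exact hMc.mono sphere_subset_closedBall
  rw [← planeDegree_congr isOpen_ball isBounded_ball (G := M) hfr]
  · refine planeDegree_nonneg isOpen_ball isBounded_ball hC2 (by rwa [closure_ball _ hr.ne']) ?_ ?_
    · rw [frontier_ball' hr]
      intro z hz
      rw [← heq z hz]
      exact h0 z hz
    · intro z hz
      rw [jac_of_hasDerivAt ((hdiff z hz).differentiableAt (isOpen_ball.mem_nhds hz)).hasDerivAt]
      positivity
  · rw [frontier_ball' hr]
    exact fun z hz => (heq z hz).symm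
  · rw [frontier_ball' hr]
    intro z hz
    rw [← heq z hz]
    exact h0 z hz

/-- A positively oriented circle homeomorphism minus an affine map has nonnegative degree, unless
it vanishes somewhere or the two image circles coincide. -/
lemma planeDegree_sub_affine_nonneg {F : ℂ → ℂ} {c c' a d : ℂ} {r r' : ℝ} (hr : 0 < r)
    (hr' : 0 < r') (h : IsPosOriented F c r c' r') (ha : a ≠ 0)
    (hne : ¬ (‖a‖ * r = r' ∧ a * c + d = c')) (h0 : ∀ z ∈ sphere c r, F z ≠ a * z + d) :
    0 ≤ planeDegree (fun z => F z - (a * z + d)) (ball c r) := by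
  obtain ⟨P, hP, hPF, hPuv⟩ := h.exists_phase
  have hr0 : (r : ℂ) ≠ 0 := by exact_mod_cast hr.ne'
  set B : Set ℂ := {u | u ∈ sphere (0 : ℂ) 1 ∧ ‖a * (c + r * u) + d - c'‖ = |r'|} with hB
  suffices ∃ (s : ℂ) (β : ℝ), ‖s‖ < 1 ∧
      ∀ u ∈ B, β + 2 * Complex.arg (1 - s * (starRingEnd ℂ) u) = P u by
    obtain ⟨s, β, hs, hQ⟩ := this
    have hQc : ContinuousOn (fun u => β + 2 * Complex.arg (1 - s * (starRingEnd ℂ) u))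
        (sphere 0 1) := by
      intro u hu
      have h1 := one_sub_mul_conj_mem_slitPlane hs (mem_sphere_zero_iff_norm.1 hu).le
      have h2 : Continuous fun u => 1 - s * (starRingEnd ℂ) u :=
        continuous_const.sub (continuous_const.mul Complex.continuous_conj)
      exact (continuousAt_const.add (continuousAt_const.mul
        (ContinuousAt.comp (f := fun u => 1 - s * (starRingEnd ℂ) u)
          (Complex.continuousAt_arg h1) h2.continuousAt))).continuousWithinAt
    rw [planeDegree_phase_homotopy hr hP hQc hPF (A := fun z => a * z + d) (by fun_prop)
      (fun u hu hub => ⟨h0 _ (by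
        rw [mem_sphere, dist_eq_norm, add_sub_cancel_left, norm_mul,
          mem_sphere_zero_iff_norm.1 hu, mul_one, Complex.norm_of_nonneg hr.le]), hQ u ⟨hu, hub⟩⟩)]
    apply planeDegree_nonneg_of_mobius hr hs
    intro z hz hzero
    obtain ⟨hus, hz'⟩ := eq_add_mul_of_mem_sphere hr hz
    set u := (z - c) / r with hudef
    have h1 : a * z + d - c' = r' * (u * Complex.exp ((β + 2 * Complex.arg
      (1 - s * (starRingEnd ℂ) u) : ℝ) * Complex.I)) := by
      linear_combination -hzero
    have hub : u ∈ B := by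
      refine ⟨hus, ?_⟩
      rw [← hz', h1, norm_mul, norm_mul, Complex.norm_exp_ofReal_mul_I,
        mem_sphere_zero_iff_norm.1 hus, Complex.norm_real, Real.norm_eq_abs]
      ring
    apply h0 z hz
    have e := hPF u hus
    rw [← hz'] at e
    rw [hQ u hub] at h1
    rw [e]
    linear_combination -h1
  rcases B.eq_empty_or_nonempty with hBe | ⟨u₁, hu₁⟩
  · exact ⟨0, 0, by simp, by simp [hBe]⟩
  by_cases hu : ∀ u ∈ B, u = u₁
  · exact ⟨0, P u₁, by simp, fun u hub => by rw [hu u hub]; simp⟩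
  push Not at hu
  obtain ⟨u₂, hu₂, hne₂⟩ := hu
  obtain ⟨θ₁, θ₂, e1, e2, h1, h2, h3, h4⟩ := hPuv u₁ hu₁.1 u₂ hu₂.1 hne₂.symm
  obtain ⟨s, β, hs, k1, k2⟩ := exists_arg_interpolation h1 h2 h3 h4
  refine ⟨s, β, hs, fun u hub => ?_⟩
  suffices u = u₁ ∨ u = u₂ by
    rcases this with rfl | rfl
    · rw [← k1, ← e1]
    · rw [← k2, ← e2]
  set κ := a * c + d - c' with hκ
  have hBeq : ∀ u ∈ B, (a * r * (starRingEnd ℂ) κ * u).re =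
      (r' ^ 2 - ‖a‖ ^ 2 * r ^ 2 - ‖κ‖ ^ 2) / 2 := by
    rintro u ⟨hu1, hu2⟩
    have e : a * (c + r * u) + d - c' = a * r * u + κ := by rw [hκ]; ring
    have h5 : ‖a * r * u + κ‖ ^ 2 = r' ^ 2 := by rw [← e, hu2, sq_abs]
    rw [← Complex.normSq_eq_norm_sq, Complex.normSq_add, Complex.normSq_eq_norm_sq,
      Complex.normSq_eq_norm_sq, norm_mul, norm_mul, mem_sphere_zero_iff_norm.1 hu1,
      Complex.norm_of_nonneg hr.le] at h5
    have : a * r * (starRingEnd ℂ) κ * u = a * r * u * (starRingEnd ℂ) κ := by ring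
    rw [this]
    linarith
  have hκ0 : κ ≠ 0 := by
    intro h0
    apply hne
    refine ⟨?_, sub_eq_zero.1 h0⟩
    have h5 := hu₁.2
    have e : a * (c + r * u₁) + d - c' = a * r * u₁ + κ := by rw [hκ]; ring
    rw [e, h0, add_zero, norm_mul, norm_mul, mem_sphere_zero_iff_norm.1 hu₁.1,
      Complex.norm_of_nonneg hr.le, abs_of_pos hr', mul_one] at h5
    exact h5
  set ω := a * r * (starRingEnd ℂ) κ with hω
  have hω0 : ω ≠ 0 := mul_ne_zero (mul_ne_zero ha hr0) (by simpa using hκ0)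
  have key : ∀ v w : ℂ, v ∈ B → w ∈ B → ω * v = ω * w ∨ ω * v = (starRingEnd ℂ) (ω * w) := by
    intro v w hv hw
    have r1 : (ω * v).re = (ω * w).re := by rw [hBeq v hv, hBeq w hw]
    have r2 : Complex.normSq (ω * v) = Complex.normSq (ω * w) := by
      rw [Complex.normSq_eq_norm_sq, Complex.normSq_eq_norm_sq, norm_mul ω v, norm_mul ω w,
        mem_sphere_zero_iff_norm.1 hv.1, mem_sphere_zero_iff_norm.1 hw.1]
    rw [Complex.normSq_apply, Complex.normSq_apply, r1] at r2
    have r3 : (ω * v).im ^ 2 = (ω * w).im ^ 2 := by nlinarith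
    rcases sq_eq_sq_iff_eq_or_eq_neg.1 r3 with h | h
    · exact Or.inl (Complex.ext r1 h)
    · exact Or.inr (Complex.ext (by rw [Complex.conj_re]; exact r1)
        (by rw [Complex.conj_im]; exact h))
  rcases key u u₁ hub hu₁ with h5 | h5
  · exact Or.inl (mul_left_cancel₀ hω0 h5)
  rcases key u₂ u₁ hu₂ hu₁ with h6 | h6
  · exact absurd (mul_left_cancel₀ hω0 h6) hne₂
  · exact Or.inr (mul_left_cancel₀ hω0 (h5.trans h6.symm))

/-- The degree of a positively oriented circle homeomorphism minus an affine map is one if the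
image circles are nested. -/
lemma planeDegree_sub_affine_of_nested {F : ℂ → ℂ} {c c' a d : ℂ} {r r' : ℝ} (hr : 0 < r)
    (hr' : 0 < r') (h : IsPosOriented F c r c' r') (hF : ContinuousOn F (sphere c r))
    (hm : MapsTo F (sphere c r) (sphere c' r')) (ha : a ≠ 0)
    (hnest : ‖c' - (a * c + d)‖ < |r' - ‖a‖ * r|) :
    planeDegree (fun z => F z - (a * z + d)) (ball c r) = 1 := by
  have hA : ∀ z ∈ sphere c r, a * z + d - c' = a * (z - c) - (c' - (a * c + d)) := by
    intro z _; ring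
  have hn : ∀ z ∈ sphere c r, ‖a * (z - c)‖ = ‖a‖ * r := by
    intro z hz
    rw [norm_mul, ← dist_eq_norm, mem_sphere.1 hz]
  have hFn : ∀ z ∈ sphere c r, ‖F z - c'‖ = r' := by
    intro z hz
    rw [← dist_eq_norm]; exact hm hz
  rcases le_total (‖a‖ * r) r' with hle | hle
  · rw [abs_of_nonneg (by linarith)] at hnest
    rw [← planeDegree_sub_center hr hr' h]
    refine planeDegree_eq_of_segment isOpen_ball isBounded_ball ?_ ?_ ?_
    · rw [frontier_ball' hr]; exact hF.sub (by fun_prop)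
    · rw [frontier_ball' hr]; exact hF.sub (by fun_prop)
    · rw [frontier_ball' hr]
      intro z hz t ht h0
      have e : F z - c' = ((1 - t : ℝ) : ℂ) * (a * z + d - c') := by
        push_cast; linear_combination h0
      have e1 := hFn z hz
      rw [e, norm_mul, Complex.norm_of_nonneg (by linarith [ht.2]), hA z hz] at e1
      have e2 := norm_sub_le (a * (z - c)) (c' - (a * c + d))
      rw [hn z hz] at e2
      nlinarith [ht.1, ht.2, norm_nonneg (a * (z - c) - (c' - (a * c + d)))]
  · rw [abs_of_nonpos (by linarith)] at hnest
    have hin : (c' - d) / a ∈ ball c r := by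
      have hapos := norm_pos_iff.2 ha
      have e : (c' - d) / a - c = (c' - (a * c + d)) / a := by field_simp; ring
      rw [mem_ball, dist_eq_norm, e, norm_div, div_lt_iff₀ hapos]
      linarith
    rw [← planeDegree_mul_sub isOpen_ball isBounded_ball hin (neg_ne_zero.2 ha)]
    refine planeDegree_eq_of_segment isOpen_ball isBounded_ball ?_ ?_ ?_
    · rw [frontier_ball' hr]; exact hF.sub (by fun_prop)
    · rw [frontier_ball' hr]; fun_prop
    · rw [frontier_ball' hr]
      intro z hz t ht h0
      have e0 : a * ((c' - d) / a) = c' - d := by field_simp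
      have e : a * z + d - c' = ((1 - t : ℝ) : ℂ) * (F z - c') := by
        push_cast; linear_combination -h0 + t * e0
      have e1 := norm_sub_norm_le (a * (z - c)) (c' - (a * c + d))
      rw [hn z hz, ← hA z hz, e, norm_mul, Complex.norm_of_nonneg (by linarith [ht.2]),
        hFn z hz] at e1
      nlinarith [ht.1, ht.2]

section Families

variable {I : Type*} {Ω : Set ℂ} {c : I → ℂ} {r : I → ℝ}

/-- The complement in `Ω` of a family of discs. -/
def discResidual (Ω : Set ℂ) (c : I → ℂ) (r : I → ℝ) : Set ℂ := Ω \ ⋃ i, ball (c i) (r i)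

lemma IsSchottkyFamily.eq_of_mem (h : IsSchottkyFamily Ω c r) {i j : I} {z : ℂ}
    (hi : z ∈ closedBall (c i) (r i)) (hj : z ∈ closedBall (c j) (r j)) : i = j := by
  by_contra hij
  exact Set.disjoint_left.1 (h.2.2 hij) hi hj

lemma IsSchottkyFamily.finite_le_radius (h : IsSchottkyFamily Ω c r)
    (hb : Bornology.IsBounded Ω) {ρ : ℝ} (hρ : 0 < ρ) : {i | ρ ≤ r i}.Finite := by
  have hpos : (0 : ℝ≥0∞) < volume (ball (0 : ℂ) ρ) := measure_ball_pos _ _ hρ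
  refine (Measure.finite_const_le_meas_of_disjoint_iUnion volume hpos
    (As := fun i => ball (c i) (r i)) (fun i => measurableSet_ball) ?_ ?_).subset ?_
  · intro i j hij
    exact (h.2.2 hij).mono ball_subset_closedBall ball_subset_closedBall
  · refine ne_top_of_le_ne_top hb.measure_lt_top.ne (measure_mono ?_)
    exact iUnion_subset fun i => ball_subset_closedBall.trans (h.2.1 i)
  · intro i hi
    change volume (ball (0 : ℂ) ρ) ≤ volume (ball (c i) (r i))
    rw [Measure.addHaar_ball_center volume (c i)]
    exact measure_mono (ball_subset_ball hi)

lemma IsSchottkyFamily.sphere_subset (h : IsSchottkyFamily Ω c r) (i : I) :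
    sphere (c i) (r i) ⊆ discResidual Ω c r := by
  intro z hz
  refine ⟨h.2.1 i (sphere_subset_closedBall hz), ?_⟩
  simp only [mem_iUnion, not_exists]
  intro j hj
  obtain rfl := h.eq_of_mem (sphere_subset_closedBall hz) (ball_subset_closedBall hj)
  exact absurd (mem_sphere.1 hz) (mem_ball.1 hj).ne

/-- The saturation of `K`: all discs meeting `K` are added to `K`. -/
def saturation (c : I → ℂ) (r : I → ℝ) (K : Set ℂ) : Set ℂ :=
  K ∪ ⋃ i ∈ {i | (closedBall (c i) (r i) ∩ K).Nonempty}, closedBall (c i) (r i)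

lemma closedBall_subset_saturation {K : Set ℂ} {i : I} {z : ℂ}
    (hz : z ∈ closedBall (c i) (r i)) (hK : z ∈ K) :
    closedBall (c i) (r i) ⊆ saturation c r K := by
  intro w hw
  exact Or.inr (mem_biUnion (show i ∈ {i | (closedBall (c i) (r i) ∩ K).Nonempty} from
    ⟨z, hz, hK⟩) hw)

lemma IsSchottkyFamily.saturation_subset (h : IsSchottkyFamily Ω c r) {K : Set ℂ} (hK : K ⊆ Ω) :
    saturation c r K ⊆ Ω :=
  union_subset hK (iUnion₂_subset fun i _ => h.2.1 i)

lemma IsSchottkyFamily.isCompact_saturation (h : IsSchottkyFamily Ω c r)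
    (hb : Bornology.IsBounded Ω) {K : Set ℂ} (hK : K ⊆ Ω) (hKc : IsCompact K) :
    IsCompact (saturation c r K) := by
  refine isCompact_of_isClosed_isBounded ?_ (hb.subset (h.saturation_subset hK))
  rcases K.eq_empty_or_nonempty with rfl | hne
  · simp [saturation]
  rw [← isOpen_compl_iff, isOpen_iff_mem_nhds]
  intro z hz
  have hzK : z ∉ K := fun h => hz (Or.inl h)
  have hδ := (hKc.isClosed.notMem_iff_infDist_pos hne).1 hzK
  set δ := infDist z K
  set J : Set I := {i | (closedBall (c i) (r i) ∩ K).Nonempty} ∩ {i | δ / 4 ≤ r i}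
  have hJ : J.Finite := (h.finite_le_radius hb (by positivity)).subset inter_subset_right
  have hcl : IsClosed (⋃ i ∈ J, closedBall (c i) (r i)) :=
    hJ.isClosed_biUnion fun _ _ => isClosed_closedBall
  have hzJ : z ∉ ⋃ i ∈ J, closedBall (c i) (r i) := by
    intro hz'
    obtain ⟨i, hi, hzi⟩ := mem_iUnion₂.1 hz'
    exact hz (Or.inr (mem_biUnion hi.1 hzi))
  filter_upwards [ball_mem_nhds z (half_pos hδ), hcl.isOpen_compl.mem_nhds hzJ] with w hw hwJ
  rintro (hwK | hw')
  · have := infDist_le_dist_of_mem (x := z) hwK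
    rw [mem_ball, dist_comm] at hw
    linarith
  · obtain ⟨i, hi, hwi⟩ := mem_iUnion₂.1 hw'
    by_cases hri : δ / 4 ≤ r i
    · exact hwJ (mem_biUnion ⟨hi, hri⟩ hwi)
    obtain ⟨k, hk1, hk2⟩ := hi
    have h1 := infDist_le_dist_of_mem (x := z) hk2
    have h2 := dist_triangle z w k
    have h3 := dist_triangle_right w k (c i)
    rw [mem_ball, dist_comm] at hw
    rw [mem_closedBall] at hwi hk1
    push Not at hri
    linarith

lemma exists_mem_sphere_dist_le {c z : ℂ} {r : ℝ} (hr : 0 < r) (hz : z ∈ closedBall c r) :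
    ∃ w ∈ sphere c r, dist z w ≤ 2 * r := by
  refine ⟨c + r, by simp [abs_of_pos hr], ?_⟩
  have := dist_triangle z c (c + r)
  have h2 : dist c (c + r) = r := by simp [dist_eq_norm, abs_of_pos hr]
  rw [mem_closedBall] at hz
  linarith

lemma isPreconnected_sphere_complex (c : ℂ) (r : ℝ) : IsPreconnected (sphere c r) :=
  isPreconnected_sphere (by simp) c r

/-- Removing a null family of discs does not disconnect a set. -/
lemma isPreconnected_sdiff_iUnion_ball {X : Set ℂ} (hX : IsPreconnected X)
    (hr : ∀ i, 0 < r i) (hsub : ∀ i, closedBall (c i) (r i) ⊆ X)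
    (hdisj : Pairwise fun i j => Disjoint (closedBall (c i) (r i)) (closedBall (c j) (r j)))
    (hfin : ∀ ρ > 0, {i | ρ ≤ r i}.Finite) : IsPreconnected (X \ ⋃ i, ball (c i) (r i)) := by
  set Y := X \ ⋃ i, ball (c i) (r i) with hY
  have hfam : IsSchottkyFamily X c r := ⟨hr, hsub, hdisj⟩
  have hYs : ∀ i, ∀ z ∈ Y, z ∈ closedBall (c i) (r i) → z ∈ sphere (c i) (r i) := by
    intro i z hz hzi
    refine le_antisymm hzi ?_
    by_contra hlt
    exact hz.2 (mem_iUnion.2 ⟨i, not_le.1 hlt⟩)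
  have key : ∀ t t' : Set ℂ, IsClosed t → Y ⊆ t ∪ t' → ¬ (Y ∩ (t ∩ t')).Nonempty →
      closure ((Y ∩ t) ∪ ⋃ i ∈ {i | sphere (c i) (r i) ⊆ t}, closedBall (c i) (r i)) ∩ X ⊆
      ((Y ∩ t) ∪ ⋃ i ∈ {i | sphere (c i) (r i) ⊆ t}, closedBall (c i) (r i)) := by
    rintro t t' ht hcov hemp x ⟨hx, hxX⟩
    rw [mem_closure_iff_nhds] at hx
    by_cases hxb : ∃ i, x ∈ ball (c i) (r i)
    · obtain ⟨i, hi⟩ := hxb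
      obtain ⟨w, hw1, hw2⟩ := hx _ (isOpen_ball.mem_nhds hi)
      rcases hw2 with hw2 | hw2
      · exact absurd (mem_iUnion.2 ⟨i, hw1⟩) hw2.1.2
      · obtain ⟨j, hj, hwj⟩ := mem_iUnion₂.1 hw2
        obtain rfl := hfam.eq_of_mem (ball_subset_closedBall hw1) hwj
        exact Or.inr (mem_biUnion hj (ball_subset_closedBall hi))
    have hxY : x ∈ Y := ⟨hxX, by simpa using hxb⟩
    by_cases hxt : x ∈ t
    · exact Or.inl ⟨hxY, hxt⟩
    exfalso
    obtain ⟨δ, hδ, hδt⟩ := Metric.isOpen_iff.1 ht.isOpen_compl x hxt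
    set J : Set I := {i | sphere (c i) (r i) ⊆ t} ∩ {i | δ / 4 ≤ r i}
    have hJ : J.Finite := (hfin (δ / 4) (by positivity)).subset inter_subset_right
    have hcl : IsClosed (⋃ i ∈ J, closedBall (c i) (r i)) :=
      hJ.isClosed_biUnion fun _ _ => isClosed_closedBall
    have hxJ : x ∉ ⋃ i ∈ J, closedBall (c i) (r i) := by
      intro hx'
      obtain ⟨i, hi, hxi⟩ := mem_iUnion₂.1 hx'
      exact hxt (hi.1 (hYs i x hxY hxi))
    obtain ⟨w, ⟨hw1, hw2⟩, hw3⟩ := hx _ (inter_mem (ball_mem_nhds x (half_pos hδ))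
      (hcl.isOpen_compl.mem_nhds hxJ))
    rcases hw3 with hw3 | hw3
    · exact hδt (ball_subset_ball (by linarith) hw1) hw3.2
    obtain ⟨i, hi, hwi⟩ := mem_iUnion₂.1 hw3
    by_cases hri : δ / 4 ≤ r i
    · exact hw2 (mem_biUnion ⟨hi, hri⟩ hwi)
    obtain ⟨k, hk, hkd⟩ := exists_mem_sphere_dist_le (hr i) hwi
    refine hδt ?_ (hi hk)
    rw [mem_ball] at hw1 ⊢
    rw [dist_comm] at hkd
    have := dist_triangle k w x
    push Not at hri
    linarith
  rw [isPreconnected_closed_iff]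
  intro t t' ht ht' hcov hne hne'
  by_contra hemp
  set T1 := (Y ∩ t) ∪ ⋃ i ∈ {i | sphere (c i) (r i) ⊆ t}, closedBall (c i) (r i)
  set T2 := (Y ∩ t') ∪ ⋃ i ∈ {i | sphere (c i) (r i) ⊆ t'}, closedBall (c i) (r i)
  have k1 := key t t' ht hcov hemp
  have k2 := key t' t ht' (by rwa [union_comm]) (by rwa [inter_comm t' t])
  have hsph : ∀ i, sphere (c i) (r i) ⊆ t ∨ sphere (c i) (r i) ⊆ t' := by
    intro i
    have h1 := hfam.sphere_subset i
    by_contra hcon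
    push Not at hcon
    obtain ⟨⟨a, ha, hat⟩, ⟨b, hb, hbt⟩⟩ := And.intro (Set.not_subset.1 hcon.1)
      (Set.not_subset.1 hcon.2)
    obtain ⟨z, hz1, hz2⟩ := isPreconnected_closed_iff.1
      (isPreconnected_sphere_complex (c i) (r i)) t t' ht ht' (h1.trans hcov)
      ⟨b, hb, (hcov (h1 hb)).resolve_right hbt⟩ ⟨a, ha, (hcov (h1 ha)).resolve_left hat⟩
    exact hemp ⟨z, h1 hz1, hz2⟩
  have hcovX : X ⊆ T1 ∪ T2 := by
    intro x hx
    by_cases hxb : ∃ i, x ∈ ball (c i) (r i)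
    · obtain ⟨i, hi⟩ := hxb
      rcases hsph i with h | h
      · exact Or.inl (Or.inr (mem_biUnion h (ball_subset_closedBall hi)))
      · exact Or.inr (Or.inr (mem_biUnion h (ball_subset_closedBall hi)))
    · have hxY : x ∈ Y := ⟨hx, by simpa using hxb⟩
      rcases hcov hxY with h | h
      · exact Or.inl (Or.inl ⟨hxY, h⟩)
      · exact Or.inr (Or.inl ⟨hxY, h⟩)
  obtain ⟨z, hz, hz1, hz2⟩ := isPreconnected_closed_iff.1 hX (closure T1) (closure T2)
    isClosed_closure isClosed_closure
    (hcovX.trans (union_subset_union subset_closure subset_closure))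
    (hne.imp fun z hz => ⟨hz.1.1, subset_closure (Or.inl hz)⟩)
    (hne'.imp fun z hz => ⟨hz.1.1, subset_closure (Or.inl hz)⟩)
  have hzT1 := k1 ⟨hz1, hz⟩
  have hzT2 := k2 ⟨hz2, hz⟩
  rcases hzT1 with h1 | h1 <;> rcases hzT2 with h2 | h2
  · exact hemp ⟨z, h1.1, h1.2, h2.2⟩
  · obtain ⟨i, hi, hzi⟩ := mem_iUnion₂.1 h2
    exact hemp ⟨z, h1.1, h1.2, hi (hYs i z h1.1 hzi)⟩
  · obtain ⟨i, hi, hzi⟩ := mem_iUnion₂.1 h1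
    exact hemp ⟨z, h2.1, hi (hYs i z h2.1 hzi), h2.2⟩
  · obtain ⟨i, hi, hzi⟩ := mem_iUnion₂.1 h1
    obtain ⟨j, hj, hzj⟩ := mem_iUnion₂.1 h2
    obtain rfl := hfam.eq_of_mem hzi hzj
    obtain ⟨w, hw, -⟩ := exists_mem_sphere_dist_le (hr i) hzi
    exact hemp ⟨w, hfam.sphere_subset i hw, hi hw, hj hw⟩

lemma isPreconnected_annulus (c : ℂ) {r R : ℝ} (hr : 0 ≤ r) :
    IsPreconnected {z | r < dist z c ∧ dist z c < R} := by
  have : {z | r < dist z c ∧ dist z c < R} =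
      (fun p : ℝ × ℝ => c + p.1 * Complex.exp (p.2 * Complex.I)) '' (Ioo r R ×ˢ univ) := by
    ext z
    simp only [mem_ofPred_eq, mem_image, mem_prod, mem_Ioo, mem_univ, and_true, Prod.exists]
    constructor
    · rintro h
      refine ⟨dist z c, Complex.arg (z - c), h, ?_⟩
      rw [dist_eq_norm, Complex.norm_mul_exp_arg_mul_I]
      ring
    · rintro ⟨a, b, h, rfl⟩
      rw [dist_eq_norm, add_sub_cancel_left, norm_mul, Complex.norm_exp_ofReal_mul_I, mul_one,
        Complex.norm_of_nonneg (by linarith)]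
      exact h
  rw [this]
  exact (isPreconnected_Ioo.prod isPreconnected_univ).image _ (by fun_prop)

lemma isPreconnected_sdiff_closedBall {U : Set ℂ} (hU : IsOpen U) (hc : IsPreconnected U)
    {c : ℂ} {r : ℝ} (hr : 0 < r) (hsub : closedBall c r ⊆ U) :
    IsPreconnected (U \ closedBall c r) := by
  obtain ⟨δ, hδ, hδU⟩ := (isCompact_closedBall c r).exists_thickening_subset_open hU hsub
  have hRU : ball c (r + δ) ⊆ U := by
    refine subset_trans ?_ hδU
    rw [thickening_closedBall hδ hr.le, add_comm]
  set A := {z | r < dist z c ∧ dist z c < r + δ} with hA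
  have hAs : A ⊆ U \ closedBall c r := fun z hz => ⟨hRU hz.2, by simpa using hz.1⟩
  have hAc : IsPreconnected A := isPreconnected_annulus c hr.le
  have hAne : (c + (r + δ / 2 : ℝ)) ∈ A := by
    simp only [hA, mem_ofPred_eq, dist_eq_norm, add_sub_cancel_left]
    rw [Complex.norm_of_nonneg (by positivity)]
    constructor <;> linarith
  have main : ∀ u v : Set ℂ, IsOpen u → IsOpen v → U \ closedBall c r ⊆ u ∪ v →
      ((U \ closedBall c r) ∩ v).Nonempty → A ⊆ u →
      ((U \ closedBall c r) ∩ (u ∩ v)).Nonempty := by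
    rintro u v hu hv hcov ⟨y, hy, hyv⟩ hAu
    by_contra hemp
    have ho : IsOpen (U \ closedBall c r) := hU.sdiff isClosed_closedBall
    obtain ⟨z, hz, hz1, hz2⟩ := hc (u ∩ (U \ closedBall c r) ∪ ball c (r + δ))
      (v ∩ (U \ closedBall c r)) ((hu.inter ho).union isOpen_ball) (hv.inter ho)
      (by
        intro z hz
        by_cases hzb : z ∈ closedBall c r
        · exact Or.inl (Or.inr (closedBall_subset_ball (by linarith) hzb))
        · rcases hcov ⟨hz, hzb⟩ with h | h
          · exact Or.inl (Or.inl ⟨h, hz, hzb⟩)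
          · exact Or.inr ⟨h, hz, hzb⟩)
      ⟨c, hsub (mem_closedBall_self hr.le), Or.inr (mem_ball_self (by linarith))⟩
      ⟨y, hy.1, hyv, hy⟩
    rcases hz1 with hz1 | hz1
    · exact hemp ⟨z, hz2.2, hz1.1, hz2.1⟩
    · exact hemp ⟨z, hz2.2, hAu ⟨by simpa using hz2.2.2, hz1⟩, hz2.1⟩
  intro u v hu hv hcov hne hne'
  by_contra hemp
  have ho : IsOpen (U \ closedBall c r) := hU.sdiff isClosed_closedBall
  rcases hAc.subset_or_subset (hu.inter ho) (hv.inter ho)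
    (disjoint_left.2 fun z hz hz' => hemp ⟨z, hz.2, hz.1, hz'.1⟩)
    (fun z hz => (hcov (hAs hz)).imp (fun h => ⟨h, hAs hz⟩) fun h => ⟨h, hAs hz⟩) with h | h
  · exact hemp (main u v hu hv hcov hne' fun z hz => (h hz).1)
  · exact hemp (by
      rw [inter_comm u v]
      exact main v u hv hu (by rwa [union_comm]) hne fun z hz => (h hz).1)

end Families

/-- Mutually inverse continuous maps `f`, `g` between two bounded relative Schottky sets, matching
the peripheral circles. -/
structure IsSchottkyMap {I : Type*} (Ω Ω' : Set ℂ) (c : I → ℂ) (r : I → ℝ) (c' : I → ℂ)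
    (r' : I → ℝ) (f g : ℂ → ℂ) : Prop where
  domain : IsPlaneDomain Ω
  domain' : IsPlaneDomain Ω'
  bdd : Bornology.IsBounded Ω
  bdd' : Bornology.IsBounded Ω'
  family : IsSchottkyFamily Ω c r
  family' : IsSchottkyFamily Ω' c' r'
  cont : ContinuousOn f (discResidual Ω c r)
  cont' : ContinuousOn g (discResidual Ω' c' r')
  mapsTo : MapsTo f (discResidual Ω c r) (discResidual Ω' c' r')
  mapsTo' : MapsTo g (discResidual Ω' c' r') (discResidual Ω c r)
  leftInv : ∀ z ∈ discResidual Ω c r, g (f z) = z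
  rightInv : ∀ z ∈ discResidual Ω' c' r', f (g z) = z
  circle : ∀ i, MapsTo f (sphere (c i) (r i)) (sphere (c' i) (r' i))
  circle' : ∀ i, MapsTo g (sphere (c' i) (r' i)) (sphere (c i) (r i))

/-- The cone extension of a circle map to the disc. -/
def coneMap (c : ℂ) (r : ℝ) (c' : ℂ) (f : ℂ → ℂ) (z : ℂ) : ℂ :=
  c' + ((min 1 (2 * ‖z - c‖ / r) : ℝ) : ℂ) * (f (c + ((r / ‖z - c‖ : ℝ) : ℂ) * (z - c)) - c')

open Classical in
/-- The extension of a map of Schottky sets over the complementary discs. -/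
def discExtension {I : Type*} (c : I → ℂ) (r : I → ℝ) (c' : I → ℂ) (f : ℂ → ℂ) (z : ℂ) : ℂ :=
  if h : ∃ i, z ∈ ball (c i) (r i) then
    coneMap (c h.choose) (r h.choose) (c' h.choose) f z else f z

lemma radial_mem_sphere {c z : ℂ} {r : ℝ} (hr : 0 < r) (hz : z ≠ c) :
    c + ((r / ‖z - c‖ : ℝ) : ℂ) * (z - c) ∈ sphere c r := by
  have h0 : 0 < ‖z - c‖ := norm_pos_iff.2 (sub_ne_zero.2 hz)
  rw [mem_sphere, dist_eq_norm, add_sub_cancel_left, norm_mul,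
    Complex.norm_of_nonneg (by positivity)]
  field_simp

lemma dist_radial {c z : ℂ} {r : ℝ} (hz : z ≠ c) (hzr : z ∈ closedBall c r) :
    dist z (c + ((r / ‖z - c‖ : ℝ) : ℂ) * (z - c)) = r - dist z c := by
  have h0 : 0 < ‖z - c‖ := norm_pos_iff.2 (sub_ne_zero.2 hz)
  rw [mem_closedBall, dist_eq_norm] at hzr
  have e : z - (c + ((r / ‖z - c‖ : ℝ) : ℂ) * (z - c)) =
      -(((r / ‖z - c‖ - 1 : ℝ) : ℂ) * (z - c)) := by push_cast; ring
  have h1 : 0 ≤ r / ‖z - c‖ - 1 := by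
    rw [sub_nonneg, le_div_iff₀ h0]; linarith
  rw [dist_eq_norm, e, norm_neg, norm_mul, Complex.norm_of_nonneg h1, dist_eq_norm]
  field_simp

lemma coneMap_center (c : ℂ) (r : ℝ) (c' : ℂ) (f : ℂ → ℂ) : coneMap c r c' f c = c' := by
  simp [coneMap]

lemma continuousOn_coneMap {c c' : ℂ} {r r' : ℝ} {f : ℂ → ℂ} (hr : 0 < r)
    (hf : ContinuousOn f (sphere c r)) (hm : MapsTo f (sphere c r) (sphere c' r')) :
    Continuous (coneMap c r c' f) := by
  rw [continuous_iff_continuousAt]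
  intro z
  have hmin : Continuous fun z : ℂ => min 1 (2 * ‖z - c‖ / r) := by fun_prop
  by_cases hz : z = c
  · subst hz
    rw [ContinuousAt, coneMap_center, tendsto_iff_norm_sub_tendsto_zero]
    have hlim : Tendsto (fun w : ℂ => min 1 (2 * ‖w - z‖ / r) * r') (𝓝 z) (𝓝 0) := by
      have := (hmin.mul_const r').tendsto z
      simpa using this
    refine squeeze_zero (fun _ => norm_nonneg _) (fun w => ?_) hlim
    have h0 : 0 ≤ min 1 (2 * ‖w - z‖ / r) := le_min zero_le_one (by positivity)
    by_cases hw : w = z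
    · simp [hw, coneMap_center]
    · have hmem := mem_sphere.1 (hm (radial_mem_sphere hr hw))
      rw [dist_eq_norm] at hmem
      rw [coneMap, add_sub_cancel_left, norm_mul, Complex.norm_of_nonneg h0]
      exact mul_le_mul_of_nonneg_left hmem.le h0
  · have h0 : ‖z - c‖ ≠ 0 := (norm_pos_iff.2 (sub_ne_zero.2 hz)).ne'
    have hrad : ContinuousAt (fun z : ℂ => c + ((r / ‖z - c‖ : ℝ) : ℂ) * (z - c)) z := by
      refine continuousAt_const.add (ContinuousAt.mul ?_ (by fun_prop))
      refine Complex.continuous_ofReal.continuousAt.comp ?_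
      exact continuousAt_const.div (by fun_prop) h0
    have hcomp : ContinuousAt (fun z : ℂ => f (c + ((r / ‖z - c‖ : ℝ) : ℂ) * (z - c))) z := by
      refine (hf _ (radial_mem_sphere hr hz)).tendsto.comp (tendsto_nhdsWithin_iff.2 ⟨hrad, ?_⟩)
      filter_upwards [isOpen_ne.mem_nhds hz] with w hw using radial_mem_sphere hr hw
    exact continuousAt_const.add ((Complex.continuous_ofReal.comp hmin).continuousAt.mul
      (hcomp.sub continuousAt_const))

section

variable {I : Type*} {Ω Ω' : Set ℂ} {c : I → ℂ} {r : I → ℝ} {c' : I → ℂ} {r' : I → ℝ} {f g : ℂ → ℂ}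

lemma discExtension_of_notMem {z : ℂ} (hz : ∀ i, z ∉ ball (c i) (r i)) :
    discExtension c r c' f z = f z := by
  rw [discExtension, dif_neg (by simpa using hz)]

lemma discExtension_of_mem_residual {z : ℂ} (hz : z ∈ discResidual Ω c r) :
    discExtension c r c' f z = f z :=
  discExtension_of_notMem fun i hi => hz.2 (mem_iUnion.2 ⟨i, hi⟩)

lemma IsSchottkyFamily.discExtension_of_mem_ball (h : IsSchottkyFamily Ω c r) {i : I} {z : ℂ}
    (hz : z ∈ ball (c i) (r i)) : discExtension c r c' f z = coneMap (c i) (r i) (c' i) f z := by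
  have hex : ∃ i, z ∈ ball (c i) (r i) := ⟨i, hz⟩
  rw [discExtension, dif_pos hex, h.eq_of_mem (ball_subset_closedBall hex.choose_spec)
    (ball_subset_closedBall hz)]

lemma mem_residual_or_mem_ball {z : ℂ} (hz : z ∈ Ω) :
    z ∈ discResidual Ω c r ∨ ∃ i, z ∈ ball (c i) (r i) := by
  by_cases h : ∃ i, z ∈ ball (c i) (r i)
  · exact Or.inr h
  · exact Or.inl ⟨hz, by simpa using h⟩

lemma coneMap_mem_of_convex {c c' : ℂ} {r : ℝ} {f : ℂ → ℂ} {C : Set ℂ} (hr : 0 < r)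
    (hC : Convex ℝ C) (hc : c' ∈ C) {z : ℂ}
    (hz : z ≠ c → f (c + ((r / ‖z - c‖ : ℝ) : ℂ) * (z - c)) ∈ C) : coneMap c r c' f z ∈ C := by
  by_cases h : z = c
  · rwa [h, coneMap_center]
  · have h0 : 0 ≤ min 1 (2 * ‖z - c‖ / r) := le_min zero_le_one (by positivity)
    have := hC.add_smul_sub_mem hc (hz h) ⟨h0, min_le_left _ _⟩
    rwa [Complex.real_smul] at this

namespace IsSchottkyMap

lemma symm (h : IsSchottkyMap Ω Ω' c r c' r' f g) : IsSchottkyMap Ω' Ω c' r' c r g f :=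
  ⟨h.domain', h.domain, h.bdd', h.bdd, h.family', h.family, h.cont', h.cont, h.mapsTo', h.mapsTo,
    h.rightInv, h.leftInv, h.circle', h.circle⟩

lemma injOn (h : IsSchottkyMap Ω Ω' c r c' r' f g) : InjOn f (discResidual Ω c r) := by
  intro z hz w hw e
  rw [← h.leftInv z hz, e, h.leftInv w hw]

lemma surjOn_circle (h : IsSchottkyMap Ω Ω' c r c' r' f g) (i : I) {w : ℂ}
    (hw : w ∈ sphere (c' i) (r' i)) : ∃ z ∈ sphere (c i) (r i), f z = w :=
  ⟨g w, h.circle' i hw, h.rightInv w (h.family'.sphere_subset i hw)⟩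

lemma extension_of_mem (_h : IsSchottkyMap Ω Ω' c r c' r' f g) {z : ℂ}
    (hz : z ∈ discResidual Ω c r) : discExtension c r c' f z = f z :=
  discExtension_of_mem_residual hz

lemma extension_mem_closedBall (h : IsSchottkyMap Ω Ω' c r c' r' f g) {i : I} {z : ℂ}
    (hz : z ∈ closedBall (c i) (r i)) :
    discExtension c r c' f z ∈ closedBall (c' i) (r' i) := by
  rcases (lt_or_eq_of_le (mem_closedBall.1 hz)) with hlt | heq
  · rw [h.family.discExtension_of_mem_ball hlt]
    exact coneMap_mem_of_convex (h.family.1 i) (convex_closedBall _ _)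
      (mem_closedBall_self (h.family'.1 i).le) fun hzc =>
        sphere_subset_closedBall (h.circle i (radial_mem_sphere (h.family.1 i) hzc))
  · rw [h.extension_of_mem (h.family.sphere_subset i heq)]
    exact sphere_subset_closedBall (h.circle i heq)

lemma extension_mapsTo (h : IsSchottkyMap Ω Ω' c r c' r' f g) :
    MapsTo (discExtension c r c' f) Ω Ω' := by
  intro z hz
  rcases mem_residual_or_mem_ball (c := c) (r := r) hz with hzS | ⟨i, hi⟩
  · rw [h.extension_of_mem hzS]; exact (h.mapsTo hzS).1
  · exact h.family'.2.1 i (h.extension_mem_closedBall (ball_subset_closedBall hi))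

lemma mem_ball_of_extension (h : IsSchottkyMap Ω Ω' c r c' r' f g) {i : I} {z : ℂ} (hz : z ∈ Ω)
    (hF : discExtension c r c' f z ∈ ball (c' i) (r' i)) : z ∈ ball (c i) (r i) := by
  rcases mem_residual_or_mem_ball (c := c) (r := r) hz with hzS | ⟨j, hj⟩
  · rw [h.extension_of_mem hzS] at hF
    exact absurd (mem_iUnion.2 ⟨i, hF⟩) (h.mapsTo hzS).2
  · obtain rfl := h.family'.eq_of_mem (ball_subset_closedBall hF)
      (h.extension_mem_closedBall (ball_subset_closedBall hj))
    exact hj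

/-- The oscillation of the extension is controlled by the oscillation on the Schottky set. -/
lemma dist_extension_le (h : IsSchottkyMap Ω Ω' c r c' r' f g) {s : ℂ} {R D : ℝ}
    (hs : s ∈ discResidual Ω c r)
    (hD : ∀ z ∈ discResidual Ω c r, dist z s < 5 * R → dist (f z) (f s) ≤ D) {z : ℂ} (hz : z ∈ Ω)
    (hzs : dist z s < R) : dist (discExtension c r c' f z) (f s) ≤ D := by
  have hR : 0 < R := dist_nonneg.trans_lt hzs
  rcases mem_residual_or_mem_ball (c := c) (r := r) hz with hzS | ⟨i, hi⟩
  · rw [h.extension_of_mem hzS]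
    exact hD z hzS (by linarith)
  rw [h.family.discExtension_of_mem_ball hi]
  have hri := h.family.1 i
  have hri' := h.family'.1 i
  have hi' := mem_ball.1 hi
  rcases le_or_gt (r i) (2 * R) with hle | hlt
  · have hsph : ∀ w ∈ sphere (c i) (r i), f w ∈ closedBall (f s) D := by
      intro w hw
      refine hD w (h.family.sphere_subset i hw) ?_
      have h1 := dist_triangle w z s
      have h2 := dist_triangle_right w z (c i)
      rw [mem_sphere.1 hw] at h2
      linarith
    have hcen : c' i ∈ closedBall (f s) D := by
      have hsub : sphere (c' i) (r' i) ⊆ closedBall (f s) D := by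
        intro w hw
        obtain ⟨z, hz, rfl⟩ := h.surjOn_circle i hw
        exact hsph z hz
      have e : c' i = midpoint ℝ (c' i + r' i) (c' i - r' i) := by
        rw [midpoint_add_sub]
      rw [e]
      refine Convex.midpoint_mem (convex_closedBall _ _) (hsub ?_) (hsub ?_)
      · simp [abs_of_pos hri']
      · simp [abs_of_pos hri']
    exact coneMap_mem_of_convex hri (convex_closedBall _ _) hcen fun hzc =>
      hsph _ (radial_mem_sphere hri hzc)
  · have hsc : r i ≤ dist s (c i) := by
      by_contra hlt
      exact hs.2 (mem_iUnion.2 ⟨i, not_le.1 hlt⟩)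
    have h1 := dist_triangle_left s (c i) z
    have hzc : z ≠ c i := by
      rintro rfl
      rw [dist_self] at h1
      linarith
    have hmin : min 1 (2 * ‖z - c i‖ / r i) = 1 := by
      rw [min_eq_left]
      rw [le_div_iff₀ hri, ← dist_eq_norm]
      linarith
    rw [coneMap, hmin, Complex.ofReal_one, one_mul, add_sub_cancel]
    refine hD _ (h.family.sphere_subset i (radial_mem_sphere hri hzc)) ?_
    have h2 := dist_radial hzc (ball_subset_closedBall hi)
    have h3 := dist_triangle_left (c i + ((r i / ‖z - c i‖ : ℝ) : ℂ) * (z - c i)) s z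
    linarith

lemma continuousOn_extension (h : IsSchottkyMap Ω Ω' c r c' r' f g) :
    ContinuousOn (discExtension c r c' f) Ω := by
  intro z hz
  rcases mem_residual_or_mem_ball (c := c) (r := r) hz with hzS | ⟨i, hi⟩
  · rw [Metric.continuousWithinAt_iff]
    intro ε hε
    obtain ⟨δ, hδ, hδf⟩ := Metric.continuousWithinAt_iff.1 (h.cont z hzS) (ε / 2) (half_pos hε)
    refine ⟨δ / 5, by positivity, fun {w} hw hwz => ?_⟩
    rw [h.extension_of_mem hzS]
    refine (h.dist_extension_le hzS (R := δ / 5) (D := ε / 2) (fun y hy hyz => ?_) hw hwz).trans_lt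
      (half_lt_self hε)
    exact (hδf hy (by linarith)).le
  · refine ContinuousAt.continuousWithinAt ?_
    have hc := (continuousOn_coneMap (h.family.1 i) (h.cont.mono (h.family.sphere_subset i))
      (h.circle i)).continuousAt (x := z)
    refine hc.congr ?_
    filter_upwards [isOpen_ball.mem_nhds hi] with w hw
    exact (h.family.discExtension_of_mem_ball hw).symm

lemma isCompact_preimage_extension (h : IsSchottkyMap Ω Ω' c r c' r' f g) {K : Set ℂ}
    (hK : K ⊆ Ω') (hKc : IsCompact K) : IsCompact (Ω ∩ discExtension c r c' f ⁻¹' K) := by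
  set K1 := saturation c' r' K with hK1
  have hK1c := h.family'.isCompact_saturation h.bdd' hK hKc
  have hK1s := h.family'.saturation_subset hK
  have hTK : IsCompact (discResidual Ω' c' r' ∩ K1) := by
    have : discResidual Ω' c' r' ∩ K1 = K1 \ ⋃ i, ball (c' i) (r' i) := by
      ext z
      constructor
      · rintro ⟨h1, h2⟩; exact ⟨h2, h1.2⟩
      · rintro ⟨h1, h2⟩; exact ⟨⟨hK1s h1, h2⟩, h1⟩
    rw [this]
    exact hK1c.diff (isOpen_iUnion fun _ => isOpen_ball)
  set K2 := g '' (discResidual Ω' c' r' ∩ K1) with hK2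
  have hK2c : IsCompact K2 := hTK.image_of_continuousOn (h.cont'.mono inter_subset_left)
  have hK2s : K2 ⊆ Ω := by
    rintro _ ⟨z, hz, rfl⟩
    exact (h.mapsTo' hz.1).1
  have hK3c := h.family.isCompact_saturation h.bdd hK2s hK2c
  have hK3s := h.family.saturation_subset hK2s
  have e : Ω ∩ discExtension c r c' f ⁻¹' K =
      saturation c r K2 ∩ discExtension c r c' f ⁻¹' K := by
    ext z
    constructor
    · rintro ⟨hz, hzK⟩
      refine ⟨?_, hzK⟩
      rcases mem_residual_or_mem_ball (c := c) (r := r) hz with hzS | ⟨i, hi⟩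
      · rw [mem_preimage, h.extension_of_mem hzS] at hzK
        exact Or.inl ⟨f z, ⟨h.mapsTo hzS, Or.inl hzK⟩, h.leftInv z hzS⟩
      · have h1 := h.extension_mem_closedBall (ball_subset_closedBall hi)
        have h2 := closedBall_subset_saturation h1 hzK
        have hw : c' i + r' i ∈ sphere (c' i) (r' i) := by
          simp [abs_of_pos (h.family'.1 i)]
        refine closedBall_subset_saturation (z := g (c' i + r' i))
          (sphere_subset_closedBall (h.circle' i hw)) ?_ (ball_subset_closedBall hi)
        exact ⟨_, ⟨h.family'.sphere_subset i hw, h2 (sphere_subset_closedBall hw)⟩, rfl⟩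
    · rintro ⟨hz, hzK⟩
      exact ⟨hK3s hz, hzK⟩
  rw [e]
  obtain ⟨t, ht, hte⟩ := continuousOn_iff_isClosed.1 (h.continuousOn_extension.mono hK3s) K
    hKc.isClosed
  rw [inter_comm, hte]
  exact hK3c.inter_left ht

end IsSchottkyMap

end

lemma planeDegree_sub_center_of_conj {F : ℂ → ℂ} {c c' : ℂ} {r r' : ℝ} (hr : 0 < r) (hr' : 0 < r')
    (h : IsPosOriented (fun z => (starRingEnd ℂ) (F z)) c r ((starRingEnd ℂ) c') r') :
    planeDegree (fun z => F z - c') (ball c r) = -1 := by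
  obtain ⟨P, hP, hPF, -⟩ := h.exists_phase
  have hr0 : (r : ℂ) ≠ 0 := by exact_mod_cast hr.ne'
  set W : ℝ → ℂ → ℂ := fun t z => (((1 - t) * (r' / r) + t : ℝ) : ℂ) * (starRingEnd ℂ)
    ((z - c) * Complex.exp ((((1 - t) * P ((z - c) / r) : ℝ) : ℂ) * Complex.I)) with hW
  have hWc : ContinuousOn (Function.uncurry W) (Icc (0 : ℝ) 1 ×ˢ sphere c r) := by
    have h1 : ContinuousOn (fun p : ℝ × ℂ => (p.2 - c) / r) (Icc (0 : ℝ) 1 ×ˢ sphere c r) :=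
      ((continuous_snd.sub continuous_const).div_const _).continuousOn
    have hP' := hP.comp h1 fun p hp => (eq_add_mul_of_mem_sphere hr hp.2).1
    have h2 : ContinuousOn (fun p : ℝ × ℂ => (1 - p.1) * P ((p.2 - c) / r))
        (Icc (0 : ℝ) 1 ×ˢ sphere c r) := (by fun_prop : Continuous fun p : ℝ × ℂ => 1 - p.1).continuousOn.mul hP'
    have h3 := Complex.continuous_exp.comp_continuousOn
      ((Complex.continuous_ofReal.comp_continuousOn h2).mul
        (continuousOn_const (c := Complex.I)))
    have h4 : Continuous fun p : ℝ × ℂ => (((1 - p.1) * (r' / r) + p.1 : ℝ) : ℂ) := by fun_prop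
    have h5 : Continuous fun p : ℝ × ℂ => p.2 - c := by fun_prop
    exact h4.continuousOn.mul (Complex.continuous_conj.comp_continuousOn (h5.continuousOn.mul h3))
  have hW0 : ∀ t ∈ Icc (0 : ℝ) 1, ∀ z ∈ sphere c r, W t z ≠ 0 := by
    intro t ht z hz
    have h1 : 0 < (1 - t) * (r' / r) + t := by
      have := div_pos hr' hr
      rcases eq_or_lt_of_le ht.1 with rfl | h
      · simpa using this
      · nlinarith [ht.2, mul_nonneg (sub_nonneg.2 ht.2) this.le]
    have h2 : z - c ≠ 0 := by
      rw [sub_ne_zero]; exact ne_of_mem_sphere hz hr.ne'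
    refine mul_ne_zero (by exact_mod_cast h1.ne') ?_
    rw [Ne, map_eq_zero]
    exact mul_ne_zero h2 (Complex.exp_ne_zero _)
  have key := planeDegree_homotopy isPreconnected_Icc isOpen_ball isBounded_ball (U := ball c r)
    (G := W) (by rwa [frontier_ball' hr]) (by rwa [frontier_ball' hr]) (x := 0) (y := 1)
    (by simp) (by simp)
  rw [← planeDegree_congr isOpen_ball isBounded_ball (G := W 0) (G' := fun z => F z - c'), key]
  · rw [← planeDegree_conj_sub isOpen_ball isBounded_ball (mem_ball_self hr)]
    congr 1
    funext z
    simp [hW]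
  · rw [frontier_ball' hr]
    exact hWc.comp (f := fun z => ((0 : ℝ), z)) (by fun_prop) fun z hz => ⟨by simp, hz⟩
  · rw [frontier_ball' hr]
    intro z hz
    obtain ⟨hus, hz'⟩ := eq_add_mul_of_mem_sphere hr hz
    have e := hPF _ hus
    rw [← hz'] at e
    have e' := congrArg (starRingEnd ℂ) e
    rw [Complex.conj_conj, map_add, Complex.conj_conj, map_mul, Complex.conj_ofReal] at e'
    simp only [hW]
    rw [e', add_sub_cancel_left]
    simp only [sub_zero, one_mul, add_zero, map_mul, map_sub, map_div₀, Complex.conj_ofReal,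
      Complex.ofReal_div]
    field_simp
  · rw [frontier_ball' hr]
    exact hW0 0 (by simp)

lemma exists_isOpen_bounded_between {Z Ω : Set ℂ} (hZ : IsCompact Z) (hΩ : IsOpen Ω) (h : Z ⊆ Ω) :
    ∃ U, IsOpen U ∧ Bornology.IsBounded U ∧ Z ⊆ U ∧ closure U ⊆ Ω := by
  obtain ⟨K, hK, hZK, hKΩ⟩ := exists_compact_between hZ hΩ h
  exact ⟨interior K, isOpen_interior, hK.isBounded.subset interior_subset, hZK,
    (closure_minimal interior_subset hK.isClosed).trans hKΩ⟩

lemma IsPlaneDomain.exists_compact_preconnected {Ω : Set ℂ} (h : IsPlaneDomain Ω) {a b : ℂ}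
    (ha : a ∈ Ω) (hb : b ∈ Ω) :
    ∃ E ⊆ Ω, IsCompact E ∧ IsPreconnected E ∧ a ∈ E ∧ b ∈ E := by
  have hp : IsPathConnected Ω := h.1.isConnected_iff_isPathConnected.1 h.2
  obtain ⟨γ, hγ⟩ := hp.joinedIn a ha b hb
  exact ⟨range γ, range_subset_iff.2 hγ, isCompact_range γ.continuous,
    isPreconnected_range γ.continuous, ⟨0, γ.source⟩, ⟨1, γ.target⟩⟩

namespace IsSchottkyMap

variable {I : Type*} {Ω Ω' : Set ℂ} {c : I → ℂ} {r : I → ℝ} {c' : I → ℂ} {r' : I → ℝ} {f g : ℂ → ℂ}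

lemma oriented (h : IsSchottkyMap Ω Ω' c r c' r' f g) (i : I) :
    IsPosOriented f (c i) (r i) (c' i) (r' i) ∨
      IsPosOriented (fun z => (starRingEnd ℂ) (f z)) (c i) (r i) ((starRingEnd ℂ) (c' i)) (r' i) :=
  exists_oriented_lift (h.family.1 i) (h.family'.1 i) (h.cont.mono (h.family.sphere_subset i))
    (h.circle i) (h.injOn.mono (h.family.sphere_subset i))

lemma extension_add_mul_exp (h : IsSchottkyMap Ω Ω' c r c' r' f g) (i : I) (θ : ℝ) :
    discExtension c r c' f (c i + r i * Complex.exp (θ * Complex.I)) =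
      f (c i + r i * Complex.exp (θ * Complex.I)) := by
  refine h.extension_of_mem (h.family.sphere_subset i ?_)
  rw [mem_sphere, dist_eq_norm, add_sub_cancel_left, norm_mul, Complex.norm_exp_ofReal_mul_I,
    mul_one, Complex.norm_of_nonneg (h.family.1 i).le]

lemma posOriented_extension (h : IsSchottkyMap Ω Ω' c r c' r' f g) {i : I}
    (hi : IsPosOriented f (c i) (r i) (c' i) (r' i)) :
    IsPosOriented (discExtension c r c' f) (c i) (r i) (c' i) (r' i) := by
  obtain ⟨φ, h1, h2, h3, h4⟩ := hi
  exact ⟨φ, h1, h2, h3, fun θ => by rw [h.extension_add_mul_exp, h4]⟩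

lemma degree_extension_of_pos (h : IsSchottkyMap Ω Ω' c r c' r' f g) {i : I}
    (hi : IsPosOriented f (c i) (r i) (c' i) (r' i)) :
    planeDegree (fun z => discExtension c r c' f z - c' i) (ball (c i) (r i)) = 1 :=
  planeDegree_sub_center (h.family.1 i) (h.family'.1 i) (h.posOriented_extension hi)

lemma degree_extension_of_neg (h : IsSchottkyMap Ω Ω' c r c' r' f g) {i : I}
    (hi : IsPosOriented (fun z => (starRingEnd ℂ) (f z)) (c i) (r i)
      ((starRingEnd ℂ) (c' i)) (r' i)) :
    planeDegree (fun z => discExtension c r c' f z - c' i) (ball (c i) (r i)) = -1 := by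
  refine planeDegree_sub_center_of_conj (h.family.1 i) (h.family'.1 i) ?_
  obtain ⟨φ, h1, h2, h3, h4⟩ := hi
  exact ⟨φ, h1, h2, h3, fun θ => by
    rw [← h4]
    exact congrArg (starRingEnd ℂ) (h.extension_add_mul_exp i θ)⟩

/-- The degree of the extension at a center may be computed on the corresponding disc. -/
lemma degree_extension_excision (h : IsSchottkyMap Ω Ω' c r c' r' f g) {i : I} {U : Set ℂ}
    (hU : IsOpen U) (hb : Bornology.IsBounded U) (hUΩ : closure U ⊆ Ω)
    (hiU : ball (c i) (r i) ⊆ U) :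
    planeDegree (fun z => discExtension c r c' f z - c' i) U =
      planeDegree (fun z => discExtension c r c' f z - c' i) (ball (c i) (r i)) := by
  refine planeDegree_excision hU hb isOpen_ball hiU
    ((h.continuousOn_extension.mono hUΩ).sub continuousOn_const) ?_
  intro z hz h0
  refine h.mem_ball_of_extension (hUΩ hz) ?_
  rw [sub_eq_zero.1 h0]
  exact mem_ball_self (h.family'.1 i)

lemma degree_extension_eq (h : IsSchottkyMap Ω Ω' c r c' r' f g) (i j : I) :
    planeDegree (fun z => discExtension c r c' f z - c' i) (ball (c i) (r i)) =
      planeDegree (fun z => discExtension c r c' f z - c' j) (ball (c j) (r j)) := by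
  have hci : ∀ i, c' i ∈ closedBall (c' i) (r' i) := fun i => mem_closedBall_self (h.family'.1 i).le
  obtain ⟨E, hE, hEc, hEp, hi, hj⟩ := h.domain'.exists_compact_preconnected
    (h.family'.2.1 i (hci i)) (h.family'.2.1 j (hci j))
  set E' := E ∪ (closedBall (c' i) (r' i) ∪ closedBall (c' j) (r' j)) with hE'
  have hE'Ω : E' ⊆ Ω' := union_subset hE (union_subset (h.family'.2.1 i) (h.family'.2.1 j))
  have hE'c : IsCompact E' :=
    hEc.union ((isCompact_closedBall _ _).union (isCompact_closedBall _ _))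
  have hZ := h.isCompact_preimage_extension hE'Ω hE'c
  obtain ⟨U, hU, hUb, hZU, hUΩ⟩ := exists_isOpen_bounded_between hZ h.domain.1 inter_subset_left
  have hballU : ∀ k, closedBall (c' k) (r' k) ⊆ E' → ball (c k) (r k) ⊆ U := by
    intro k hk z hz
    exact hZU ⟨h.family.2.1 k (ball_subset_closedBall hz),
      hk (h.extension_mem_closedBall (ball_subset_closedBall hz))⟩
  rw [← h.degree_extension_excision hU hUb hUΩ (hballU i (subset_union_left.trans subset_union_right)),
    ← h.degree_extension_excision hU hUb hUΩ (hballU j (subset_union_right.trans subset_union_right))]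
  refine planeDegree_homotopy hEp hU hUb (G := fun w z => discExtension c r c' f z - w) ?_ ?_ hi hj
  · have hc : ContinuousOn (discExtension c r c' f) (frontier U) :=
      h.continuousOn_extension.mono (frontier_subset_closure.trans hUΩ)
    exact (hc.comp continuousOn_snd fun p hp => hp.2).sub continuousOn_fst
  · intro w hw z hz h0
    have hzU : z ∉ U := by
      rw [hU.frontier_eq] at hz; exact hz.2
    refine hzU (hZU ⟨hUΩ (frontier_subset_closure hz), Or.inl ?_⟩)
    rw [sub_eq_zero.1 h0]
    exact hw

/-- All peripheral circles have the same orientation behaviour. -/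
lemma oriented_consistent (h : IsSchottkyMap Ω Ω' c r c' r' f g) :
    (∀ i, IsPosOriented f (c i) (r i) (c' i) (r' i)) ∨
      ∀ i, IsPosOriented (fun z => (starRingEnd ℂ) (f z)) (c i) (r i)
        ((starRingEnd ℂ) (c' i)) (r' i) := by
  by_contra hcon
  push Not at hcon
  obtain ⟨⟨i, hi⟩, ⟨j, hj⟩⟩ := hcon
  have h1 := h.degree_extension_of_neg ((h.oriented i).resolve_left hi)
  have h2 := h.degree_extension_of_pos ((h.oriented j).resolve_right hj)
  rw [h.degree_extension_eq i j, h2] at h1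
  norm_num at h1

end IsSchottkyMap

/-- The rescaled bump function, of integral one. -/
def mollifier (s : ℝ) (w : ℂ) : ℝ := s ^ 2 * planeBump (s * w)

lemma contDiff_planeBump_two : ContDiff ℝ 2 planeBump := by
  unfold planeBump
  exact (contDiff_lineBump (n := 2)).comp Complex.reCLM.contDiff |>.mul
    ((contDiff_lineBump (n := 2)).comp Complex.imCLM.contDiff)

lemma contDiff_mollifier (s : ℝ) : ContDiff ℝ 2 (mollifier s) :=
  contDiff_const.mul (contDiff_planeBump_two.comp (contDiff_const.mul contDiff_id))

lemma mollifier_nonneg (s : ℝ) (w : ℂ) : 0 ≤ mollifier s w :=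
  mul_nonneg (sq_nonneg _) (planeBump_nonneg _)

lemma mollifier_eq_zero {s : ℝ} (hs : 0 < s) {w : ℂ} (hw : s⁻¹ ≤ ‖w‖) : mollifier s w = 0 := by
  unfold mollifier
  rw [planeBump_eq_zero, mul_zero]
  rw [norm_mul, Complex.norm_real, Real.norm_of_nonneg hs.le]
  calc 1 = s * s⁻¹ := (mul_inv_cancel₀ hs.ne').symm
    _ ≤ _ := by gcongr

lemma hasCompactSupport_mollifier {s : ℝ} (hs : 0 < s) : HasCompactSupport (mollifier s) := by
  refine HasCompactSupport.intro (isCompact_closedBall (0 : ℂ) s⁻¹) fun x hx => ?_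
  apply mollifier_eq_zero hs
  simp at hx
  exact hx.le

lemma integral_mollifier {s : ℝ} (hs : 0 < s) : ∫ w, mollifier s w = 1 := by
  have := planeBump_scale_integral hs 0
  simp only [sub_zero] at this
  unfold mollifier
  rw [integral_const_mul, this, mul_inv_cancel₀ (by positivity)]

lemma integrable_mollifier {s : ℝ} (hs : 0 < s) : Integrable (mollifier s) :=
  (contDiff_mollifier s).continuous.integrable_of_hasCompactSupport (hasCompactSupport_mollifier hs)

lemma exists_lipschitz_planeBump : ∃ L : ℝ≥0, LipschitzWith L planeBump :=
  ContDiff.lipschitzWith_of_hasCompactSupport hasCompactSupport_planeBump contDiff_planeBump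
    (by norm_num)

/-- Mollification at scale `ε`, with the derivative controlled by the local oscillation. -/
theorem exists_mollification : ∃ C₀ : ℝ, 0 < C₀ ∧ ∀ (F : ℂ → ℂ) (K : Set ℂ), IsCompact K →
    ContinuousOn F K → ∀ ε : ℝ, 0 < ε → ∃ H : ℂ → ℂ, ContDiff ℝ 2 H ∧
      ∀ (z w : ℂ) (D : ℝ), ball z (2 * ε) ⊆ K → (∀ y ∈ ball z (2 * ε), ‖F y - w‖ ≤ D) →
        ‖H z - w‖ ≤ D ∧ ‖fderiv ℝ H z‖ ≤ C₀ * D / ε := by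
  obtain ⟨L, hL⟩ := exists_lipschitz_planeBump
  refine ⟨4 * Real.pi * L + 1, by positivity, fun F K hK hF ε hε => ?_⟩
  set s : ℝ := ε⁻¹ with hs_def
  have hs : 0 < s := inv_pos.2 hε
  have hsi : s⁻¹ = ε := inv_inv ε
  set F₁ : ℂ → ℂ := K.indicator F with hF₁
  have hF₁i : Integrable F₁ := (hF.integrableOn_compact hK).integrable_indicator hK.measurableSet
  have hki : ∀ z : ℂ, Integrable fun y => mollifier s (z - y) := fun z =>
    (integrable_mollifier hs).comp_sub_left z
  have hk1 : ∀ z : ℂ, ∫ y, mollifier s (z - y) = 1 := fun z => by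
    rw [integral_sub_left_eq_self (mollifier s) volume z, integral_mollifier hs]
  have hprod : ∀ z : ℂ, Integrable fun y => mollifier s (z - y) • F₁ y := fun z =>
    ((hasCompactSupport_mollifier hs).convolutionExists_left
      (ContinuousLinearMap.lsmul ℝ ℝ) (contDiff_mollifier s).continuous
      hF₁i.locallyIntegrable z).integrable_swap
  set H : ℂ → ℂ := fun z => ∫ y, mollifier s (z - y) • F₁ y with hH
  have hHc : ContDiff ℝ 2 H := by
    have hconv : H = MeasureTheory.convolution (mollifier s) F₁
        (ContinuousLinearMap.lsmul ℝ ℝ : ℝ →L[ℝ] ℂ →L[ℝ] ℂ) volume := by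
      funext z
      rw [MeasureTheory.convolution_eq_swap]
      rfl
    rw [hconv]
    exact (hasCompactSupport_mollifier hs).contDiff_convolution_left (n := (2 : ℕ∞)) _
      (contDiff_mollifier s) hF₁i.locallyIntegrable
  have hHw : ∀ z w : ℂ, H z - w = ∫ y, mollifier s (z - y) • (F₁ y - w) := fun z w => by
    have : ∀ y, mollifier s (z - y) • (F₁ y - w)
        = mollifier s (z - y) • F₁ y - mollifier s (z - y) • w := fun y => smul_sub _ _ _
    simp_rw [this]
    rw [integral_sub (hprod z) ((hki z).smul_const w), integral_smul_const, hk1, one_smul]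
  have hiw : ∀ z w : ℂ, Integrable fun y => mollifier s (z - y) • (F₁ y - w) := fun z w => by
    simp_rw [smul_sub]
    exact (hprod z).sub ((hki z).smul_const w)
  refine ⟨H, hHc, fun z w D hzK hD => ?_⟩
  have hD0 : 0 ≤ D := (norm_nonneg _).trans (hD z (mem_ball_self (by positivity)))
  have hF₁D : ∀ y ∈ ball z (2 * ε), ‖F₁ y - w‖ ≤ D := fun y hy => by
    rw [hF₁, indicator_of_mem (hzK hy)]; exact hD y hy
  have hfar : ∀ x y : ℂ, dist x z < ε → y ∉ ball z (2 * ε) → mollifier s (x - y) = 0 := by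
    intro x y hx hy
    apply mollifier_eq_zero hs
    rw [hsi, ← dist_eq_norm]
    rw [mem_ball, not_lt] at hy
    have := dist_triangle_left y z x
    linarith
  constructor
  · rw [hHw]
    calc ‖∫ y, mollifier s (z - y) • (F₁ y - w)‖ ≤ ∫ y, mollifier s (z - y) * D := by
          apply norm_integral_le_of_norm_le ((hki z).mul_const D)
          refine Eventually.of_forall fun y => ?_
          rw [norm_smul, Real.norm_of_nonneg (mollifier_nonneg _ _)]
          by_cases hy : y ∈ ball z (2 * ε)
          · exact mul_le_mul_of_nonneg_left (hF₁D y hy) (mollifier_nonneg _ _)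
          · rw [hfar z y (by simpa using hε) hy]; simp
      _ = D := by rw [integral_mul_const, hk1, one_mul]
  · have hd : HasFDerivAt H (fderiv ℝ H z) z :=
      (hHc.differentiable (by norm_num) z).hasFDerivAt
    have hCL : 0 ≤ 4 * Real.pi * L * D / ε := by positivity
    have : ‖fderiv ℝ H z‖ ≤ 4 * Real.pi * L * D / ε := by
      refine hd.le_of_lip' hCL ?_
      filter_upwards [ball_mem_nhds z hε] with x hx
      have hsub : H x - H z = ∫ y in ball z (2 * ε),
          (mollifier s (x - y) - mollifier s (z - y)) • (F₁ y - w) := by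
        have e1 : H x - H z = (H x - w) - (H z - w) := by ring
        rw [e1, hHw, hHw, ← integral_sub (hiw x w) (hiw z w)]
        rw [setIntegral_eq_integral_of_forall_compl_eq_zero]
        · congr 1; ext y; rw [sub_smul]
        · intro y hy
          rw [hfar x y hx hy, hfar z y (by simpa using hε) hy]; simp
      rw [hsub]
      have hb : ∀ y ∈ ball z (2 * ε),
          ‖(mollifier s (x - y) - mollifier s (z - y)) • (F₁ y - w)‖ ≤
            s ^ 2 * (L * (s * ‖x - z‖)) * D := by
        intro y hy
        rw [norm_smul]
        refine mul_le_mul ?_ (hF₁D y hy) (norm_nonneg _) (by positivity)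
        unfold mollifier
        rw [← mul_sub, norm_mul, Real.norm_of_nonneg (sq_nonneg s)]
        gcongr
        rw [← dist_eq_norm]
        refine (hL.dist_le_mul _ _).trans ?_
        gcongr
        rw [dist_eq_norm, ← mul_sub, norm_mul, Complex.norm_real, Real.norm_of_nonneg hs.le]
        simp
      refine (norm_setIntegral_le_of_norm_le_const (by simp [Complex.volume_ball, ENNReal.mul_lt_top]) hb).trans ?_
      rw [Measure.real, Complex.volume_ball]
      simp only [ENNReal.toReal_mul, ENNReal.toReal_pow, ENNReal.toReal_ofReal (by positivity : 0 ≤ 2 * ε)]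
      rw [hs_def]
      apply le_of_eq
      simp only [ENNReal.coe_toReal, NNReal.coe_real_pi]
      field_simp
      ring
    refine this.trans ?_
    gcongr
    linarith

/-- A planar map differing from a complex affine map by `H` has Jacobian at least
`-‖fderiv H‖²`. -/
lemma neg_sq_le_jac_sub_affine {H : ℂ → ℂ} (hH : Differentiable ℝ H) (a b z : ℂ) :
    -‖fderiv ℝ H z‖ ^ 2 ≤ jac (fun z => H z - (a * z + b)) z := by
  have hA : HasFDerivAt (fun z : ℂ => a * z + b)
      ((ContinuousLinearMap.mul ℝ ℂ a)) z := by
    exact ((ContinuousLinearMap.mul ℝ ℂ a).hasFDerivAt).add_const b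
  have hd := ((hH z).hasFDerivAt.sub hA).fderiv
  have hX : ‖fderiv ℝ H z 1‖ ≤ ‖fderiv ℝ H z‖ := by
    simpa using (fderiv ℝ H z).le_opNorm 1
  have hY : ‖fderiv ℝ H z Complex.I‖ ≤ ‖fderiv ℝ H z‖ := by
    simpa using (fderiv ℝ H z).le_opNorm Complex.I
  have e : fderiv ℝ (fun z => H z - (a * z + b)) z
      = fderiv ℝ H z - ContinuousLinearMap.mul ℝ ℂ a := hd
  unfold jac
  rw [e]
  set X := fderiv ℝ H z 1
  set Y := fderiv ℝ H z Complex.I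
  have h1 : X.re ^ 2 + X.im ^ 2 ≤ ‖fderiv ℝ H z‖ ^ 2 := by
    have := pow_le_pow_left₀ (norm_nonneg _) hX 2
    rw [Complex.sq_norm, Complex.normSq_apply] at this
    linarith
  have h2 : Y.re ^ 2 + Y.im ^ 2 ≤ ‖fderiv ℝ H z‖ ^ 2 := by
    have := pow_le_pow_left₀ (norm_nonneg _) hY 2
    rw [Complex.sq_norm, Complex.normSq_apply] at this
    linarith
  have eX : (fderiv ℝ H z - ContinuousLinearMap.mul ℝ ℂ a) 1 = X - a := by simp [X]
  have eY : (fderiv ℝ H z - ContinuousLinearMap.mul ℝ ℂ a) Complex.I = Y - a * Complex.I := by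
    simp [Y]
  rw [eX, eY]
  simp only [Complex.sub_re, Complex.sub_im, Complex.mul_re, Complex.mul_im, Complex.I_re,
    Complex.I_im, mul_zero, mul_one, zero_sub, sub_neg_eq_add, add_zero]
  nlinarith [sq_nonneg (a.re - (X.re + Y.im) / 2), sq_nonneg (a.im - (X.im - Y.re) / 2),
    sq_nonneg (X.re + Y.im), sq_nonneg (X.im - Y.re)]

/-- If a smooth map has degree one over `U` but degree at least two over a union of discs, its
Jacobian is substantially negative on the part of `U` outside the discs. -/
theorem one_le_integral_of_degree {I : Type*} {U : Set ℂ} (hb : Bornology.IsBounded U) {H : ℂ → ℂ} (hH : ContDiff ℝ 2 H) {s : ℝ} {w : ℂ}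
    (hdeg : smoothDegree (fun z => s * (H z - w)) U = 1) {J : Finset I} {c : I → ℂ} {r : I → ℝ}
    (hdisj : (J : Set I).PairwiseDisjoint fun k => ball (c k) (r k))
    (hoff : ∀ k ∈ J, ∀ z ∈ ball (c k) (r k), z ∉ U → planeBump (s * (H z - w)) = 0)
    (hnn : ∀ k ∈ J, 0 ≤ smoothDegree (fun z => s * (H z - w)) (ball (c k) (r k)))
    {i j : I} (hi : i ∈ J) (hj : j ∈ J) (hij : i ≠ j)
    (hdi : smoothDegree (fun z => s * (H z - w)) (ball (c i) (r i)) = 1)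
    (hdj : smoothDegree (fun z => s * (H z - w)) (ball (c j) (r j)) = 1)
    {q : ℂ → ℝ} (hq : Continuous q) (hJ : ∀ z, -q z ≤ jac H z) :
    1 ≤ ∫ z in U \ ⋃ k ∈ J, ball (c k) (r k), planeBump (s * (H z - w)) * (s ^ 2 * q z) := by
  classical
  set B : Set ℂ := ⋃ k ∈ J, ball (c k) (r k) with hB
  set g : ℂ → ℝ := fun z => planeBump (s * (H z - w)) * jac (fun z => s * (H z - w)) z with hg
  have hHw : ContDiff ℝ 2 fun z => (s : ℂ) * (H z - w) := contDiff_const.mul (hH.sub contDiff_const)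
  have hgc : Continuous g := by
    refine (continuous_planeBump.comp hHw.continuous).mul ?_
    rw [continuous_iff_continuousAt]
    exact fun z => continuousAt_jac (hHw.contDiffAt.of_le (by norm_num))
  have hgi : ∀ X : Set ℂ, Bornology.IsBounded X → IntegrableOn g X := fun X hX =>
    (hgc.continuousOn.integrableOn_compact hX.isCompact_closure).mono_set subset_closure
  have hBo : IsOpen B := isOpen_biUnion fun _ _ => isOpen_ball
  have hBb : Bornology.IsBounded B :=
    (Bornology.isBounded_biUnion J.finite_toSet).2 fun _ _ => isBounded_ball
  have hBint : ∫ z in B, g z = ∑ k ∈ J, smoothDegree (fun z => s * (H z - w)) (ball (c k) (r k)) :=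
    integral_biUnion_finset J (fun _ _ => measurableSet_ball)
      (fun k hk l hl hkl => hdisj hk hl hkl) fun k _ => hgi _ isBounded_ball
  have hB2 : 2 ≤ ∫ z in B, g z := by
    rw [hBint]
    have hsub : ({i, j} : Finset I) ⊆ J := by
      intro k hk; simp at hk; rcases hk with rfl | rfl <;> assumption
    refine le_trans ?_ (Finset.sum_le_sum_of_subset_of_nonneg hsub fun k hk _ => hnn k hk)
    rw [Finset.sum_pair hij, hdi, hdj]; norm_num
  have hBU : ∫ z in U ∩ B, g z = ∫ z in B, g z := by
    refine Eq.symm (setIntegral_eq_of_subset_of_forall_sdiff_eq_zero hBo.measurableSet inter_subset_right ?_)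
    intro z hz
    obtain ⟨k, hk, hzk⟩ := mem_iUnion₂.1 hz.1
    simp only [hg]
    rw [hoff k hk z hzk fun h => hz.2 ⟨h, hz.1⟩, zero_mul]
  have hUs : (∫ z in U ∩ B, g z) + ∫ z in U \ B, g z = 1 := by
    rw [integral_inter_add_sdiff hBo.measurableSet (hgi _ hb)]
    exact hdeg
  have hR : ∫ z in U \ B, g z ≤ -1 := by linarith
  have hqi : IntegrableOn (fun z => planeBump (s * (H z - w)) * (s ^ 2 * q z)) (U \ B) :=
    ((((continuous_planeBump.comp hHw.continuous).mul
      (continuous_const.mul hq)).continuousOn).integrableOn_compact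
        hb.isCompact_closure).mono_set (sdiff_subset.trans subset_closure)
  have hle : ∫ z in U \ B, -g z ≤ ∫ z in U \ B, planeBump (s * (H z - w)) * (s ^ 2 * q z) := by
    refine setIntegral_mono (hgi _ (hb.subset sdiff_subset)).neg hqi fun z => ?_
    simp only [hg]
    have hHd : DifferentiableAt ℝ (fun z => H z - w) z :=
      ((hH.differentiable (by norm_num)) z).sub_const w
    rw [jac_const_mul s hHd]
    have : jac (fun z => H z - w) z = jac H z := by
      unfold jac; rw [fderiv_sub_const]
    rw [this, ← mul_neg, ← mul_neg]
    have := hJ z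
    exact mul_le_mul_of_nonneg_left (mul_le_mul_of_nonneg_left (by linarith) (sq_nonneg s))
      (planeBump_nonneg _)
  rw [integral_neg] at hle
  linarith

/-- Averaging the preceding lower bound over target points. -/
theorem volume_le_of_one_le_integral {R : Set ℂ}
    (hb : Bornology.IsBounded R) {H : ℂ → ℂ} (hH : Continuous H) {s : ℝ} (hs : 0 < s)
    {q : ℂ → ℝ} (hq : Continuous q) (hq0 : ∀ z, 0 ≤ q z) {A : Set ℂ}
    (h : ∀ w ∈ A, 1 ≤ ∫ z in R, planeBump (s * (H z - w)) * (s ^ 2 * q z)) :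
    volume A ≤ ∫⁻ z in R, ENNReal.ofReal (q z) := by
  have hc : Continuous fun p : ℂ × ℂ => planeBump (s * (H p.2 - p.1)) * (s ^ 2 * q p.2) := by
    refine (continuous_planeBump.comp (by fun_prop)).mul (by fun_prop)
  have hm : Measurable fun p : ℂ × ℂ =>
      ENNReal.ofReal (planeBump (s * (H p.2 - p.1)) * (s ^ 2 * q p.2)) :=
    hc.measurable.ennreal_ofReal
  have h1 : ∀ w ∈ A, 1 ≤ ∫⁻ z in R,
      ENNReal.ofReal (planeBump (s * (H z - w)) * (s ^ 2 * q z)) := by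
    intro w hw
    have hcw : Continuous fun z => planeBump (s * (H z - w)) * (s ^ 2 * q z) := by
      refine (continuous_planeBump.comp (by fun_prop)).mul (by fun_prop)
    have hInt : IntegrableOn (fun z => planeBump (s * (H z - w)) * (s ^ 2 * q z)) R :=
      (hcw.continuousOn.integrableOn_compact hb.isCompact_closure).mono_set subset_closure
    have hpos : 0 ≤ᵐ[volume.restrict R] fun z => planeBump (s * (H z - w)) * (s ^ 2 * q z) :=
      Eventually.of_forall fun z =>
        mul_nonneg (planeBump_nonneg _) (mul_nonneg (sq_nonneg _) (hq0 _))
    rw [← ofReal_integral_eq_lintegral_ofReal hInt hpos, ← ENNReal.ofReal_one]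
    exact ENNReal.ofReal_le_ofReal (h w hw)
  have hmt : Measurable fun w => ∫⁻ z in R,
      ENNReal.ofReal (planeBump (s * (H z - w)) * (s ^ 2 * q z)) :=
    hm.lintegral_prod_right'
  calc volume A ≤ ∫⁻ w, ∫⁻ z in R, ENNReal.ofReal (planeBump (s * (H z - w)) * (s ^ 2 * q z)) := by
        have := mul_meas_ge_le_lintegral₀ (μ := volume) hmt.aemeasurable 1
        rw [one_mul] at this
        exact (measure_mono fun w hw => h1 w hw).trans this
    _ = ∫⁻ z in R, ∫⁻ w, ENNReal.ofReal (planeBump (s * (H z - w)) * (s ^ 2 * q z)) :=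
        lintegral_lintegral_swap hm.aemeasurable
    _ = ∫⁻ z in R, ENNReal.ofReal (q z) := by
        congr 1; ext z
        have e : ∀ w, planeBump (s * (H z - w)) * (s ^ 2 * q z) = mollifier s (H z - w) * q z := by
          intro w; unfold mollifier; ring
        simp_rw [e]
        rw [← ofReal_integral_eq_lintegral_ofReal
          (((integrable_mollifier hs).comp_sub_left (H z)).mul_const (q z))
          (Eventually.of_forall fun w => mul_nonneg (mollifier_nonneg _ _) (hq0 _)),
          integral_mul_const, integral_sub_left_eq_self (mollifier s) volume (H z),
          integral_mollifier hs, one_mul]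

lemma volumeReal_ball (a : ℂ) {r : ℝ} (hr : 0 ≤ r) :
    volume.real (ball a r) = Real.pi * r ^ 2 := by
  rw [Measure.real, Complex.volume_ball]
  simp [ENNReal.toReal_ofReal hr]
  ring

lemma volumeReal_closedBall (a : ℂ) {r : ℝ} (hr : 0 ≤ r) :
    volume.real (closedBall a r) = Real.pi * r ^ 2 := by
  rw [Measure.real, Complex.volume_closedBall]
  simp [ENNReal.toReal_ofReal hr]
  ring

/-- A compact set has a finite separated net at any scale. -/
lemma exists_finite_net {K : Set ℂ} (hK : IsCompact K) {ε : ℝ} (hε : 0 < ε) :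
    ∃ N : Finset ℂ, ↑N ⊆ K ∧ (∀ x ∈ N, ∀ y ∈ N, x ≠ y → ε < dist x y) ∧
      ∀ z ∈ K, ∃ s ∈ N, dist z s ≤ ε := by
  set e : ℝ≥0 := (ε / 2).toNNReal with he
  have hee : (e : ℝ) = ε / 2 := Real.coe_toNNReal _ (by positivity)
  have he0 : e ≠ 0 := (Real.toNNReal_pos.2 (by positivity)).ne'
  have h2e : ((2 * e : ℝ≥0) : ℝ) = ε := by push_cast; rw [hee]; ring
  obtain ⟨C, -, hCf, hC⟩ := exists_finite_isCover_of_isCompact he0 hK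
  have htop : packingNumber (2 * e) K ≠ ⊤ := by
    refine ne_top_of_le_ne_top (encard_ne_top_iff.2 hCf) ?_
    exact (packingNumber_two_mul_le_externalCoveringNumber e K).trans
      hC.externalCoveringNumber_le_encard
  have hfin : (maximalSeparatedSet (2 * e) K).Finite := by
    rw [← encard_ne_top_iff, encard_maximalSeparatedSet htop]; exact htop
  refine ⟨hfin.toFinset, by simpa using maximalSeparatedSet_subset, ?_, ?_⟩
  · intro x hx y hy hxy
    have : ((2 * e : ℝ≥0) : ℝ≥0∞) < edist x y :=
      isSeparated_maximalSeparatedSet (hfin.mem_toFinset.1 hx) (hfin.mem_toFinset.1 hy) hxy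
    rw [edist_nndist, ENNReal.coe_lt_coe, ← NNReal.coe_lt_coe, h2e] at this
    exact this
  · intro z hz
    have := (isCover_maximalSeparatedSet htop).subset_iUnion_closedBall hz
    obtain ⟨s, hs, hzs⟩ := mem_iUnion₂.1 this
    exact ⟨s, hfin.mem_toFinset.2 hs, by rw [← h2e]; exact hzs⟩

/-- If `f` is weakly quasisymmetric on a compact set and the image is null, then at small scales
the squared local oscillations over a net have small sum. -/
theorem exists_controlled_net {f : ℂ → ℂ} {K₁ K₂ : Set ℂ} (hK₁ : IsCompact K₁)
    (hK₂ : IsCompact K₂) (h12 : K₁ ⊆ K₂) (hf : ContinuousOn f K₂)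
    (hnull : volume (f '' K₁) = 0) {C C' : ℝ} (hC : 0 < C) (hC' : 1 ≤ C')
    (hw : ∀ s ∈ K₂, ∀ l ∈ K₂, ∀ z ∈ K₂, dist z s ≤ C * dist l s →
      dist (f z) (f s) ≤ C' * dist (f l) (f s)) {κ : ℝ} (hκ : 0 < κ) :
    ∃ ε₀ > 0, ∀ ε : ℝ, 0 < ε → ε < ε₀ → ∃ (N : Finset ℂ) (D : ℂ → ℝ), ↑N ⊆ K₁ ∧
      (∀ x ∈ N, ∀ y ∈ N, x ≠ y → ε < dist x y) ∧ (∀ z ∈ K₁, ∃ s ∈ N, dist z s ≤ ε) ∧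
      (∀ s ∈ N, 0 ≤ D s) ∧ (∀ s ∈ N, ∀ z ∈ K₂, dist z s < C * ε → dist (f z) (f s) ≤ D s) ∧
      ∑ s ∈ N, D s ^ 2 ≤ κ := by
  have hC'0 : 0 < C' := by linarith
  have hcomp : IsCompact (f '' K₁) := hK₁.image_of_continuousOn (hf.mono h12)
  set κ' : ℝ := Real.pi * κ / (4 * C' ^ 2) with hκ'
  have hκ'0 : 0 < κ' := by positivity
  have hev : ∀ᶠ ω in 𝓝 (0 : ℝ), volume (cthickening ω (f '' K₁)) < ENNReal.ofReal κ' := by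
    have := tendsto_measure_cthickening_of_isCompact (μ := volume) hcomp
    rw [hnull] at this
    exact this.eventually_lt_const (ENNReal.ofReal_pos.2 hκ'0)
  obtain ⟨ω, hω, hω0⟩ := ((hev.filter_mono nhdsWithin_le_nhds).and
    (self_mem_nhdsWithin : ∀ᶠ ω in 𝓝[>] (0 : ℝ), ω ∈ Ioi 0)).exists
  obtain ⟨δ, hδ, hδω⟩ := Metric.uniformContinuousOn_iff.1
    (hK₂.uniformContinuousOn_of_continuous hf) ω hω0
  refine ⟨δ / C, by positivity, fun ε hε hεδ => ?_⟩
  rw [lt_div_iff₀ hC] at hεδ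
  obtain ⟨N, hNK, hsep, hcov⟩ := exists_finite_net hK₁ hε
  set A : ℂ → Set ℝ := fun s => (fun z => dist (f z) (f s)) '' {z ∈ K₂ | dist z s < C * ε} with hA
  have hAω : ∀ s ∈ N, ∀ x ∈ A s, x ≤ ω := by
    rintro s hs _ ⟨z, ⟨hz, hzs⟩, rfl⟩
    exact (hδω z hz s (h12 (hNK hs)) (by nlinarith)).le
  have hle : ∀ s ∈ N, ∀ z ∈ K₂, dist z s < C * ε → dist (f z) (f s) ≤ sSup (A s) :=
    fun s hs z hz hzs => le_csSup ⟨ω, hAω s hs⟩ ⟨z, ⟨hz, hzs⟩, rfl⟩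
  have h0 : ∀ s ∈ N, 0 ≤ sSup (A s) := fun s hs =>
    dist_nonneg.trans (hle s hs s (h12 (hNK hs)) (by simp; positivity))
  refine ⟨N, fun s => sSup (A s), hNK, hsep, hcov, h0, hle, ?_⟩
  have hDω : ∀ s ∈ N, sSup (A s) ≤ ω := fun s hs => Real.sSup_le (hAω s hs) hω0.le
  have hDl : ∀ s ∈ N, ∀ l ∈ N, l ≠ s → sSup (A s) ≤ C' * dist (f l) (f s) := by
    intro s hs l hl hls
    refine Real.sSup_le ?_ (by positivity)
    rintro _ ⟨z, ⟨hz, hzs⟩, rfl⟩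
    refine hw s (h12 (hNK hs)) l (h12 (hNK hl)) z hz (hzs.le.trans ?_)
    exact mul_le_mul_of_nonneg_left (hsep l hl s hs hls).le hC.le
  have hdisj : (N : Set ℂ).PairwiseDisjoint fun s => ball (f s) (sSup (A s) / (2 * C')) := by
    intro s hs l hl hsl
    refine ball_disjoint_ball ?_
    have h1 := hDl s hs l hl hsl.symm
    have h2 := hDl l hl s hs hsl
    rw [dist_comm] at h1
    rw [← add_div, div_le_iff₀ (by positivity)]
    linarith
  have hsub : (⋃ s ∈ N, ball (f s) (sSup (A s) / (2 * C'))) ⊆ cthickening ω (f '' K₁) := by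
    refine iUnion₂_subset fun s hs x hx => ?_
    refine mem_cthickening_of_dist_le x (f s) ω _ (mem_image_of_mem f (hNK hs)) ?_
    have h1 : sSup (A s) / (2 * C') ≤ ω := by
      rw [div_le_iff₀ (by positivity)]
      nlinarith [hDω s hs]
    exact (mem_ball.1 hx).le.trans h1
  have hmeas : volume.real (⋃ s ∈ N, ball (f s) (sSup (A s) / (2 * C'))) ≤ κ' := by
    refine ENNReal.toReal_le_of_le_ofReal hκ'0.le ((measure_mono hsub).trans hω.le)
  rw [measureReal_biUnion_finset hdisj (fun _ _ => measurableSet_ball)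
    (fun _ _ => by simp [Complex.volume_ball, ENNReal.mul_eq_top]),
    Finset.sum_congr rfl fun s hs => volumeReal_ball (f s) (div_nonneg (h0 s hs) (by positivity)),
    ← Finset.mul_sum] at hmeas
  simp_rw [div_pow] at hmeas
  rw [← Finset.sum_div, hκ', mul_pow] at hmeas
  rw [mul_div_assoc] at hmeas
  have := le_of_mul_le_mul_left hmeas Real.pi_pos
  norm_num at this
  rwa [div_le_div_iff_of_pos_right (by positivity)] at this

/-- A separated set close to large disjoint circles has few points. -/
theorem card_near_circles_le {I : Type*} {Ω : Set ℂ} (hb : Bornology.IsBounded Ω) {c : I → ℂ}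
    {r : I → ℝ} {J : Finset I} (hsub : ∀ k ∈ J, ball (c k) (r k) ⊆ Ω)
    (hdisj : (J : Set I).PairwiseDisjoint fun k => ball (c k) (r k)) {ε M : ℝ} (hε : 0 < ε)
    (hM : 2 ≤ M) (hr : ∀ k ∈ J, M * ε ≤ r k) {N : Finset ℂ}
    (hsep : ∀ x ∈ N, ∀ y ∈ N, x ≠ y → ε < dist x y)
    (hN : ∀ s ∈ N, ∃ k ∈ J, ∃ z ∈ sphere (c k) (r k), dist z s ≤ ε) :
    Real.pi * (N.card * ε ^ 2) ≤ 32 * volume.real Ω / M := by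
  have hr2 : ∀ k ∈ J, 2 * ε ≤ r k := fun k hk => by nlinarith [hr k hk]
  have hNd : (N : Set ℂ).PairwiseDisjoint fun s => ball s (ε / 2) := by
    intro s hs l hl hsl
    refine ball_disjoint_ball ?_
    have := hsep s hs l hl hsl
    linarith
  have hcover : (⋃ s ∈ N, ball s (ε / 2)) ⊆
      ⋃ k ∈ J, closedBall (c k) (r k + 2 * ε) \ ball (c k) (r k - 2 * ε) := by
    refine iUnion₂_subset fun s hs x hx => ?_
    obtain ⟨k, hk, z, hz, hzs⟩ := hN s hs
    refine mem_iUnion₂.2 ⟨k, hk, ?_⟩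
    rw [mem_ball] at hx
    rw [mem_sphere] at hz
    have h1 := dist_triangle x s z
    have h2 := dist_triangle x z (c k)
    have h3 := dist_triangle z x (c k)
    rw [dist_comm s z] at h1
    rw [dist_comm z x] at h3
    simp only [Set.mem_sdiff, mem_closedBall, mem_ball, not_lt]
    constructor <;> linarith
  have hann : ∀ k ∈ J, volume.real (closedBall (c k) (r k + 2 * ε) \ ball (c k) (r k - 2 * ε)) ≤
      8 / M * volume.real (ball (c k) (r k)) := by
    intro k hk
    have h2 := hr2 k hk
    rw [measureReal_sdiff (ball_subset_closedBall.trans (closedBall_subset_closedBall (by linarith)))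
      measurableSet_ball isBounded_closedBall.measure_lt_top.ne, volumeReal_closedBall _ (by linarith), volumeReal_ball _ (by linarith),
      volumeReal_ball _ (by linarith)]
    rw [div_mul_eq_mul_div, le_div_iff₀ (by linarith)]
    have : Real.pi * r k * (M * ε) ≤ Real.pi * r k * r k :=
      mul_le_mul_of_nonneg_left (hr k hk) (mul_nonneg Real.pi_pos.le (by linarith))
    nlinarith
  have hfinΩ : volume Ω ≠ ⊤ := hb.measure_lt_top.ne
  have hsum : ∑ k ∈ J, volume.real (ball (c k) (r k)) ≤ volume.real Ω := by
    rw [← measureReal_biUnion_finset hdisj (fun _ _ => measurableSet_ball)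
      (fun _ _ => isBounded_ball.measure_lt_top.ne)]
    exact measureReal_mono (iUnion₂_subset hsub) hfinΩ
  have h1 : volume.real (⋃ s ∈ N, ball s (ε / 2)) = Real.pi * (N.card * ε ^ 2) / 4 := by
    rw [measureReal_biUnion_finset hNd (fun _ _ => measurableSet_ball)
      (fun _ _ => isBounded_ball.measure_lt_top.ne),
      Finset.sum_congr rfl fun s hs => volumeReal_ball s (by positivity)]
    rw [Finset.sum_const, nsmul_eq_mul]
    ring
  have h2 : volume.real (⋃ s ∈ N, ball s (ε / 2)) ≤
      ∑ k ∈ J, volume.real (closedBall (c k) (r k + 2 * ε) \ ball (c k) (r k - 2 * ε)) := by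
    refine (measureReal_mono hcover ?_).trans (measureReal_biUnion_finset_le _ _)
    exact (((Bornology.isBounded_biUnion J.finite_toSet).2 fun _ _ =>
      isBounded_closedBall.subset sdiff_subset).measure_lt_top).ne
  have h3 := (h2.trans (Finset.sum_le_sum hann)).trans_eq (Finset.mul_sum _ _ _).symm
  have h4 : 8 / M * ∑ k ∈ J, volume.real (ball (c k) (r k)) ≤ 8 / M * volume.real Ω :=
    mul_le_mul_of_nonneg_left hsum (by positivity)
  rw [h1] at h3
  have : 32 * volume.real Ω / M = 4 * (8 / M * volume.real Ω) := by ring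
  linarith

lemma lintegral_le_of_net {R : Set ℂ} {N : Finset ℂ} {ρ : ℝ} (hρ : 0 ≤ ρ)
    (hR : ∀ z ∈ R, ∃ s ∈ N, dist z s ≤ ρ) {q : ℂ → ℝ} {m : ℂ → ℝ} (hm : ∀ s ∈ N, 0 ≤ m s)
    (hRm : MeasurableSet R)
    (hq : ∀ s ∈ N, ∀ z ∈ R, dist z s ≤ ρ → q z ≤ m s) :
    ∫⁻ z in R, ENNReal.ofReal (q z) ≤ ENNReal.ofReal (Real.pi * ρ ^ 2 * ∑ s ∈ N, m s) := by
  have hcov : R ⊆ ⋃ s : N, (R ∩ closedBall (s : ℂ) ρ) := by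
    intro z hz
    obtain ⟨s, hs, hzs⟩ := hR z hz
    exact mem_iUnion.2 ⟨⟨s, hs⟩, hz, hzs⟩
  calc ∫⁻ z in R, ENNReal.ofReal (q z)
      ≤ ∫⁻ z in ⋃ s : N, (R ∩ closedBall (s : ℂ) ρ), ENNReal.ofReal (q z) :=
        lintegral_mono_set hcov
    _ ≤ ∑' s : N, ∫⁻ z in R ∩ closedBall (s : ℂ) ρ, ENNReal.ofReal (q z) := lintegral_iUnion_le _ _
    _ ≤ ∑' s : N, ENNReal.ofReal (Real.pi * ρ ^ 2 * m s) := by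
        refine ENNReal.tsum_le_tsum fun s => ?_
        calc ∫⁻ z in R ∩ closedBall (s : ℂ) ρ, ENNReal.ofReal (q z)
            ≤ ∫⁻ z in R ∩ closedBall (s : ℂ) ρ, ENNReal.ofReal (m s) := by
              refine setLIntegral_mono' (hRm.inter measurableSet_closedBall) fun z hz => ?_
              exact ENNReal.ofReal_le_ofReal (hq s s.2 z hz.1 hz.2)
          _ = ENNReal.ofReal (m s) * volume (R ∩ closedBall (s : ℂ) ρ) := by
              rw [setLIntegral_const]
          _ ≤ ENNReal.ofReal (m s) * volume (closedBall (s : ℂ) ρ) := by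
              gcongr; exact inter_subset_right
          _ = ENNReal.ofReal (Real.pi * ρ ^ 2 * m s) := by
              rw [← ENNReal.ofReal_toReal (isBounded_closedBall.measure_lt_top (μ := volume)
                (s := closedBall (s : ℂ) ρ)).ne, ← ENNReal.ofReal_mul (hm s s.2)]
              congr 1
              have := volumeReal_closedBall (s : ℂ) hρ
              rw [Measure.real] at this
              rw [this]; ring
    _ = ENNReal.ofReal (Real.pi * ρ ^ 2 * ∑ s ∈ N, m s) := by
        rw [tsum_fintype, Finset.mul_sum, ENNReal.ofReal_sum_of_nonneg
          fun s hs => mul_nonneg (by positivity) (hm s hs)]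
        exact Finset.sum_coe_sort N fun s => ENNReal.ofReal (Real.pi * ρ ^ 2 * m s)

lemma volume_biUnion_closedBall_le {N : Finset ℂ} (G : ℂ → ℂ) {D : ℂ → ℝ} (hD : ∀ s ∈ N, 0 ≤ D s)
    {t : ℝ} (ht : 0 ≤ t) :
    volume (⋃ s ∈ N, closedBall (G s) (5 * D s + t)) ≤
      ENNReal.ofReal (50 * Real.pi * ∑ s ∈ N, D s ^ 2 + 2 * t ^ 2 * (Real.pi * N.card)) := by
  have hb : Bornology.IsBounded (⋃ s ∈ N, closedBall (G s) (5 * D s + t)) :=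
    (Bornology.isBounded_biUnion N.finite_toSet).2 fun _ _ => isBounded_closedBall
  rw [← ENNReal.ofReal_toReal hb.measure_lt_top.ne]
  refine ENNReal.ofReal_le_ofReal ?_
  refine (measureReal_biUnion_finset_le N _).trans ?_
  rw [Finset.sum_congr rfl fun s hs => volumeReal_closedBall (G s)
    (by have := hD s hs; positivity : 0 ≤ 5 * D s + t)]
  have : ∀ s ∈ N, Real.pi * (5 * D s + t) ^ 2 ≤ 50 * Real.pi * D s ^ 2 + 2 * t ^ 2 * Real.pi := by
    intro s _
    nlinarith [Real.pi_pos, mul_nonneg Real.pi_pos.le (sq_nonneg (5 * D s - t))]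
  refine (Finset.sum_le_sum this).trans_eq ?_
  rw [Finset.sum_add_distrib, ← Finset.mul_sum, Finset.sum_const, nsmul_eq_mul]
  ring

section NestedPair

variable {I : Type*} {Ω Ω' : Set ℂ} {c c' : I → ℂ} {r r' : I → ℝ} {f g : ℂ → ℂ}

/-- The weak form of local quasisymmetry used below. -/
def LocallyWeaklyQuasisymmetricOn (f : ℂ → ℂ) (S : Set ℂ) : Prop :=
  ∀ K ⊆ S, IsCompact K → ∀ C : ℝ, 0 < C → ∃ C' : ℝ, 1 ≤ C' ∧ ∀ s ∈ K, ∀ l ∈ K, ∀ z ∈ K,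
    dist z s ≤ C * dist l s → dist (f z) (f s) ≤ C' * dist (f l) (f s)

theorem IsSchottkyMap.one_le_integral_of_nested (h : IsSchottkyMap Ω Ω' c r c' r' f g)
    (hpos : ∀ i, IsPosOriented f (c i) (r i) (c' i) (r' i)) {a b w : ℂ} (ha : a ≠ 0) {σ ε : ℝ}
    (hσ : 0 < σ) (hε : 0 < ε) (hεσ : ε ≤ σ)
    (hZ : IsCompact {z ∈ Ω | ‖discExtension c r c' f z - (a * z + b)‖ ≤ 2 * σ})
    (hdeg : planeDegree (fun z => discExtension c r c' f z - (a * z + b))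
      {z ∈ Ω | ‖discExtension c r c' f z - (a * z + b)‖ < 2 * σ} = 1)
    {H : ℂ → ℂ} (hH : ContDiff ℝ 2 H) {J : Finset I} {i j : I} (hi : i ∈ J) (hj : j ∈ J)
    (hij : i ≠ j) (hni : ‖c' i - (a * c i + (b + w))‖ < |r' i - ‖a‖ * r i|)
    (hnj : ‖c' j - (a * c j + (b + w))‖ < |r' j - ‖a‖ * r j|)
    (hHZ : ∀ z ∈ Ω, ‖discExtension c r c' f z - (a * z + b)‖ ≤ 2 * σ →
      ‖H z - discExtension c r c' f z‖ ≤ σ / 4)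
    (hHJ : ∀ k ∈ J, ∀ z ∈ ball (c k) (r k), ‖H z - discExtension c r c' f z‖ ≤ σ / 4)
    (hw : ‖w‖ ≤ σ / 2) (hne : ∀ k ∈ J, ¬ (‖a‖ * r k = r' k ∧ a * c k + (b + w) = c' k))
    (hsph : ∀ k ∈ J, ∀ z ∈ sphere (c k) (r k), ∃ D : ℝ, 0 ≤ D ∧
      ‖H z - discExtension c r c' f z‖ ≤ 2 * D ∧
      4 * D + ε < ‖discExtension c r c' f z - (a * z + b) - w‖) :
    1 ≤ ∫ z in {z ∈ Ω | ‖discExtension c r c' f z - (a * z + b)‖ < 2 * σ} \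
        ⋃ k ∈ J, ball (c k) (r k),
      planeBump ((2 / ε : ℝ) * ((H z - (a * z + b)) - w)) *
        ((2 / ε) ^ 2 * ‖fderiv ℝ H z‖ ^ 2) := by
  set F := discExtension c r c' f with hF
  set U : Set ℂ := {z ∈ Ω | ‖F z - (a * z + b)‖ < 2 * σ} with hU
  set s : ℝ := 2 / ε with hs
  have hs0 : 0 < s := by positivity
  have hsσ : 2 ≤ s * σ := by
    rw [hs, div_mul_eq_mul_div, le_div_iff₀ hε]; nlinarith
  have hFc : ContinuousOn F Ω := h.continuousOn_extension
  have hGc : ContinuousOn (fun z => F z - (a * z + b)) Ω := hFc.sub (by fun_prop)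
  have hUo : IsOpen U := by
    have := hGc.norm.isOpen_inter_preimage h.domain.1 (isOpen_Iio (a := 2 * σ))
    exact this
  have hUb : Bornology.IsBounded U := h.bdd.subset fun z hz => hz.1
  have hUf : ∀ z ∈ frontier U, z ∈ Ω ∧ ‖F z - (a * z + b)‖ = 2 * σ := by
    intro z hz
    have h1 : z ∈ {z ∈ Ω | ‖F z - (a * z + b)‖ ≤ 2 * σ} :=
      closure_minimal (show U ⊆ {z ∈ Ω | ‖F z - (a * z + b)‖ ≤ 2 * σ} from
        fun z hz => ⟨hz.1, le_of_lt hz.2⟩) hZ.isClosed hz.1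
    refine ⟨h1.1, le_antisymm h1.2 (not_lt.1 fun hlt => ?_)⟩
    rw [hUo.frontier_eq] at hz
    exact hz.2 ⟨h1.1, hlt⟩
  set H₁ : ℂ → ℂ := fun z => H z - (a * z + b) with hH₁
  have hAff : ContDiff ℝ 2 fun z : ℂ => a * z + b := by fun_prop
  have hH₁c : ContDiff ℝ 2 H₁ := hH.sub hAff
  have hHw : ContDiff ℝ 2 fun z => (s : ℂ) * (H₁ z - w) :=
    contDiff_const.mul (hH₁c.sub contDiff_const)
  have hdiffU : smoothDegree (fun z => s * (H₁ z - w)) U = 1 := by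
    rw [← hdeg]
    refine (planeDegree_eq hUo hUb ⟨hHw.contDiffOn, hHw.continuous.continuousOn, s, hs0, ?_⟩).symm
    intro z hz
    obtain ⟨hzΩ, hzσ⟩ := hUf z hz
    rw [hzσ]
    refine ⟨by nlinarith, ?_⟩
    rw [← mul_sub, norm_mul, Complex.norm_real, Real.norm_of_nonneg hs0.le, mul_div_assoc]
    refine mul_lt_mul_of_pos_left ?_ hs0
    have e : H₁ z - w - (F z - (a * z + b)) = (H z - F z) - w := by rw [hH₁]; ring
    rw [e]
    have h2 := hHZ z hzΩ hzσ.le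
    have h3 := norm_sub_le (H z - F z) w
    linarith
  have hdegk : ∀ k ∈ J, planeDegree (fun z => F z - (a * z + (b + w))) (ball (c k) (r k)) =
      smoothDegree (fun z => s * (H₁ z - w)) (ball (c k) (r k)) := by
    intro k hk
    refine planeDegree_eq isOpen_ball isBounded_ball
      ⟨hHw.contDiffOn, hHw.continuous.continuousOn, s, hs0, ?_⟩
    intro z hz
    rw [frontier_ball' (h.family.1 k)] at hz
    obtain ⟨D, hD0, hD1, hD2⟩ := hsph k hk z hz
    have e1 : F z - (a * z + (b + w)) = F z - (a * z + b) - w := by ring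
    beta_reduce
    rw [e1]
    constructor
    · calc (2 : ℝ) = s * ε := by rw [hs]; field_simp
        _ < _ := by
          refine mul_lt_mul_of_pos_left ?_ hs0
          linarith
    · rw [← mul_sub, norm_mul, Complex.norm_real, Real.norm_of_nonneg hs0.le, mul_div_assoc]
      refine mul_lt_mul_of_pos_left ?_ hs0
      have e : H₁ z - w - (F z - (a * z + b) - w) = H z - F z := by rw [hH₁]; ring
      rw [e]
      linarith
  have hFs : ∀ k, ContinuousOn F (sphere (c k) (r k)) := fun k =>
    hFc.mono (sphere_subset_closedBall.trans (h.family.2.1 k))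
  have hFm : ∀ k, MapsTo F (sphere (c k) (r k)) (sphere (c' k) (r' k)) := by
    intro k z hz
    have hzS := h.family.sphere_subset k hz
    rw [hF, h.extension_of_mem hzS]
    exact h.circle k hz
  refine one_le_integral_of_degree hUb hH₁c hdiffU ?_ ?_ ?_ hi hj hij ?_ ?_ (q := fun z =>
    ‖fderiv ℝ H z‖ ^ 2) ?_ ?_
  · intro k _ l _ hkl
    exact (h.family.2.2 hkl).mono ball_subset_closedBall ball_subset_closedBall
  · intro k hk z hz hzU
    apply planeBump_eq_zero
    rw [norm_mul, Complex.norm_real, Real.norm_of_nonneg hs0.le]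
    have hzΩ : z ∈ Ω := h.family.2.1 k (ball_subset_closedBall hz)
    have hzσ : 2 * σ ≤ ‖F z - (a * z + b)‖ := not_lt.1 fun hlt => hzU ⟨hzΩ, hlt⟩
    have h2 := hHJ k hk z hz
    have e : F z - (a * z + b) = (H₁ z - w) + (w - (H z - F z)) := by rw [hH₁]; ring
    rw [e] at hzσ
    have h3 := norm_add_le (H₁ z - w) (w - (H z - F z))
    have h4 := norm_sub_le w (H z - F z)
    have h5 : σ ≤ ‖H₁ z - w‖ := by linarith
    nlinarith
  · intro k hk
    rw [← hdegk k hk]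
    refine planeDegree_sub_affine_nonneg (h.family.1 k) (h.family'.1 k)
      (h.posOriented_extension (hpos k)) ha (hne k hk) fun z hz heq => ?_
    obtain ⟨D, hD0, hD1, hD2⟩ := hsph k hk z hz
    have e : F z - (a * z + b) - w = 0 := by
      change F z = _ at heq
      rw [heq]; ring
    rw [e, norm_zero] at hD2
    linarith
  · rw [← hdegk i hi]
    exact planeDegree_sub_affine_of_nested (h.family.1 i) (h.family'.1 i)
      (h.posOriented_extension (hpos i)) (hFs i) (hFm i) ha hni
  · rw [← hdegk j hj]
    exact planeDegree_sub_affine_of_nested (h.family.1 j) (h.family'.1 j)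
      (h.posOriented_extension (hpos j)) (hFs j) (hFm j) ha hnj
  · exact (hH.continuous_fderiv (by norm_num)).norm.pow 2
  · intro z
    exact neg_sq_le_jac_sub_affine (hH.differentiable (by norm_num)) a b z


lemma isCompact_residual_inter {K : Set ℂ} (hK : K ⊆ Ω) (hKc : IsCompact K) :
    IsCompact (discResidual Ω c r ∩ K) := by
  have : discResidual Ω c r ∩ K = K \ ⋃ i, ball (c i) (r i) := by
    ext z
    exact ⟨fun hz => ⟨hz.2, hz.1.2⟩, fun hz => ⟨⟨hK hz.1, hz.2⟩, hz.1⟩⟩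
  rw [this]
  exact hKc.diff (isOpen_iUnion fun _ => isOpen_ball)

set_option maxHeartbeats 1600000 in
/-- The area estimate at a single scale. -/
theorem IsSchottkyMap.area_bound_of_nested (h : IsSchottkyMap Ω Ω' c r c' r' f g)
    (hpos : ∀ i, IsPosOriented f (c i) (r i) (c' i) (r' i)) {a b : ℂ} (ha : a ≠ 0) {σ ε ρ : ℝ}
    (hσ : 0 < σ) (hε : 0 < ε) (hεσ : ε ≤ σ) (hρσ : ρ ≤ σ / 2) (hρ : 0 < ρ)
    (hZ : IsCompact {z ∈ Ω | ‖discExtension c r c' f z - (a * z + b)‖ ≤ 2 * σ})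
    (hdeg : planeDegree (fun z => discExtension c r c' f z - (a * z + b))
      {z ∈ Ω | ‖discExtension c r c' f z - (a * z + b)‖ < 2 * σ} = 1)
    {i j : I} (hij : i ≠ j) (hni : ‖c' i - (a * c i + b)‖ + ρ < |r' i - ‖a‖ * r i|)
    (hnj : ‖c' j - (a * c j + b)‖ + ρ < |r' j - ‖a‖ * r j|) {K₀ : Set ℂ} {δ M C₀ : ℝ}
    (hK₀Z : {z ∈ Ω | ‖discExtension c r c' f z - (a * z + b)‖ ≤ 2 * σ} ⊆ K₀)
    (hiK : closedBall (c i) (r i) ⊆ K₀) (hjK : closedBall (c j) (r j) ⊆ K₀)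
    (hδ : cthickening δ (saturation c r K₀) ⊆ Ω) (hM : 2 ≤ M) (hMδ : (10 * M + 20) * ε ≤ δ)
    (hMi : M * ε ≤ r i) (hMj : M * ε ≤ r j) {H : ℂ → ℂ} (hH : ContDiff ℝ 2 H)
    (hHF : ∀ (z w : ℂ) (D : ℝ), ball z (2 * ε) ⊆ cthickening δ (saturation c r K₀) →
      (∀ y ∈ ball z (2 * ε), ‖discExtension c r c' f y - w‖ ≤ D) →
        ‖H z - w‖ ≤ D ∧ ‖fderiv ℝ H z‖ ≤ C₀ * D / ε)
    (hosc : ∀ z ∈ saturation c r K₀, ∀ y ∈ ball z (2 * ε),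
      ‖discExtension c r c' f y - discExtension c r c' f z‖ ≤ σ / 4)
    {N : Finset ℂ} {D : ℂ → ℝ} (hNK : ↑N ⊆ discResidual Ω c r ∩ saturation c r K₀)
    (hsep : ∀ x ∈ N, ∀ y ∈ N, x ≠ y → ε < dist x y)
    (hcov : ∀ z ∈ discResidual Ω c r ∩ saturation c r K₀, ∃ s ∈ N, dist z s ≤ ε)
    (hD0 : ∀ s ∈ N, 0 ≤ D s)
    (hD : ∀ s ∈ N, ∀ z ∈ discResidual Ω c r ∩ cthickening δ (saturation c r K₀),
      dist z s < (10 * M + 20) * ε → dist (f z) (f s) ≤ D s) :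
    Real.pi * ρ ^ 2 ≤ (Real.pi * C₀ ^ 2 * (2 * M + 1) ^ 2 + 50 * Real.pi) * ∑ s ∈ N, D s ^ 2 +
      64 * (‖a‖ + 1) ^ 2 * volume.real Ω / M := by
  classical
  set F := discExtension c r c' f with hF
  set K₁ := saturation c r K₀ with hK₁
  have hK₁₂ : K₁ ⊆ cthickening δ K₁ := self_subset_cthickening _
  have hnear : ∀ s ∈ K₁, ∀ y, dist y s < (10 * M + 20) * ε → y ∈ cthickening δ K₁ :=
    fun s hs y hy => mem_cthickening_of_dist_le y s δ _ hs (hy.le.trans hMδ)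
  have hFs : ∀ s ∈ N, ∀ y ∈ ball s ((2 * M + 4) * ε), ‖F y - f s‖ ≤ D s := by
    intro s hs y hy
    rw [← dist_eq_norm]
    refine h.dist_extension_le (R := (2 * M + 4) * ε) (hNK hs).1 ?_ ?_ hy
    · intro z hz hzs
      have hzs' : dist z s < (10 * M + 20) * ε := by linarith
      exact hD s hs z ⟨hz, hnear s (hNK hs).2 z hzs'⟩ hzs'
    · refine hδ (hnear s (hNK hs).2 y ?_)
      rw [mem_ball] at hy
      nlinarith
  have hHs : ∀ s ∈ N, ∀ z, dist z s ≤ (2 * M + 1) * ε →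
      ‖H z - f s‖ ≤ D s ∧ ‖fderiv ℝ H z‖ ≤ C₀ * D s / ε := by
    intro s hs z hzs
    have hball : ball z (2 * ε) ⊆ ball s ((2 * M + 4) * ε) :=
      ball_subset_ball' (by nlinarith)
    refine hHF z (f s) (D s) ?_ fun y hy => hFs s hs y (hball hy)
    intro y hy
    have := mem_ball.1 (hball hy)
    exact hnear s (hNK hs).2 y (by nlinarith)
  have hHK₁ : ∀ z ∈ K₁, ‖H z - F z‖ ≤ σ / 4 := by
    intro z hz
    refine (hHF z (F z) (σ / 4) ?_ (hosc z hz)).1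
    intro y hy
    exact hnear z hz y (by have := mem_ball.1 hy; nlinarith)
  have hJf : {k | M * ε ≤ r k ∧ (closedBall (c k) (r k) ∩ K₀).Nonempty}.Finite :=
    (h.family.finite_le_radius h.bdd (by positivity : 0 < M * ε)).subset fun k hk => hk.1
  set J : Finset I := hJf.toFinset with hJ
  have hJm : ∀ k, k ∈ J ↔ M * ε ≤ r k ∧ (closedBall (c k) (r k) ∩ K₀).Nonempty := fun k =>
    hJf.mem_toFinset
  have hJK : ∀ k ∈ J, closedBall (c k) (r k) ⊆ K₁ := by
    intro k hk
    obtain ⟨z, hz1, hz2⟩ := ((hJm k).1 hk).2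
    exact closedBall_subset_saturation hz1 hz2
  have hiJ : i ∈ J := (hJm i).2 ⟨hMi, c i, mem_closedBall_self (h.family.1 i).le,
    hiK (mem_closedBall_self (h.family.1 i).le)⟩
  have hjJ : j ∈ J := (hJm j).2 ⟨hMj, c j, mem_closedBall_self (h.family.1 j).le,
    hjK (mem_closedBall_self (h.family.1 j).le)⟩
  set U : Set ℂ := {z ∈ Ω | ‖F z - (a * z + b)‖ < 2 * σ} with hU
  set R : Set ℂ := U \ ⋃ k ∈ J, ball (c k) (r k) with hR
  have hUo : IsOpen U := by
    have hGc : ContinuousOn (fun z => F z - (a * z + b)) Ω :=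
      h.continuousOn_extension.sub (by fun_prop)
    have := hGc.norm.isOpen_inter_preimage h.domain.1 (isOpen_Iio (a := 2 * σ))
    exact this
  have hRm : MeasurableSet R :=
    hUo.measurableSet.diff (J.measurableSet_biUnion fun _ _ => measurableSet_ball)
  have hRb : Bornology.IsBounded R := h.bdd.subset fun z hz => hz.1.1
  have hRN : ∀ z ∈ R, ∃ s ∈ N, dist z s ≤ (2 * M + 1) * ε := by
    intro z hz
    have hzK : z ∈ K₀ := hK₀Z ⟨hz.1.1, le_of_lt hz.1.2⟩
    rcases mem_residual_or_mem_ball (c := c) (r := r) hz.1.1 with hzS | ⟨k, hk⟩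
    · obtain ⟨s, hs, hzs⟩ := hcov z ⟨hzS, Or.inl hzK⟩
      exact ⟨s, hs, by nlinarith⟩
    · have hkJ : k ∉ J := fun hkJ => hz.2 (mem_iUnion₂.2 ⟨k, hkJ, hk⟩)
      have hrk : r k < M * ε := by
        by_contra! hle
        exact hkJ ((hJm k).2 ⟨hle, z, ball_subset_closedBall hk, hzK⟩)
      obtain ⟨y, hy, hzy⟩ := exists_mem_sphere_dist_le (h.family.1 k) (ball_subset_closedBall hk)
      obtain ⟨s, hs, hys⟩ := hcov y ⟨h.family.sphere_subset k hy,
        closedBall_subset_saturation (ball_subset_closedBall hk) hzK (sphere_subset_closedBall hy)⟩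
      exact ⟨s, hs, (dist_triangle z y s).trans (by linarith)⟩
  have hInt : ∫⁻ z in R, ENNReal.ofReal (‖fderiv ℝ H z‖ ^ 2) ≤
      ENNReal.ofReal (Real.pi * ((2 * M + 1) * ε) ^ 2 * ∑ s ∈ N, (C₀ * D s / ε) ^ 2) := by
    refine lintegral_le_of_net (by positivity) hRN (fun s _ => sq_nonneg _) hRm ?_
    intro s hs z _ hzs
    exact pow_le_pow_left₀ (norm_nonneg _) (hHs s hs z hzs).2 2
  have hIntEq : Real.pi * ((2 * M + 1) * ε) ^ 2 * ∑ s ∈ N, (C₀ * D s / ε) ^ 2 =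
      Real.pi * C₀ ^ 2 * (2 * M + 1) ^ 2 * ∑ s ∈ N, D s ^ 2 := by
    have : ∀ s ∈ N, (C₀ * D s / ε) ^ 2 = C₀ ^ 2 / ε ^ 2 * D s ^ 2 := fun s _ => by ring
    rw [Finset.sum_congr rfl this, ← Finset.mul_sum]
    field_simp
  rw [hIntEq] at hInt
  set N' : Finset ℂ := N.filter fun s => ∃ k ∈ J, ∃ z ∈ sphere (c k) (r k), dist z s ≤ ε with hN'
  have hN'N : N' ⊆ N := Finset.filter_subset _ _
  set t : ℝ := (‖a‖ + 1) * ε with ht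
  set G : ℂ → ℂ := fun z => F z - (a * z + b) with hG
  set B : Set ℂ := ⋃ s ∈ N', closedBall (G s) (5 * D s + t) with hB
  set Q : Set ℂ := ((J.image fun k => c' k - a * c k - b : Finset ℂ) : Set ℂ) with hQ
  have hmain : ∀ w ∈ ball (0 : ℂ) ρ \ (B ∪ Q), 1 ≤ ∫ z in R,
      planeBump ((2 / ε : ℝ) * ((H z - (a * z + b)) - w)) *
        ((2 / ε) ^ 2 * ‖fderiv ℝ H z‖ ^ 2) := by
    rintro w ⟨hwρ, hwBQ⟩
    rw [mem_ball_zero_iff] at hwρ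
    have hwB : w ∉ B := fun hw => hwBQ (Or.inl hw)
    have hwQ : w ∉ Q := fun hw => hwBQ (Or.inr hw)
    have hnest : ∀ k, ‖c' k - (a * c k + b)‖ + ρ < |r' k - ‖a‖ * r k| →
        ‖c' k - (a * c k + (b + w))‖ < |r' k - ‖a‖ * r k| := by
      intro k hk
      have e : c' k - (a * c k + (b + w)) = c' k - (a * c k + b) - w := by ring
      rw [e]
      have := norm_sub_le (c' k - (a * c k + b)) w
      linarith
    refine h.one_le_integral_of_nested hpos ha hσ hε hεσ hZ hdeg hH hiJ hjJ hij (hnest i hni)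
      (hnest j hnj) (fun z hz hzσ => hHK₁ z (Or.inl (hK₀Z ⟨hz, hzσ⟩)))
      (fun k hk z hz => hHK₁ z (hJK k hk (ball_subset_closedBall hz))) (by linarith) ?_ ?_
    · rintro k hk ⟨-, hk2⟩
      refine hwQ (Finset.mem_coe.2 (Finset.mem_image.2 ⟨k, hk, ?_⟩))
      rw [← hk2]; ring
    · intro k hk z hz
      have hzS := h.family.sphere_subset k hz
      have hzK := hJK k hk (sphere_subset_closedBall hz)
      obtain ⟨s, hs, hzs⟩ := hcov z ⟨hzS, hzK⟩
      have hsN' : s ∈ N' := Finset.mem_filter.2 ⟨hs, k, hk, z, hz, hzs⟩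
      have hws : w ∉ closedBall (G s) (5 * D s + t) := fun hw => hwB (mem_iUnion₂.2 ⟨s, hsN', hw⟩)
      rw [mem_closedBall, not_le, dist_eq_norm] at hws
      have hFz : F z = f z := h.extension_of_mem hzS
      have hFs' : F s = f s := h.extension_of_mem (hNK hs).1
      have hzs2 : dist (f z) (f s) ≤ D s :=
        hD s hs z ⟨hzS, hK₁₂ hzK⟩ (by nlinarith)
      rw [dist_eq_norm] at hzs2
      refine ⟨D s, hD0 s hs, ?_, ?_⟩
      · have h1 := (hHs s hs z (by nlinarith)).1
        have e : H z - F z = (H z - f s) - (f z - f s) := by rw [hFz]; ring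
        rw [e]
        exact (norm_sub_le _ _).trans (by linarith)
      · have e : w - G s = (f z - f s) - a * (z - s) - (F z - (a * z + b) - w) := by
          rw [hG]; simp only; rw [hFz, hFs']; ring
        rw [e] at hws
        have h1 := norm_sub_le ((f z - f s) - a * (z - s)) (F z - (a * z + b) - w)
        have h2 := norm_sub_le (f z - f s) (a * (z - s))
        rw [norm_mul, ← dist_eq_norm z s] at h2
        have h3 : ‖a‖ * dist z s ≤ ‖a‖ * ε := mul_le_mul_of_nonneg_left hzs (norm_nonneg _)
        have h4 : t = ‖a‖ * ε + ε := by rw [ht]; ring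
        linarith
  have hH₁c : Continuous fun z => H z - (a * z + b) := hH.continuous.sub (by fun_prop)
  have hvol := volume_le_of_one_le_integral hRb hH₁c (by positivity : 0 < 2 / ε)
    ((hH.continuous_fderiv (by norm_num)).norm.pow 2) (fun z => sq_nonneg _) hmain
  have hcard : Real.pi * (N'.card * ε ^ 2) ≤ 32 * volume.real Ω / M := by
    refine card_near_circles_le h.bdd (fun k _ => ball_subset_closedBall.trans (h.family.2.1 k))
      (fun k _ l _ hkl => (h.family.2.2 hkl).mono ball_subset_closedBall ball_subset_closedBall)
      hε hM (fun k hk => ((hJm k).1 hk).1)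
      (fun x hx y hy => hsep x (hN'N hx) y (hN'N hy)) fun s hs => (Finset.mem_filter.1 hs).2
  have hBv : volume B ≤ ENNReal.ofReal
      (50 * Real.pi * ∑ s ∈ N, D s ^ 2 + 64 * (‖a‖ + 1) ^ 2 * volume.real Ω / M) := by
    refine (volume_biUnion_closedBall_le G (fun s hs => hD0 s (hN'N hs))
      (by positivity : 0 ≤ t)).trans (ENNReal.ofReal_le_ofReal ?_)
    have h1 : ∑ s ∈ N', D s ^ 2 ≤ ∑ s ∈ N, D s ^ 2 :=
      Finset.sum_le_sum_of_subset_of_nonneg hN'N fun _ _ _ => sq_nonneg _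
    have h2 : 2 * t ^ 2 * (Real.pi * N'.card) =
        2 * (‖a‖ + 1) ^ 2 * (Real.pi * (N'.card * ε ^ 2)) := by rw [ht]; ring
    have h3 : 64 * (‖a‖ + 1) ^ 2 * volume.real Ω / M =
        2 * (‖a‖ + 1) ^ 2 * (32 * volume.real Ω / M) := by ring
    rw [h2, h3]
    have := Real.pi_pos
    gcongr
  have hQv : volume Q = 0 := (Finset.finite_toSet _).measure_zero _
  have htot : volume (ball (0 : ℂ) ρ) ≤ ENNReal.ofReal
      (Real.pi * C₀ ^ 2 * (2 * M + 1) ^ 2 * ∑ s ∈ N, D s ^ 2) + ENNReal.ofReal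
      (50 * Real.pi * ∑ s ∈ N, D s ^ 2 + 64 * (‖a‖ + 1) ^ 2 * volume.real Ω / M) := by
    calc volume (ball (0 : ℂ) ρ) ≤ volume ((ball (0 : ℂ) ρ \ (B ∪ Q)) ∪ (B ∪ Q)) :=
          measure_mono (by intro x hx; by_cases hx' : x ∈ B ∪ Q <;> simp_all)
      _ ≤ volume (ball (0 : ℂ) ρ \ (B ∪ Q)) + (volume B + volume Q) :=
          (measure_union_le _ _).trans (by gcongr; exact measure_union_le _ _)
      _ ≤ _ := by
          rw [hQv, add_zero]
          exact add_le_add (hvol.trans hInt) hBv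
  have hsum0 : 0 ≤ ∑ s ∈ N, D s ^ 2 := Finset.sum_nonneg fun _ _ => sq_nonneg _
  have hV0 : 0 ≤ volume.real Ω := measureReal_nonneg
  rw [← ENNReal.ofReal_add (by positivity) (by positivity)] at htot
  have := ENNReal.toReal_le_of_le_ofReal (by positivity) htot
  have h5 := volumeReal_ball 0 hρ.le
  rw [Measure.real] at h5
  rw [h5] at this
  linarith

end NestedPair

section NestedPairContradiction

variable {I : Type*} {Ω Ω' : Set ℂ} {c c' : I → ℂ} {r r' : I → ℝ} {f g : ℂ → ℂ}

/-- No affine map of local degree one can be strictly nested with respect to two discs. -/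
theorem IsSchottkyMap.not_nested_pair (h : IsSchottkyMap Ω Ω' c r c' r' f g)
    (hpos : ∀ i, IsPosOriented f (c i) (r i) (c' i) (r' i))
    (hT : volume (discResidual Ω' c' r') = 0)
    (hW : LocallyWeaklyQuasisymmetricOn f (discResidual Ω c r)) {a b : ℂ} (ha : a ≠ 0) {σ : ℝ}
    (hσ : 0 < σ)
    (hZ : IsCompact {z ∈ Ω | ‖discExtension c r c' f z - (a * z + b)‖ ≤ 2 * σ})
    (hdeg : planeDegree (fun z => discExtension c r c' f z - (a * z + b))
      {z ∈ Ω | ‖discExtension c r c' f z - (a * z + b)‖ < 2 * σ} = 1)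
    {i j : I} (hij : i ≠ j) (hni : ‖c' i - (a * c i + b)‖ < |r' i - ‖a‖ * r i|)
    (hnj : ‖c' j - (a * c j + b)‖ < |r' j - ‖a‖ * r j|) : False := by
  set F := discExtension c r c' f with hF
  set K₀ : Set ℂ := {z ∈ Ω | ‖F z - (a * z + b)‖ ≤ 2 * σ} ∪ closedBall (c i) (r i) ∪
    closedBall (c j) (r j) with hK₀
  have hK₀c : IsCompact K₀ := (hZ.union (isCompact_closedBall _ _)).union (isCompact_closedBall _ _)
  have hK₀Ω : K₀ ⊆ Ω := union_subset (union_subset (fun z hz => hz.1) (h.family.2.1 i))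
    (h.family.2.1 j)
  have hK₁c := h.family.isCompact_saturation h.bdd hK₀Ω hK₀c
  have hK₁Ω := h.family.saturation_subset hK₀Ω
  obtain ⟨δ, hδ0, hδ⟩ := hK₁c.exists_cthickening_subset_open h.domain.1 hK₁Ω
  set K₁ := saturation c r K₀ with hK₁
  have hK₂c : IsCompact (cthickening δ K₁) := hK₁c.cthickening
  have hK₁₂ : K₁ ⊆ cthickening δ K₁ := self_subset_cthickening _
  obtain ⟨ρ, hρ, hρσ, hρi, hρj⟩ : ∃ ρ > 0, ρ ≤ σ / 2 ∧
      ‖c' i - (a * c i + b)‖ + ρ < |r' i - ‖a‖ * r i| ∧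
      ‖c' j - (a * c j + b)‖ + ρ < |r' j - ‖a‖ * r j| := by
    obtain ⟨ρ, h1, h2⟩ := exists_between (lt_min (lt_min (half_pos hσ) (sub_pos.2 hni))
      (sub_pos.2 hnj))
    simp only [lt_min_iff] at h2
    exact ⟨ρ, h1, h2.1.1.le, by linarith [h2.1.2], by linarith [h2.2]⟩
  have hpi := Real.pi_pos
  have hA0 : 0 < Real.pi * ρ ^ 2 / 4 := by positivity
  set V := volume.real Ω with hV
  have hV0 : 0 ≤ V := measureReal_nonneg
  obtain ⟨M, hM2, hMV⟩ : ∃ M : ℝ, 2 ≤ M ∧ 64 * (‖a‖ + 1) ^ 2 * V / M ≤ Real.pi * ρ ^ 2 / 4 := by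
    refine ⟨max 2 (64 * (‖a‖ + 1) ^ 2 * V / (Real.pi * ρ ^ 2 / 4)), le_max_left _ _, ?_⟩
    rw [div_le_iff₀ (by positivity), ← div_le_iff₀' hA0]
    exact le_max_right _ _
  obtain ⟨C₀, hC₀, hmol⟩ := exists_mollification
  set Q := Real.pi * C₀ ^ 2 * (2 * M + 1) ^ 2 + 50 * Real.pi with hQ
  have hQ0 : 0 < Q := by positivity
  have hκ : 0 < Real.pi * ρ ^ 2 / 4 / Q := by positivity
  have hC : 0 < 10 * M + 20 := by linarith
  obtain ⟨C', hC', hw⟩ := hW _ inter_subset_left (isCompact_residual_inter hδ hK₂c) _ hC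
  have hK₁S : discResidual Ω c r ∩ K₁ ⊆ discResidual Ω c r ∩ cthickening δ K₁ :=
    inter_subset_inter_right _ hK₁₂
  obtain ⟨ε₀, hε₀, hnet⟩ := exists_controlled_net (isCompact_residual_inter hK₁Ω hK₁c)
    (isCompact_residual_inter hδ hK₂c) hK₁S (h.cont.mono inter_subset_left)
    (measure_mono_null ((image_mono inter_subset_left).trans h.mapsTo.image_subset) hT) hC hC' hw hκ
  have huc := hK₂c.uniformContinuousOn_of_continuous (h.continuousOn_extension.mono hδ)
  rw [Metric.uniformContinuousOn_iff] at huc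
  obtain ⟨δ₁, hδ₁, huc⟩ := huc (σ / 4) (by positivity)
  have hri := h.family.1 i
  have hrj := h.family.1 j
  obtain ⟨ε, hε, hε1⟩ := exists_between (lt_min (lt_min (lt_min hε₀ hσ)
    (lt_min (div_pos hδ0 hC) (half_pos hδ₁))) (lt_min (div_pos hri (by linarith : 0 < M))
      (div_pos hrj (by linarith : 0 < M))))
  simp only [lt_min_iff, lt_div_iff₀ hC, lt_div_iff₀ (by linarith : 0 < M)] at hε1
  obtain ⟨⟨⟨hε1, hε2⟩, hε3, hε4⟩, hε5, hε6⟩ := hε1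
  obtain ⟨N, D, hNK, hsep, hcov, hD0, hD, hsum⟩ := hnet ε hε hε1
  obtain ⟨H, hH, hHF⟩ := hmol F _ hK₂c (h.continuousOn_extension.mono hδ) ε hε
  have hmem : ∀ z ∈ K₁, ∀ y ∈ ball z (2 * ε), y ∈ cthickening δ K₁ := fun z hz y hy =>
    mem_cthickening_of_dist_le y z δ _ hz (by rw [mem_ball] at hy; nlinarith)
  have key := h.area_bound_of_nested hpos ha hσ hε hε2.le hρσ hρ hZ hdeg hij hρi hρj
    (fun z hz => Or.inl (Or.inl hz)) (fun z hz => Or.inl (Or.inr hz)) (fun z hz => Or.inr hz) hδ hM2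
    (by linarith) (by linarith) (by linarith) hH hHF
    (fun z hz y hy => by
      rw [← dist_eq_norm]
      exact (huc y (hmem z hz y hy) z (hK₁₂ hz)
        ((mem_ball.1 hy).trans (by linarith))).le) hNK hsep hcov hD0 hD
  have h1 : Q * ∑ s ∈ N, D s ^ 2 ≤ Real.pi * ρ ^ 2 / 4 := by
    rw [← le_div_iff₀' hQ0]; exact hsum
  linarith

end NestedPairContradiction

namespace IsSchottkyMap

variable {I : Type*} {Ω Ω' : Set ℂ} {c c' : I → ℂ} {r r' : I → ℝ} {f g : ℂ → ℂ}

/-- Discs accumulate at every point of the Schottky set if the target Schottky set is null. -/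
lemma exists_disc_near (h : IsSchottkyMap Ω Ω' c r c' r' f g)
    (hT : volume (discResidual Ω' c' r') = 0) {y : ℂ} (hy : y ∈ discResidual Ω c r) {ε : ℝ}
    (hε : 0 < ε) {J : Set I} (hJ : J.Finite) :
    ∃ j ∉ J, dist (c j) y < ε ∧ dist (c' j) (f y) < ε ∧ r j < ε ∧ r' j < ε := by
  have hfy := h.mapsTo hy
  have hg := h.cont' (f y) hfy
  rw [Metric.continuousWithinAt_iff] at hg
  obtain ⟨δ, hδ, hg⟩ := hg (ε / 2) (half_pos hε)
  set ρ := min (ε / 4) (δ / 8) with hρ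
  have hρ0 : 0 < ρ := lt_min (by positivity) (by positivity)
  have hρε : ρ ≤ ε / 4 := min_le_left _ _
  have hρδ : ρ ≤ δ / 8 := min_le_right _ _
  set J' : Set I := J ∪ {j | ρ ≤ r j} ∪ {j | ρ ≤ r' j} with hJ'
  have hJ'f : J'.Finite := (hJ.union (h.family.finite_le_radius h.bdd hρ0)).union
    (h.family'.finite_le_radius h.bdd' hρ0)
  obtain ⟨u, hu⟩ : ∃ u : ℂ, ∀ j, f y ∈ closedBall (c' j) (r' j) → u = f y - c' j := by
    by_cases hex : ∃ k, f y ∈ closedBall (c' k) (r' k)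
    · obtain ⟨k, hk⟩ := hex
      exact ⟨f y - c' k, fun j hj => by rw [h.family'.eq_of_mem hk hj]⟩
    · exact ⟨0, fun j hj => absurd ⟨j, hj⟩ hex⟩
  have htend : Tendsto (fun t : ℝ => f y + t * u) (𝓝[>] 0) (𝓝 (f y)) := by
    have : Continuous fun t : ℝ => f y + t * u := by fun_prop
    simpa using (this.tendsto 0).mono_left nhdsWithin_le_nhds
  have hev : ∀ᶠ t : ℝ in 𝓝[>] 0, ∀ j ∈ J', f y + t * u ∉ closedBall (c' j) (r' j) := by
    rw [eventually_all_finite hJ'f]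
    intro j _
    by_cases hj : f y ∈ closedBall (c' j) (r' j)
    · filter_upwards [self_mem_nhdsWithin] with t ht hmem
      have ht0 : (0 : ℝ) < t := ht
      have h1 : r' j ≤ ‖f y - c' j‖ := by
        rw [← dist_eq_norm]
        exact not_lt.1 fun hlt => hfy.2 (mem_iUnion.2 ⟨j, hlt⟩)
      have e : f y + t * u - c' j = ((1 + t : ℝ) : ℂ) * (f y - c' j) := by
        rw [hu j hj]; push_cast; ring
      rw [mem_closedBall, dist_eq_norm, e, norm_mul, Complex.norm_of_nonneg (by positivity)] at hmem
      nlinarith [h.family'.1 j]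
    · exact htend.eventually (isClosed_closedBall.isOpen_compl.mem_nhds hj)
  obtain ⟨t, ht, ht1⟩ := (hev.and (htend.eventually
    ((h.domain'.1.inter isOpen_ball).mem_nhds ⟨hfy.1, mem_ball_self hρ0⟩))).exists
  set O : Set ℂ := (Ω' ∩ ball (f y) ρ) \ ⋃ j ∈ J', closedBall (c' j) (r' j) with hO
  have hOo : IsOpen O := (h.domain'.1.inter isOpen_ball).sdiff
    (hJ'f.isClosed_biUnion fun _ _ => isClosed_closedBall)
  have hOne : O.Nonempty := ⟨_, ht1, by simpa using ht⟩
  obtain ⟨w, hwO, hwT⟩ : ∃ w ∈ O, w ∉ discResidual Ω' c' r' := by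
    by_contra! hcon
    exact (hOo.measure_pos volume hOne).ne' (measure_mono_null hcon hT)
  obtain ⟨j, hj⟩ := (mem_residual_or_mem_ball hwO.1.1).resolve_left hwT
  have hjJ : j ∉ J' := fun hjJ => hwO.2 (mem_biUnion hjJ (ball_subset_closedBall hj))
  have hrj : r j < ρ := not_le.1 fun hle => hjJ (Or.inl (Or.inr hle))
  have hrj' : r' j < ρ := not_le.1 fun hle => hjJ (Or.inr hle)
  have hd1 : dist (c' j) (f y) < 2 * ρ := by
    have := dist_triangle (c' j) w (f y)
    have h1 : dist w (c' j) < r' j := hj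
    have h2 : dist w (f y) < ρ := hwO.1.2
    rw [dist_comm] at h1
    linarith
  obtain ⟨q, hq⟩ : (sphere (c' j) (r' j)).Nonempty := NormedSpace.sphere_nonempty.2 (h.family'.1 j).le
  have hqd : dist q (f y) < δ := by
    have := dist_triangle q (c' j) (f y)
    rw [mem_sphere.1 hq] at this
    linarith
  have h3 := hg (h.family'.sphere_subset j hq) hqd
  rw [h.leftInv y hy] at h3
  have h4 : dist (g q) (c j) = r j := h.circle' j hq
  refine ⟨j, fun hjJ' => hjJ (Or.inl (Or.inl hjJ')), ?_, by linarith, by linarith, by linarith⟩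
  have := dist_triangle_left (c j) y (g q)
  linarith

lemma isCompact_and_degree_of_large (h : IsSchottkyMap Ω Ω' c r c' r' f g) {a b : ℂ} (ha : a ≠ 0)
    {i : I} {σ R V : ℝ} (hR : closedBall (c i) R ⊆ Ω) (hV : ∀ w ∈ Ω', ‖w - c' i‖ ≤ V)
    (h1 : V + ‖c' i - (a * c i + b)‖ < 2 * σ)
    (h2 : 2 * σ + V + ‖c' i - (a * c i + b)‖ ≤ ‖a‖ * R) :
    IsCompact {z ∈ Ω | ‖discExtension c r c' f z - (a * z + b)‖ ≤ 2 * σ} ∧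
      planeDegree (fun z => discExtension c r c' f z - (a * z + b))
        {z ∈ Ω | ‖discExtension c r c' f z - (a * z + b)‖ < 2 * σ} = 1 := by
  set F := discExtension c r c' f with hF
  have hGc : ContinuousOn (fun z => F z - (a * z + b)) Ω :=
    h.continuousOn_extension.sub (by fun_prop)
  have ha0 : 0 < ‖a‖ := norm_pos_iff.2 ha
  have hFV : ∀ z ∈ Ω, ‖F z - c' i‖ ≤ V := fun z hz => hV _ (h.extension_mapsTo hz)
  have hZR : {z ∈ Ω | ‖F z - (a * z + b)‖ ≤ 2 * σ} =
      closedBall (c i) R ∩ (fun z => F z - (a * z + b)) ⁻¹' closedBall 0 (2 * σ) := by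
    ext z
    simp only [mem_ofPred_eq, mem_inter_iff, mem_preimage, mem_closedBall, dist_zero_right]
    refine and_congr_left fun hz => ⟨fun hzΩ => ?_, fun hzR => hR hzR⟩
    have e : a * (z - c i) = -(F z - (a * z + b)) + (F z - c' i) + (c' i - (a * c i + b)) := by ring
    have h3 : ‖a * (z - c i)‖ ≤ 2 * σ + V + ‖c' i - (a * c i + b)‖ := by
      rw [e]
      refine (norm_add₃_le).trans ?_
      rw [norm_neg]
      gcongr
      exact hFV z hzΩ
    rw [norm_mul] at h3
    rw [dist_eq_norm]
    exact le_of_mul_le_mul_left (h3.trans h2) ha0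
  have hZc : IsCompact {z ∈ Ω | ‖F z - (a * z + b)‖ ≤ 2 * σ} := by
    rw [hZR]
    exact (isCompact_closedBall _ _).of_isClosed_subset
      ((hGc.mono hR).preimage_isClosed_of_isClosed isClosed_closedBall isClosed_closedBall)
      inter_subset_left
  refine ⟨hZc, ?_⟩
  set U : Set ℂ := {z ∈ Ω | ‖F z - (a * z + b)‖ < 2 * σ} with hU
  have hUo : IsOpen U := hGc.norm.isOpen_inter_preimage h.domain.1 (isOpen_Iio (a := 2 * σ))
  have hUb : Bornology.IsBounded U := h.bdd.subset fun z hz => hz.1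
  have hci : c i ∈ U := by
    refine ⟨h.family.2.1 i (mem_closedBall_self (h.family.1 i).le), ?_⟩
    have hFc : F (c i) = c' i := by
      rw [hF, h.family.discExtension_of_mem_ball (mem_ball_self (h.family.1 i)), coneMap_center]
    rw [hFc]
    have : 0 ≤ V := (norm_nonneg _).trans
      (hV (c' i) (h.family'.2.1 i (mem_closedBall_self (h.family'.1 i).le)))
    linarith
  have hcl : closure U ⊆ {z ∈ Ω | ‖F z - (a * z + b)‖ ≤ 2 * σ} :=
    closure_minimal (fun z hz => ⟨hz.1, le_of_lt hz.2⟩) hZc.isClosed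
  rw [← planeDegree_mul_sub hUo hUb hci (neg_ne_zero.2 ha)]
  refine planeDegree_eq_of_segment hUo hUb
    (hGc.mono fun z hz => (hcl (frontier_subset_closure hz)).1) (by fun_prop) fun z hz t ht h0 => ?_
  have hzΩ := (hcl (frontier_subset_closure hz)).1
  have hz2 : 2 * σ ≤ ‖F z - (a * z + b)‖ := by
    rw [hUo.frontier_eq] at hz
    exact not_lt.1 fun hlt => hz.2 ⟨hzΩ, hlt⟩
  have e1 : F z - (a * z + b) = t * ((F z - c' i) + (c' i - (a * c i + b))) := by
    linear_combination h0
  rw [e1, norm_mul, Complex.norm_of_nonneg ht.1] at hz2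
  have h3 := norm_add_le (F z - c' i) (c' i - (a * c i + b))
  have h4 := hFV z hzΩ
  nlinarith [norm_nonneg ((F z - c' i) + (c' i - (a * c i + b))), ht.2, ht.1]

lemma isCompact_and_degree_of_small (h : IsSchottkyMap Ω Ω' c r c' r' f g)
    (hpos : ∀ i, IsPosOriented f (c i) (r i) (c' i) (r' i)) {a b : ℂ}
    {i : I} {σ m : ℝ} (hR : closedBall (c' i) (2 * σ + m) ⊆ Ω')
    (hm : ∀ z ∈ Ω, ‖a * z + b - c' i‖ ≤ m) (h1 : r' i + m < 2 * σ) :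
    IsCompact {z ∈ Ω | ‖discExtension c r c' f z - (a * z + b)‖ ≤ 2 * σ} ∧
      planeDegree (fun z => discExtension c r c' f z - (a * z + b))
        {z ∈ Ω | ‖discExtension c r c' f z - (a * z + b)‖ < 2 * σ} = 1 := by
  set F := discExtension c r c' f with hF
  have hGc : ContinuousOn (fun z => F z - (a * z + b)) Ω :=
    h.continuousOn_extension.sub (by fun_prop)
  have hPc := h.isCompact_preimage_extension hR (isCompact_closedBall _ _)
  have hZR : {z ∈ Ω | ‖F z - (a * z + b)‖ ≤ 2 * σ} =
      (Ω ∩ F ⁻¹' closedBall (c' i) (2 * σ + m)) ∩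
        (fun z => F z - (a * z + b)) ⁻¹' closedBall 0 (2 * σ) := by
    ext z
    simp only [mem_ofPred_eq, mem_inter_iff, mem_preimage, mem_closedBall, dist_zero_right]
    refine and_congr_left fun hz => ⟨fun hzΩ => ⟨hzΩ, ?_⟩, fun hzR => hzR.1⟩
    have e : F z - c' i = (F z - (a * z + b)) + (a * z + b - c' i) := by ring
    rw [dist_eq_norm, e]
    exact (norm_add_le _ _).trans (add_le_add hz (hm z hzΩ))
  have hZc : IsCompact {z ∈ Ω | ‖F z - (a * z + b)‖ ≤ 2 * σ} := by
    rw [hZR]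
    exact hPc.of_isClosed_subset
      ((hGc.mono inter_subset_left).preimage_isClosed_of_isClosed hPc.isClosed isClosed_closedBall)
      inter_subset_left
  refine ⟨hZc, ?_⟩
  set U : Set ℂ := {z ∈ Ω | ‖F z - (a * z + b)‖ < 2 * σ} with hU
  have hUo : IsOpen U := hGc.norm.isOpen_inter_preimage h.domain.1 (isOpen_Iio (a := 2 * σ))
  have hUb : Bornology.IsBounded U := h.bdd.subset fun z hz => hz.1
  have hcl : closure U ⊆ {z ∈ Ω | ‖F z - (a * z + b)‖ ≤ 2 * σ} :=
    closure_minimal (fun z hz => ⟨hz.1, le_of_lt hz.2⟩) hZc.isClosed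
  have hiU : ball (c i) (r i) ⊆ U := by
    intro z hz
    have hzΩ := h.family.2.1 i (ball_subset_closedBall hz)
    refine ⟨hzΩ, ?_⟩
    have h2 := h.extension_mem_closedBall (ball_subset_closedBall hz)
    rw [mem_closedBall, dist_eq_norm] at h2
    have e : F z - (a * z + b) = (F z - c' i) - (a * z + b - c' i) := by ring
    rw [e]
    have h3 := norm_sub_le (F z - c' i) (a * z + b - c' i)
    have h4 := hm z hzΩ
    linarith
  rw [← h.degree_extension_of_pos (hpos i),
    ← h.degree_extension_excision hUo hUb (hcl.trans fun z hz => hz.1) hiU]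
  have hfr : frontier U ⊆ Ω := fun z hz => (hcl (frontier_subset_closure hz)).1
  refine planeDegree_eq_of_segment hUo hUb (hGc.mono hfr)
    ((h.continuousOn_extension.mono hfr).sub continuousOn_const) fun z hz t ht h0 => ?_
  have hzΩ := hfr hz
  have hz2 : 2 * σ ≤ ‖F z - (a * z + b)‖ := by
    rw [hUo.frontier_eq] at hz
    exact not_lt.1 fun hlt => hz.2 ⟨hzΩ, hlt⟩
  have e1 : F z - (a * z + b) = -(t * (a * z + b - c' i)) := by
    linear_combination h0
  rw [e1, norm_neg, norm_mul, Complex.norm_of_nonneg ht.1] at hz2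
  have h4 := hm z hzΩ
  nlinarith [norm_nonneg (a * z + b - c' i), ht.2, ht.1, h.family'.1 i]

lemma center_ne {c : I → ℂ} {r : I → ℝ} (h : IsSchottkyFamily Ω c r) {i j : I} (hij : i ≠ j) :
    c i ≠ c j := fun e =>
  hij (h.eq_of_mem (mem_closedBall_self (h.1 i).le) (e ▸ mem_closedBall_self (h.1 j).le))

/-- The slope between two centres lies outside `Φ` unless it is the ratio of the radii. -/
lemma norm_slope_mul_radius (h : IsSchottkyMap Ω Ω' c r c' r' f g)
    (hpos : ∀ i, IsPosOriented f (c i) (r i) (c' i) (r' i))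
    (hT : volume (discResidual Ω' c' r') = 0)
    (hW : LocallyWeaklyQuasisymmetricOn f (discResidual Ω c r)) {i j : I} (hij : i ≠ j)
    {Φ : Set ℝ} (hΦ : IsOpen Φ) {e : ℝ} (he : 0 < e)
    (hgood : ∀ a b : ℂ, a ≠ 0 → ‖a‖ ∈ Φ → ‖c' i - (a * c i + b)‖ ≤ e → ∃ σ > 0,
      IsCompact {z ∈ Ω | ‖discExtension c r c' f z - (a * z + b)‖ ≤ 2 * σ} ∧
      planeDegree (fun z => discExtension c r c' f z - (a * z + b))
        {z ∈ Ω | ‖discExtension c r c' f z - (a * z + b)‖ < 2 * σ} = 1)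
    (hα : ‖(c' i - c' j) / (c i - c j)‖ ∈ Φ) :
    ‖(c' i - c' j) / (c i - c j)‖ * r i = r' i := by
  by_contra hne
  set α := (c' i - c' j) / (c i - c j) with hαdef
  have hcij : c i - c j ≠ 0 := sub_ne_zero.2 (center_ne h.family hij)
  have hα0 : α ≠ 0 := div_ne_zero (sub_ne_zero.2 (center_ne h.family' hij)) hcij
  have hαc : α * (c i - c j) = c' i - c' j := div_mul_cancel₀ _ hcij
  have hcont : Continuous fun s : ℝ => (s : ℂ) * α := by fun_prop
  have e1 : ∀ᶠ s : ℝ in 𝓝 1, ‖(s : ℂ) * α‖ ∈ Φ :=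
    hcont.norm.tendsto 1 |>.eventually (hΦ.mem_nhds (by simpa using hα))
  have e2 : ∀ᶠ s : ℝ in 𝓝 1, ‖(c' i - c' j) - s * α * (c i - c j)‖ < e := by
    have : Continuous fun s : ℝ => ‖(c' i - c' j) - s * α * (c i - c j)‖ := by fun_prop
    exact (this.tendsto 1).eventually_lt_const (by simp [hαc, he])
  have e3 : ∀ᶠ s : ℝ in 𝓝 1, ‖(c' i - c' j) - s * α * (c i - c j)‖ <
      |r' i - ‖(s : ℂ) * α‖ * r i| := by
    have h1 : Continuous fun s : ℝ => ‖(c' i - c' j) - s * α * (c i - c j)‖ := by fun_prop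
    have h2 : Continuous fun s : ℝ => |r' i - ‖(s : ℂ) * α‖ * r i| := by fun_prop
    refine (h1.tendsto 1).eventually_lt (h2.tendsto 1) ?_
    simp only [Complex.ofReal_one, one_mul, hαc, sub_self, norm_zero, abs_pos]
    exact sub_ne_zero.2 (Ne.symm hne)
  have e4 : ∀ᶠ s : ℝ in 𝓝[>] 1, ‖(s : ℂ) * α‖ * r j ≠ r' j := by
    have hc2 : Continuous fun s : ℝ => ‖(s : ℂ) * α‖ * r j := by fun_prop
    by_cases hj : ‖α‖ * r j = r' j
    · filter_upwards [self_mem_nhdsWithin] with s hs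
      have hs1 : (1 : ℝ) < s := hs
      have : 0 < r' j := h.family'.1 j
      rw [norm_mul, Complex.norm_of_nonneg (by linarith), mul_assoc, hj]
      nlinarith
    · exact ((hc2.tendsto 1).mono_left nhdsWithin_le_nhds).eventually_ne (by simpa using hj)
  obtain ⟨s, ⟨⟨⟨h1, h2⟩, h3⟩, h4⟩, hs⟩ := (((((e1.and e2).and e3).filter_mono
    nhdsWithin_le_nhds).and e4).and
    (self_mem_nhdsWithin : ∀ᶠ s : ℝ in 𝓝[>] 1, s ∈ Ioi 1)).exists
  have hs1 : (1 : ℝ) < s := hs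
  have ha : (s : ℂ) * α ≠ 0 := mul_ne_zero (by exact_mod_cast (by linarith : s ≠ 0)) hα0
  have ei : c' i - (s * α * c i + (c' j - s * α * c j)) =
      (c' i - c' j) - s * α * (c i - c j) := by ring
  have ej : c' j - (s * α * c j + (c' j - s * α * c j)) = 0 := by ring
  obtain ⟨σ, hσ, hZ, hdeg⟩ := hgood (s * α) (c' j - s * α * c j) ha h1 (by rw [ei]; exact h2.le)
  refine h.not_nested_pair hpos hT hW ha hσ hZ hdeg hij (by rw [ei]; exact h3) ?_
  rw [ej, norm_zero, abs_pos]
  exact sub_ne_zero.2 (Ne.symm h4)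

lemma slope_mem (h : IsSchottkyMap Ω Ω' c r c' r' f g)
    (hT : volume (discResidual Ω' c' r') = 0) {i : I} {Φ : Set ℝ} (hΦ : IsOpen Φ)
    (hs : ∀ j, i ≠ j → ‖(c' i - c' j) / (c i - c j)‖ ∈ Φ →
      ‖(c' i - c' j) / (c i - c j)‖ * r i = r' i) {y : ℂ} (hy : y ∈ discResidual Ω c r)
    (hv : ‖(c' i - f y) / (c i - y)‖ ∈ Φ) : ‖(c' i - f y) / (c i - y)‖ * r i = r' i := by
  by_contra hne
  have hyi : c i - y ≠ 0 := by
    refine sub_ne_zero.2 fun e => hy.2 (mem_iUnion.2 ⟨i, ?_⟩)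
    rw [← e]; exact mem_ball_self (h.family.1 i)
  have hcont : ContinuousAt (fun p : ℂ × ℂ => ‖(c' i - p.2) / (c i - p.1)‖) (y, f y) := by
    refine ContinuousAt.norm (ContinuousAt.div (by fun_prop) (by fun_prop) hyi)
  have hev : ∀ᶠ p : ℂ × ℂ in 𝓝 (y, f y), ‖(c' i - p.2) / (c i - p.1)‖ ∈ Φ ∧
      ‖(c' i - p.2) / (c i - p.1)‖ * r i ≠ r' i :=
    (hcont.eventually (hΦ.mem_nhds hv)).and ((hcont.mul continuousAt_const).eventually_ne hne)
  rw [Metric.eventually_nhds_iff] at hev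
  obtain ⟨ε, hε, hev⟩ := hev
  obtain ⟨j, hj, hj1, hj2, -⟩ := h.exists_disc_near hT hy hε (finite_singleton i)
  have hp := hev (y := (c j, c' j)) (by rw [Prod.dist_eq]; exact max_lt hj1 hj2)
  exact hp.2 (hs j (fun e => hj e.symm) hp.1)

end IsSchottkyMap

namespace IsSchottkyMap

variable {I : Type*} {Ω Ω' : Set ℂ} {c c' : I → ℂ} {r r' : I → ℝ} {f g : ℂ → ℂ}

lemma isPreconnected_residual (h : IsSchottkyMap Ω Ω' c r c' r' f g) :
    IsPreconnected (discResidual Ω c r) :=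
  isPreconnected_sdiff_iUnion_ball h.domain.2.isPreconnected h.family.1 h.family.2.1 h.family.2.2
    fun _ hρ => h.family.finite_le_radius h.bdd hρ

lemma center_sub_ne_zero (h : IsSchottkyMap Ω Ω' c r c' r' f g) (i : I) {y : ℂ}
    (hy : y ∈ discResidual Ω c r) : c i - y ≠ 0 := by
  refine sub_ne_zero.2 fun e => hy.2 (mem_iUnion.2 ⟨i, ?_⟩)
  rw [← e]; exact mem_ball_self (h.family.1 i)

lemma continuousOn_slope (h : IsSchottkyMap Ω Ω' c r c' r' f g) (i : I) :
    ContinuousOn (fun y => ‖(c' i - f y) / (c i - y)‖) (discResidual Ω c r) :=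
  ((continuousOn_const.sub h.cont).div (by fun_prop) fun _ hy => h.center_sub_ne_zero i hy).norm

lemma slope_le (h : IsSchottkyMap Ω Ω' c r c' r' f g) {i : I} {A : ℝ}
    (hv : ∀ y ∈ discResidual Ω c r, ‖(c' i - f y) / (c i - y)‖ ∈ Ioi A →
      ‖(c' i - f y) / (c i - y)‖ * r i = r' i) {y₀ : ℂ} (hy₀ : y₀ ∈ discResidual Ω c r)
    (h₀ : ‖(c' i - f y₀) / (c i - y₀)‖ ≤ A) {y : ℂ} (hy : y ∈ discResidual Ω c r) :
    ‖(c' i - f y) / (c i - y)‖ ≤ A := by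
  by_contra! hlt
  obtain ⟨z, hz, hzv⟩ := h.isPreconnected_residual.intermediate_value hy₀ hy
    (h.continuousOn_slope i) (show (A + ‖(c' i - f y) / (c i - y)‖) / 2 ∈ Icc _ _ from
      ⟨by linarith, by linarith⟩)
  have h1 := hv y hy hlt
  have h2 := hv z hz (show A < _ by simp only at hzv; rw [hzv]; linarith)
  have h3 := mul_right_cancel₀ (h.family.1 i).ne' (h1.trans h2.symm)
  simp only at hzv
  linarith

lemma le_slope (h : IsSchottkyMap Ω Ω' c r c' r' f g) {i : I} {A : ℝ}
    (hv : ∀ y ∈ discResidual Ω c r, ‖(c' i - f y) / (c i - y)‖ ∈ Iio A →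
      ‖(c' i - f y) / (c i - y)‖ * r i = r' i) {y₀ : ℂ} (hy₀ : y₀ ∈ discResidual Ω c r)
    (h₀ : A ≤ ‖(c' i - f y₀) / (c i - y₀)‖) {y : ℂ} (hy : y ∈ discResidual Ω c r) :
    A ≤ ‖(c' i - f y) / (c i - y)‖ := by
  by_contra! hlt
  obtain ⟨z, hz, hzv⟩ := h.isPreconnected_residual.intermediate_value hy hy₀
    (h.continuousOn_slope i) (show (A + ‖(c' i - f y) / (c i - y)‖) / 2 ∈ Icc _ _ from
      ⟨by linarith, by linarith⟩)
  have h1 := hv y hy hlt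
  have h2 := hv z hz (show _ < A by simp only at hzv; rw [hzv]; linarith)
  have h3 := mul_right_cancel₀ (h.family.1 i).ne' (h1.trans h2.symm)
  simp only at hzv
  linarith

lemma exists_forall_norm_sub_le {X : Set ℂ} (hX : Bornology.IsBounded X) :
    ∃ V : ℝ, 1 ≤ V ∧ ∀ z ∈ X, ∀ w ∈ X, ‖z - w‖ ≤ V :=
  ⟨max 1 (diam X), le_max_left _ _, fun z hz w hw => by
    rw [← dist_eq_norm]; exact (dist_le_diam_of_mem hX hz hw).trans (le_max_right _ _)⟩

lemma exists_slope_le (h : IsSchottkyMap Ω Ω' c r c' r' f g)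
    (hpos : ∀ i, IsPosOriented f (c i) (r i) (c' i) (r' i))
    (hT : volume (discResidual Ω' c' r') = 0)
    (hW : LocallyWeaklyQuasisymmetricOn f (discResidual Ω c r)) {p y₀ : ℂ}
    (hp : p ∈ discResidual Ω c r) (hy₀ : y₀ ∈ discResidual Ω c r) (hpy : y₀ ≠ p) :
    ∃ η > 0, ∃ A > 0, ∀ i, dist (c i) p < η → ∀ y ∈ discResidual Ω c r,
      ‖c' i - f y‖ ≤ A * ‖c i - y‖ := by
  obtain ⟨R, hR, hRΩ⟩ := Metric.isOpen_iff.1 h.domain.1 p hp.1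
  obtain ⟨V, hV1, hV⟩ := exists_forall_norm_sub_le h.bdd'
  have hd : 0 < dist y₀ p := dist_pos.2 hpy
  have hc' : ∀ i, c' i ∈ Ω' := fun i => h.family'.2.1 i (mem_closedBall_self (h.family'.1 i).le)
  set A := max ((3 * V + 3) / (R / 2)) (V / (dist y₀ p / 2)) with hA
  have hA0 : 0 < A := lt_max_of_lt_left (by positivity)
  refine ⟨min (R / 2) (dist y₀ p / 2), by positivity, A, hA0, fun i hi y hy => ?_⟩
  rw [lt_min_iff] at hi
  have hball : closedBall (c i) (R / 2) ⊆ Ω := by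
    refine subset_trans (fun z hz => ?_) hRΩ
    have := dist_triangle z (c i) p
    rw [mem_closedBall] at hz
    rw [mem_ball]; linarith [hi.1]
  have hslope : ∀ j, i ≠ j → ‖(c' i - c' j) / (c i - c j)‖ ∈ Ioi A →
      ‖(c' i - c' j) / (c i - c j)‖ * r i = r' i := fun j hij =>
    h.norm_slope_mul_radius hpos hT hW hij isOpen_Ioi one_pos fun a b ha haA hab => by
      refine ⟨V + 1, by linarith, h.isCompact_and_degree_of_large ha hball
        (fun w hw => hV _ hw _ (hc' i)) (by linarith) ?_⟩
      have h1 : (3 * V + 3) / (R / 2) ≤ ‖a‖ := (le_max_left _ _).trans (le_of_lt haA)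
      rw [div_le_iff₀ (by positivity)] at h1
      linarith
  have hbase : ‖(c' i - f y₀) / (c i - y₀)‖ ≤ A := by
    rw [norm_div]
    refine le_trans ?_ (le_max_right _ _)
    have h1 : dist y₀ p / 2 ≤ ‖c i - y₀‖ := by
      rw [← dist_eq_norm]
      have := dist_triangle_left y₀ p (c i)
      linarith [hi.2]
    exact div_le_div₀ (by linarith) (hV _ (hc' i) _ (h.mapsTo hy₀).1) (by positivity) h1
  have := h.slope_le (fun y hy hv => h.slope_mem hT isOpen_Ioi hslope hy hv) hy₀ hbase hy
  rwa [norm_div, div_le_iff₀ (norm_pos_iff.2 (h.center_sub_ne_zero i hy))] at this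

lemma exists_le_slope (h : IsSchottkyMap Ω Ω' c r c' r' f g)
    (hpos : ∀ i, IsPosOriented f (c i) (r i) (c' i) (r' i))
    (hT : volume (discResidual Ω' c' r') = 0)
    (hW : LocallyWeaklyQuasisymmetricOn f (discResidual Ω c r)) {p y₀ : ℂ}
    (hp : p ∈ discResidual Ω c r) (hy₀ : y₀ ∈ discResidual Ω c r) (hpy : y₀ ≠ p) :
    ∃ η > 0, ∃ A > 0, ∀ i, dist (c' i) (f p) < η → r' i < η → ∀ y ∈ discResidual Ω c r,
      A * ‖c i - y‖ ≤ ‖c' i - f y‖ := by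
  obtain ⟨R, hR, hRΩ⟩ := Metric.isOpen_iff.1 h.domain'.1 (f p) (h.mapsTo hp).1
  obtain ⟨V, hV1, hV⟩ := exists_forall_norm_sub_le h.bdd
  have hd : 0 < dist (f y₀) (f p) := dist_pos.2 fun e => hpy (h.injOn hy₀ hp e)
  have hc : ∀ i, c i ∈ Ω := fun i => h.family.2.1 i (mem_closedBall_self (h.family.1 i).le)
  have hV0 : 0 < V := by linarith
  set s := R / 4 with hs
  have hs0 : 0 < s := by positivity
  set A := min (s / 4 / V) (dist (f y₀) (f p) / 2 / V) with hA
  have hA0 : 0 < A := lt_min (by positivity) (by positivity)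
  refine ⟨min s (dist (f y₀) (f p) / 2), by positivity, A, hA0, fun i hi hri y hy => ?_⟩
  rw [lt_min_iff] at hi hri
  have hslope : ∀ j, i ≠ j → ‖(c' i - c' j) / (c i - c j)‖ ∈ Iio A →
      ‖(c' i - c' j) / (c i - c j)‖ * r i = r' i := fun j hij =>
    h.norm_slope_mul_radius hpos hT hW hij isOpen_Iio (e := s / 4) (by positivity)
      fun a b ha haA hab => by
      refine ⟨s, hs0, h.isCompact_and_degree_of_small hpos (i := i) (m := s / 2) ?_ ?_ (by linarith)⟩
      · refine subset_trans (fun z hz => ?_) hRΩ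
        have := dist_triangle z (c' i) (f p)
        rw [mem_closedBall] at hz
        rw [mem_ball]; linarith [hi.1]
      · intro z hz
        have h1 : ‖a‖ ≤ s / 4 / V := (le_of_lt haA).trans (min_le_left _ _)
        have h2 : ‖a * (z - c i)‖ ≤ s / 4 := by
          rw [norm_mul]
          rw [le_div_iff₀ hV0] at h1
          exact (mul_le_mul_of_nonneg_left (hV _ hz _ (hc i)) (norm_nonneg _)).trans h1
        have e : a * z + b - c' i = a * (z - c i) - (c' i - (a * c i + b)) := by ring
        rw [e]
        linarith [norm_sub_le (a * (z - c i)) (c' i - (a * c i + b))]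
  have hbase : A ≤ ‖(c' i - f y₀) / (c i - y₀)‖ := by
    rw [norm_div]
    refine le_trans (min_le_right _ _) ?_
    have h1 : dist (f y₀) (f p) / 2 ≤ ‖c' i - f y₀‖ := by
      rw [← dist_eq_norm]
      have := dist_triangle_left (f y₀) (f p) (c' i)
      linarith [hi.2]
    exact div_le_div₀ (norm_nonneg _) h1 (norm_pos_iff.2 (h.center_sub_ne_zero i hy₀))
      (hV _ (hc i) _ hy₀.1)
  have := h.le_slope (fun y hy hv => h.slope_mem hT isOpen_Iio hslope hy hv) hy₀ hbase hy
  rwa [norm_div, le_div_iff₀ (norm_pos_iff.2 (h.center_sub_ne_zero i hy))] at this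

lemma exists_mem_residual_ne (h : IsSchottkyMap Ω Ω' c r c' r' f g) [Nonempty I] (p : ℂ) :
    ∃ y ∈ discResidual Ω c r, y ≠ p := by
  obtain ⟨i⟩ := ‹Nonempty I›
  have hr := h.family.1 i
  by_cases hp : c i + r i = p
  · refine ⟨c i - r i, h.family.sphere_subset i (by simp [hr.le]), fun e => ?_⟩
    rw [← hp] at e
    have : (r i : ℂ) = 0 := by linear_combination (-1 / 2 : ℂ) * e
    exact hr.ne' (by exact_mod_cast this)
  · exact ⟨c i + r i, h.family.sphere_subset i (by simp [hr.le]), hp⟩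

theorem exists_biLipschitz_of_pos (h : IsSchottkyMap Ω Ω' c r c' r' f g)
    (hpos : ∀ i, IsPosOriented f (c i) (r i) (c' i) (r' i))
    (hT : volume (discResidual Ω' c' r') = 0)
    (hW : LocallyWeaklyQuasisymmetricOn f (discResidual Ω c r)) {p : ℂ}
    (hp : p ∈ discResidual Ω c r) :
    ∃ U ∈ 𝓝[discResidual Ω c r] p, ∃ A > 0, ∃ B > 0, ∀ x ∈ U, ∀ y ∈ discResidual Ω c r,
      A * dist x y ≤ dist (f x) (f y) ∧ dist (f x) (f y) ≤ B * dist x y := by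
  obtain ⟨i₀, -⟩ := h.exists_disc_near hT hp one_pos finite_empty
  have : Nonempty I := ⟨i₀⟩
  obtain ⟨y₀, hy₀, hpy⟩ := h.exists_mem_residual_ne p
  obtain ⟨η₁, hη₁, B, hB, hle⟩ := h.exists_slope_le hpos hT hW hp hy₀ hpy
  obtain ⟨η₂, hη₂, A, hA, hge⟩ := h.exists_le_slope hpos hT hW hp hy₀ hpy
  refine ⟨discResidual Ω c r ∩ {x | dist x p < η₁ ∧ dist (f x) (f p) < η₂}, ?_, A, hA, B, hB, ?_⟩
  · refine inter_mem self_mem_nhdsWithin (inter_mem (mem_nhdsWithin_of_mem_nhds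
      (ball_mem_nhds p hη₁)) ?_)
    exact (h.cont p hp).eventually (ball_mem_nhds (f p) hη₂)
  · rintro x ⟨hx, hx1, hx2⟩ y hy
    have hlim : (x, f x) ∈ closure {q : ℂ × ℂ | A * dist q.1 y ≤ dist q.2 (f y) ∧
        dist q.2 (f y) ≤ B * dist q.1 y} := by
      rw [Metric.mem_closure_iff]
      intro ε hε
      obtain ⟨i, -, hi1, hi2, -, hi4⟩ := h.exists_disc_near hT hx (ε := min ε
        (min (η₁ - dist x p) (min (η₂ - dist (f x) (f p)) η₂)))
        (lt_min hε (lt_min (by linarith) (lt_min (by linarith) hη₂))) finite_empty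
      simp only [lt_min_iff] at hi1 hi2 hi4
      have t1 := dist_triangle (c i) x p
      have t2 := dist_triangle (c' i) (f x) (f p)
      refine ⟨(c i, c' i), ?_, ?_⟩
      · simp only [dist_eq_norm]
        exact ⟨hge i (by linarith) hi4.2.2.2 y hy, hle i (by linarith) y hy⟩
      · rw [dist_comm, Prod.dist_eq]
        exact max_lt hi1.1 hi2.1
    have hcl : IsClosed {q : ℂ × ℂ | A * dist q.1 y ≤ dist q.2 (f y) ∧
        dist q.2 (f y) ≤ B * dist q.1 y} :=
      IsClosed.and (isClosed_le (by fun_prop) (by fun_prop))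
        (isClosed_le (by fun_prop) (by fun_prop))
    rwa [hcl.closure_eq] at hlim

lemma conj (h : IsSchottkyMap Ω Ω' c r c' r' f g) :
    IsSchottkyMap Ω ((starRingEnd ℂ) ⁻¹' Ω') c r (fun i => (starRingEnd ℂ) (c' i)) r'
      (fun z => (starRingEnd ℂ) (f z)) (fun z => g ((starRingEnd ℂ) z)) := by
  have hb : ∀ i (z : ℂ), dist z ((starRingEnd ℂ) (c' i)) = dist ((starRingEnd ℂ) z) (c' i) :=
    fun i z => by rw [← Complex.dist_conj_conj, Complex.conj_conj]
  have hres : discResidual ((starRingEnd ℂ) ⁻¹' Ω') (fun i => (starRingEnd ℂ) (c' i)) r' =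
      (starRingEnd ℂ) ⁻¹' discResidual Ω' c' r' := by
    ext z; simp [discResidual, hb]
  have hcc : Continuous (starRingEnd ℂ) := Complex.continuous_conj
  refine ⟨h.domain, ⟨h.domain'.1.preimage hcc, ?_⟩, h.bdd, ?_, h.family, ⟨h.family'.1, ?_, ?_⟩,
    hcc.comp_continuousOn h.cont, ?_, ?_, ?_, ?_, ?_, ?_, ?_⟩
  · exact Complex.conjLIE.toHomeomorph.isConnected_preimage.2 h.domain'.2
  · exact Complex.conjLIE.isometry.antilipschitz.isBounded_preimage h.bdd'
  · intro i z hz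
    exact h.family'.2.1 i (by rwa [mem_closedBall, hb] at hz)
  · intro i j hij
    rw [Set.disjoint_left]
    intro z hz hz'
    rw [mem_closedBall, hb] at hz hz'
    exact Set.disjoint_left.1 (h.family'.2.2 hij) hz hz'
  · rw [hres]
    exact h.cont'.comp hcc.continuousOn fun z hz => hz
  · rw [hres]
    intro z hz
    simpa using h.mapsTo hz
  · rw [hres]
    exact fun z hz => h.mapsTo' hz
  · intro z hz
    simpa using h.leftInv z hz
  · rw [hres]
    intro z hz
    simp [h.rightInv _ hz]
  · intro i z hz
    have := h.circle i hz
    rwa [mem_sphere, ← Complex.dist_conj_conj] at this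
  · intro i z hz
    exact h.circle' i (by rwa [mem_sphere, hb] at hz)

theorem exists_biLipschitz (h : IsSchottkyMap Ω Ω' c r c' r' f g)
    (hT : volume (discResidual Ω' c' r') = 0)
    (hW : LocallyWeaklyQuasisymmetricOn f (discResidual Ω c r)) {p : ℂ}
    (hp : p ∈ discResidual Ω c r) :
    ∃ U ∈ 𝓝[discResidual Ω c r] p, ∃ A > 0, ∃ B > 0, ∀ x ∈ U, ∀ y ∈ discResidual Ω c r,
      A * dist x y ≤ dist (f x) (f y) ∧ dist (f x) (f y) ≤ B * dist x y := by
  rcases h.oriented_consistent with hpos | hneg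
  · exact h.exists_biLipschitz_of_pos hpos hT hW hp
  · have hres : discResidual ((starRingEnd ℂ) ⁻¹' Ω') (fun i => (starRingEnd ℂ) (c' i)) r' =
        Complex.conjLIE ⁻¹' discResidual Ω' c' r' := by
      ext z
      have hb : ∀ i (z : ℂ), dist z ((starRingEnd ℂ) (c' i)) = dist ((starRingEnd ℂ) z) (c' i) :=
        fun i z => by rw [← Complex.dist_conj_conj, Complex.conj_conj]
      simp [discResidual, hb]
    have hT' : volume (discResidual ((starRingEnd ℂ) ⁻¹' Ω')
        (fun i => (starRingEnd ℂ) (c' i)) r') = 0 := by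
      rw [hres]
      exact Complex.conjLIE.measurePreserving.quasiMeasurePreserving.preimage_null hT
    have hW' : LocallyWeaklyQuasisymmetricOn (fun z => (starRingEnd ℂ) (f z))
        (discResidual Ω c r) := by
      simpa only [LocallyWeaklyQuasisymmetricOn, Complex.dist_conj_conj] using hW
    simpa only [Complex.dist_conj_conj] using
      h.conj.exists_biLipschitz_of_pos hneg hT' hW' hp

end IsSchottkyMap

section Separation

lemma exp_eq_const_imp_const {X : Type*} [TopologicalSpace X] {s : Set X} (hs : IsPreconnected s)
    {g : X → ℂ} (hg : ContinuousOn g s)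
    (he : ∀ x ∈ s, ∀ y ∈ s, Complex.exp (g x) = Complex.exp (g y)) {x y : X} (hx : x ∈ s)
    (hy : y ∈ s) : g x = g y :=
  Complex.isCoveringMap_exp.constOn_of_comp hs hg
    (fun a ha b hb => Subtype.ext (he a ha b hb)) hx hy

/-- The quotient `(z - e 0) / (z - e 1)` has a continuous logarithm off the path `e`. -/
lemma exists_log_div_of_path {e : ℝ → ℂ} (he : Continuous e) :
    ∃ L : ℂ → ℂ, ContinuousOn L (e '' Icc 0 1)ᶜ ∧
      ∀ z ∈ (e '' Icc 0 1)ᶜ, Complex.exp (L z) = (z - e 0) / (z - e 1) := by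
  classical
  set A : Set ℂ := (e '' Icc 0 1)ᶜ
  have hne : ∀ z ∈ A, ∀ t ∈ Icc (0 : ℝ) 1, z - e t ≠ 0 := fun z hz t ht h =>
    hz ⟨t, ht, (sub_eq_zero.1 h).symm⟩
  have h1 : (1 : ℝ) ∈ Icc (0 : ℝ) 1 := by simp
  have hsym : ∀ t : unitInterval, (1 - t : ℝ) ∈ Icc (0 : ℝ) 1 := fun t =>
    ⟨by linarith [t.2.2], by linarith [t.2.1]⟩
  let H : C(unitInterval × A, {z : ℂ // z ≠ 0}) :=
    ⟨fun q => ⟨((q.2 : ℂ) - e (1 - q.1)) / ((q.2 : ℂ) - e 1),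
      div_ne_zero (hne _ q.2.2 _ (hsym q.1)) (hne _ q.2.2 _ h1)⟩, by
      refine Continuous.subtype_mk ?_ _
      exact Continuous.div (by fun_prop) (by fun_prop) fun q => hne _ q.2.2 _ h1⟩
  have H0 : ∀ a : A, H (0, a) =
      (fun z : ℂ ↦ (⟨_, z.exp_ne_zero⟩ : {z : ℂ // z ≠ 0})) ((ContinuousMap.const A (0 : ℂ)) a) := by
    intro a
    refine Subtype.ext ?_
    change ((a : ℂ) - e (1 - ((0 : unitInterval) : ℝ))) / ((a : ℂ) - e 1) = Complex.exp 0
    rw [show ((0 : unitInterval) : ℝ) = 0 from rfl, sub_zero, div_self (hne _ a.2 _ h1), Complex.exp_zero]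
  let G := Complex.isCoveringMap_exp.liftHomotopy H (ContinuousMap.const A 0) H0
  have hG := Complex.isCoveringMap_exp.liftHomotopy_lifts H (ContinuousMap.const A 0) H0
  refine ⟨fun z => if h : z ∈ A then G (1, ⟨z, h⟩) else 0, ?_, ?_⟩
  · rw [continuousOn_iff_continuous_domRestrict]
    have : Continuous fun a : A => G (1, a) := by fun_prop
    refine this.congr fun a => ?_
    simp [domRestrict]
  · intro z hz
    simp only [dif_pos hz]
    have h2 := congrArg Subtype.val (congrFun hG (1, ⟨z, hz⟩))
    change Complex.exp (G (1, ⟨z, hz⟩)) =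
      (z - e (1 - ((1 : unitInterval) : ℝ))) / (z - e 1) at h2
    rwa [show ((1 : unitInterval) : ℝ) = 1 from rfl, sub_self] at h2

lemma not_exists_log_div {a b : ℂ} (hab : a ≠ b) :
    ¬ ∃ L : ℂ → ℂ, ContinuousOn L {z | z ≠ a ∧ z ≠ b} ∧
      ∀ z, z ≠ a → z ≠ b → Complex.exp (L z) = (z - a) / (z - b) := by
  rintro ⟨L, hL, hexp⟩
  have hd : a - b ≠ 0 := sub_ne_zero.2 hab
  have hρ : 0 < ‖a - b‖ := norm_pos_iff.2 hd
  set w : ℝ → ℂ := fun θ => ((‖a - b‖ / 2 : ℝ) : ℂ) * Complex.exp (θ * Complex.I) with hw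
  have hwn : ∀ θ, ‖w θ‖ = ‖a - b‖ / 2 := fun θ => by
    rw [hw]
    simp only [norm_mul, Complex.norm_exp_ofReal_mul_I, mul_one]
    rw [Complex.norm_of_nonneg (by positivity)]
  have hw0 : ∀ θ, w θ ≠ 0 := fun θ => norm_pos_iff.1 (by rw [hwn]; positivity)
  have hwb : ∀ θ, a + w θ ≠ b := fun θ h => by
    have : ‖w θ‖ = ‖a - b‖ := by rw [norm_sub_rev, ← h, add_sub_cancel_left]
    rw [hwn] at this
    linarith
  have hwa : ∀ θ, a + w θ ≠ a := fun θ h => hw0 θ (by simpa using h)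
  have hwc : Continuous w := by fun_prop
  have hsl : ∀ θ, 1 + w θ / (a - b) ∈ Complex.slitPlane := fun θ => by
    refine Complex.mem_slitPlane_of_norm_lt_one ?_
    rw [norm_div, hwn, div_lt_one hρ]
    linarith
  set ψ : ℝ → ℂ := fun θ => L (a + w θ) + Complex.log (1 + w θ / (a - b)) - θ * Complex.I with hψ
  have hψc : Continuous ψ := by
    refine Continuous.sub (Continuous.add ?_ ?_) (by fun_prop)
    · exact hL.comp_continuous (by fun_prop) fun θ => ⟨hwa θ, hwb θ⟩
    · exact Continuous.clog (by fun_prop) hsl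
  have hψe : ∀ θ, Complex.exp (ψ θ) = ((‖a - b‖ / 2 : ℝ) : ℂ) / (a - b) := fun θ => by
    have hb : a + w θ - b ≠ 0 := sub_ne_zero.2 (hwb θ)
    have he : Complex.exp (θ * Complex.I) ≠ 0 := Complex.exp_ne_zero _
    have e1 : 1 + w θ / (a - b) = (a + w θ - b) / (a - b) := by field_simp; ring
    rw [hψ]
    simp only
    rw [Complex.exp_sub, Complex.exp_add, hexp _ (hwa θ) (hwb θ),
      Complex.exp_log (Complex.slitPlane_ne_zero (hsl θ)), e1, add_sub_cancel_left]
    have : w θ = ((‖a - b‖ / 2 : ℝ) : ℂ) * Complex.exp (θ * Complex.I) := rfl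
    rw [div_mul_div_comm, this]
    rw [this] at hb
    field_simp
  have h := exp_eq_const_imp_const isPreconnected_univ hψc.continuousOn
    (fun x _ y _ => by rw [hψe, hψe]) (mem_univ 0) (mem_univ (2 * Real.pi))
  have hw2 : w (2 * Real.pi) = w 0 := by
    simp only [hw]
    push_cast
    rw [Complex.exp_two_pi_mul_I]
    simp
  simp only [hψ] at h
  rw [hw2] at h
  have : (2 * Real.pi : ℂ) * Complex.I = 0 := by
    push_cast at h
    linear_combination h
  simp [Real.pi_ne_zero] at this

/-- Two arcs which only share their end points separate the plane. -/
lemma not_isPreconnected_compl_arcs {α β : ℝ → ℂ} (hα : Continuous α) (hβ : Continuous β)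
    (h0 : α 0 = β 0) (h1 : α 1 = β 1) (hne : α 0 ≠ α 1)
    (hInt : ∀ z ∈ α '' Icc 0 1, z ∈ β '' Icc 0 1 → z = α 0 ∨ z = α 1) :
    ¬ IsPreconnected (α '' Icc 0 1 ∪ β '' Icc 0 1)ᶜ := by
  classical
  intro hc
  obtain ⟨L, hL, hLe⟩ := exists_log_div_of_path hα
  obtain ⟨M, hM, hMe⟩ := exists_log_div_of_path hβ
  set A := α '' Icc 0 1
  set B := β '' Icc 0 1
  have hA : IsClosed A := (isCompact_Icc.image hα).isClosed
  have hB : IsClosed B := (isCompact_Icc.image hβ).isClosed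
  have hk : ∃ k, (∀ z ∈ (A ∪ B)ᶜ, L z = M z + k) ∧ Complex.exp k = 1 := by
    have hsA : (A ∪ B)ᶜ ⊆ Aᶜ := compl_subset_compl.2 subset_union_left
    have hsB : (A ∪ B)ᶜ ⊆ Bᶜ := compl_subset_compl.2 subset_union_right
    have hone : ∀ z ∈ (A ∪ B)ᶜ, Complex.exp (L z - M z) = 1 := fun z hz => by
      rw [Complex.exp_sub, hLe z (hsA hz), hMe z (hsB hz), h0, h1, div_self]
      rw [← h0, ← h1, ← hLe z (hsA hz)]
      exact Complex.exp_ne_zero _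
    rcases (A ∪ B)ᶜ.eq_empty_or_nonempty with he | ⟨z₀, hz₀⟩
    · exact ⟨0, by simp [he], by simp⟩
    · refine ⟨L z₀ - M z₀, fun z hz => ?_, hone _ hz₀⟩
      have := exp_eq_const_imp_const hc ((hL.mono hsA).sub (hM.mono hsB))
        (fun x hx y hy => (hone x hx).trans (hone y hy).symm) hz hz₀
      simp only [Pi.sub_apply] at this
      linear_combination this
  obtain ⟨k, hk, hk1⟩ := hk
  refine not_exists_log_div hne ⟨fun z => if z ∈ A then M z + k else L z, ?_, ?_⟩
  · rintro z ⟨hza, hzb⟩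
    refine ContinuousAt.continuousWithinAt ?_
    by_cases hz : z ∈ A
    · have hzB : z ∈ Bᶜ := fun h => (hInt z hz h).elim hza hzb
      refine ((hM.continuousAt (hB.isOpen_compl.mem_nhds hzB)).add_const k).congr ?_
      filter_upwards [hB.isOpen_compl.mem_nhds hzB] with x hx
      by_cases hxA : x ∈ A
      · rw [if_pos hxA]
      · rw [if_neg hxA, hk x (by simp only [mem_compl_iff, mem_union, not_or]; exact ⟨hxA, hx⟩)]
    · refine (hL.continuousAt (hA.isOpen_compl.mem_nhds hz)).congr ?_
      filter_upwards [hA.isOpen_compl.mem_nhds hz] with x hx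
      rw [if_neg hx]
  · intro z hza hzb
    by_cases hz : z ∈ A
    · have hzB : z ∈ Bᶜ := fun h => (hInt z hz h).elim hza hzb
      simp only [if_pos hz]
      rw [Complex.exp_add, hk1, mul_one, hMe z hzB, h0, h1]
    · simp only [if_neg hz]
      rw [hLe z hz]

/-- The image of a circle under a continuous injection separates the plane. -/
lemma not_isPreconnected_compl_image_sphere {φ : ℂ → ℂ} {c : ℂ} {r : ℝ} (hr : 0 < r)
    (hφ : ContinuousOn φ (sphere c r)) (hinj : InjOn φ (sphere c r)) :
    ¬ IsPreconnected (φ '' sphere c r)ᶜ := by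
  set e : ℝ → ℂ := fun θ => φ (c + r * Complex.exp (θ * Complex.I)) with he
  have hec : Continuous e :=
    hφ.comp_continuous (by fun_prop) fun θ => mem_sphere_circle c hr.le θ
  have heq : ∀ x y, e x = e y → ∃ n : ℤ, x = y + n * (2 * Real.pi) := by
    intro x y h
    have := hinj (mem_sphere_circle c hr.le x) (mem_sphere_circle c hr.le y) h
    refine exp_ofReal_mul_I_eq_iff.1 ?_
    have hr0 : (r : ℂ) ≠ 0 := by exact_mod_cast hr.ne'
    exact mul_left_cancel₀ hr0 (add_left_cancel this)
  have heq' : ∀ x y, (∃ n : ℤ, x = y + n * (2 * Real.pi)) → e x = e y := by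
    intro x y h
    simp only [he]
    rw [exp_ofReal_mul_I_eq_iff.2 h]
  have hpi := Real.pi_pos
  have himg : φ '' sphere c r = (fun t : ℝ => e (Real.pi * t)) '' Icc 0 1 ∪
      (fun t : ℝ => e (-(Real.pi * t))) '' Icc 0 1 := by
    apply Subset.antisymm
    · rintro _ ⟨z, hz, rfl⟩
      have hz' : z = c + r * Complex.exp ((z - c).arg * Complex.I) := by
        have h1 : ‖z - c‖ = r := by rwa [mem_sphere, dist_eq_norm] at hz
        have := Complex.norm_mul_exp_arg_mul_I (z - c)
        rw [h1] at this
        rw [this]; ring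
      have hpi' : Real.pi * ((z - c).arg / Real.pi) = (z - c).arg := by field_simp
      rcases le_total 0 (z - c).arg with h | h
      · refine Or.inl ⟨(z - c).arg / Real.pi, ⟨by positivity, ?_⟩, ?_⟩
        · rw [div_le_one hpi]; exact Complex.arg_le_pi _
        · simp only [hpi', he]
          rw [← hz']
      · refine Or.inr ⟨-(z - c).arg / Real.pi, ⟨div_nonneg (by linarith) hpi.le, ?_⟩, ?_⟩
        · rw [div_le_one hpi]; linarith [Complex.neg_pi_lt_arg (z - c)]
        · simp only
          rw [show -(Real.pi * (-(z - c).arg / Real.pi)) = (z - c).arg by field_simp]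
          simp only [he]
          rw [← hz']
    · rintro _ (⟨t, -, rfl⟩ | ⟨t, -, rfl⟩)
      · exact ⟨_, mem_sphere_circle c hr.le _, rfl⟩
      · exact ⟨_, mem_sphere_circle c hr.le _, rfl⟩
  rw [himg]
  apply not_isPreconnected_compl_arcs (by fun_prop) (by fun_prop)
  · simp
  · refine heq' _ _ ⟨1, ?_⟩
    push_cast; ring
  · intro h
    obtain ⟨n, hn⟩ := heq _ _ h
    have h3 : (-1 : ℝ) = n * 2 := by
      have : Real.pi * (-1) = Real.pi * (n * 2) := by linarith
      exact mul_left_cancel₀ hpi.ne' this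
    have h4 : (-1 : ℤ) = n * 2 := by exact_mod_cast h3
    omega
  · rintro _ ⟨s, hs, rfl⟩ ⟨t, ht, hst⟩
    obtain ⟨n, hn⟩ := heq _ _ hst
    have h3 : -(t + s) = 2 * n := by
      have : Real.pi * (-(t + s)) = Real.pi * (2 * n) := by linarith
      exact mul_left_cancel₀ hpi.ne' this
    have hn1 : -1 ≤ n := by
      have : (-1 : ℝ) ≤ n := by linarith [hs.2, ht.2]
      exact_mod_cast this
    have hn2 : n ≤ 0 := by
      have : (n : ℝ) ≤ 0 := by linarith [hs.1, ht.1]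
      exact_mod_cast this
    obtain rfl | rfl : n = -1 ∨ n = 0 := by omega
    · right
      push_cast at h3
      have : s = 1 := by linarith [hs.2, ht.2]
      simp [this]
    · left
      push_cast at h3
      have : s = 0 := by linarith [hs.1, ht.1]
      simp [this]

end Separation

section Frontier

lemma IsPreconnected.subset_of_disjoint_frontier {X : Type*} [TopologicalSpace X] {s t : Set X}
    (hs : IsPreconnected s) (hne : (s ∩ t).Nonempty) (hd : ∀ z ∈ s, z ∉ frontier t) : s ⊆ t := by
  have hcov : s ⊆ interior t ∪ (closure t)ᶜ := fun z hz => by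
    by_cases h : z ∈ closure t
    · exact Or.inl (by_contra fun h' => hd z hz ⟨h, h'⟩)
    · exact Or.inr h
  refine (hs.subset_left_of_subset_union isOpen_interior isClosed_closure.isOpen_compl
    (disjoint_compl_right.mono_left (interior_subset.trans subset_closure)) hcov ?_).trans
    interior_subset
  obtain ⟨x, hx, hxt⟩ := hne
  exact ⟨x, hx, by_contra fun h' => hd x hx ⟨subset_closure hxt, h'⟩⟩

lemma Bornology.IsBounded.nonempty_frontier {V : Set ℂ} (hb : Bornology.IsBounded V)
    (hne : V.Nonempty) : (frontier V).Nonempty :=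
  nonempty_frontier_iff.2 ⟨hne, fun h => NormedSpace.unbounded_univ ℝ ℂ (h ▸ hb)⟩

lemma IsCompact.exists_bounded_component {K : Set ℂ} (hK : IsCompact K)
    (h : ¬ IsPreconnected Kᶜ) : ∃ V : Set ℂ, IsOpen V ∧ IsPreconnected V ∧ V.Nonempty ∧
      Bornology.IsBounded V ∧ frontier V ⊆ K ∧ ∀ z ∈ V, z ∉ K := by
  obtain ⟨R, hR, hKR⟩ := hK.isBounded.subset_closedBall_lt 0 0
  have hO : IsPreconnected ((univ : Set ℂ) \ closedBall 0 R) :=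
    isPreconnected_sdiff_closedBall isOpen_univ isPreconnected_univ hR (subset_univ _)
  have hOK : (univ : Set ℂ) \ closedBall 0 R ⊆ Kᶜ := fun z hz hzK => hz.2 (hKR hzK)
  obtain ⟨x, hx, hb⟩ : ∃ x ∈ Kᶜ, connectedComponentIn Kᶜ x ⊆ closedBall 0 R := by
    by_contra! hcon
    have hx0 : (2 * R : ℂ) ∈ (univ : Set ℂ) \ closedBall 0 R := by
      refine ⟨mem_univ _, fun hm => ?_⟩
      rw [mem_closedBall_zero_iff, norm_mul, Complex.norm_of_nonneg hR.le] at hm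
      norm_num at hm
      linarith
    refine h (isPreconnected_of_forall (2 * R : ℂ) fun y hy => ?_)
    obtain ⟨w, hw, hwR⟩ := not_subset.1 (hcon y hy)
    exact ⟨_, union_subset hOK (connectedComponentIn_subset Kᶜ y), Or.inl hx0,
      Or.inr (mem_connectedComponentIn hy),
      IsPreconnected.union' ⟨w, ⟨mem_univ _, hwR⟩, hw⟩ hO isPreconnected_connectedComponentIn⟩
  have hopen : ∀ y, IsOpen (connectedComponentIn Kᶜ y) := fun y =>
    hK.isClosed.isOpen_compl.connectedComponentIn
  refine ⟨connectedComponentIn Kᶜ x, hopen x, isPreconnected_connectedComponentIn,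
    ⟨x, mem_connectedComponentIn hx⟩, isBounded_closedBall.subset hb, fun z hz => ?_,
    fun z hz => connectedComponentIn_subset _ _ hz⟩
  by_contra hzK
  obtain ⟨w, hw1, hw2⟩ := mem_closure_iff_nhds.1 hz.1 _
    ((hopen z).mem_nhds (mem_connectedComponentIn hzK))
  have := (connectedComponentIn_eq hw1).trans (connectedComponentIn_eq hw2).symm
  refine hz.2 ?_
  rw [(hopen x).interior_eq, ← this]
  exact mem_connectedComponentIn hzK

/-- A bounded set whose boundary lies in a domain with connected boundary is inside the domain. -/
lemma subset_of_frontier_subset {Ω V : Set ℂ} (hΩ : IsOpen Ω) (hb : Bornology.IsBounded Ω)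
    (hfr : IsPreconnected (frontier Ω)) (hV : IsOpen V) (hVc : IsPreconnected V)
    (hVne : V.Nonempty) (hVb : Bornology.IsBounded V) (hVf : frontier V ⊆ Ω) : V ⊆ Ω := by
  have hfd : ∀ z ∈ Ω, z ∉ frontier Ω := fun z hz h => by
    rw [hΩ.frontier_eq] at h
    exact h.2 hz
  obtain ⟨w, hw⟩ := hVb.nonempty_frontier hVne
  have hVΩ : (V ∩ Ω).Nonempty := by
    obtain ⟨y, hy1, hy2⟩ := mem_closure_iff_nhds.1 hw.1 _ (hΩ.mem_nhds (hVf hw))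
    exact ⟨y, hy2, hy1⟩
  by_contra hcon
  have hmeet : (frontier Ω ∩ V).Nonempty := by
    by_contra hemp
    exact hcon (hVc.subset_of_disjoint_frontier hVΩ fun z hz hzf => hemp ⟨z, hzf, hz⟩)
  have hsub : frontier Ω ⊆ V :=
    hfr.subset_of_disjoint_frontier hmeet fun z hz hzV => hfd z (hVf hzV) hz
  obtain ⟨z, hz⟩ := (hb.union hVb).nonempty_frontier (hVne.mono subset_union_right)
  have hz' : z ∉ Ω ∪ V := by
    rw [(hΩ.union hV).frontier_eq] at hz
    exact hz.2
  rcases frontier_union_subset _ _ hz with h | h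
  · exact hz' (Or.inr (hsub h.1))
  · exact hz' (Or.inl (hVf h.2))

end Frontier

/-- Mutually inverse continuous maps `f`, `g` between two relative Schottky sets in bounded
domains with connected boundary. -/
structure IsSchottkyHomeo {I I' : Type*} (Ω Ω' : Set ℂ) (c : I → ℂ) (r : I → ℝ) (c' : I' → ℂ)
    (r' : I' → ℝ) (f g : ℂ → ℂ) : Prop where
  domain : IsPlaneDomain Ω
  domain' : IsPlaneDomain Ω'
  bdd : Bornology.IsBounded Ω
  bdd' : Bornology.IsBounded Ω'
  frontier_preconnected : IsPreconnected (frontier Ω)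
  frontier_preconnected' : IsPreconnected (frontier Ω')
  family : IsSchottkyFamily Ω c r
  family' : IsSchottkyFamily Ω' c' r'
  cont : ContinuousOn f (discResidual Ω c r)
  cont' : ContinuousOn g (discResidual Ω' c' r')
  mapsTo : MapsTo f (discResidual Ω c r) (discResidual Ω' c' r')
  mapsTo' : MapsTo g (discResidual Ω' c' r') (discResidual Ω c r)
  leftInv : ∀ z ∈ discResidual Ω c r, g (f z) = z
  rightInv : ∀ z ∈ discResidual Ω' c' r', f (g z) = z

section Circles

variable {I I' : Type*} {Ω Ω' : Set ℂ} {c : I → ℂ} {r : I → ℝ} {c' : I' → ℂ} {r' : I' → ℝ}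
  {f g : ℂ → ℂ}

lemma IsSchottkyFamily.isPreconnected_residual_sdiff_sphere (h : IsSchottkyFamily Ω c r)
    (hΩ : IsPlaneDomain Ω) (hb : Bornology.IsBounded Ω) (i : I) :
    IsPreconnected (discResidual Ω c r \ sphere (c i) (r i)) := by
  have heq : discResidual Ω c r \ sphere (c i) (r i) =
      (Ω \ closedBall (c i) (r i)) \ ⋃ j : {j // j ≠ i}, ball (c j) (r j) := by
    ext z
    simp only [discResidual, Set.mem_sdiff, mem_iUnion, not_exists, Subtype.forall]
    constructor
    · rintro ⟨⟨h1, h2⟩, h3⟩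
      refine ⟨⟨h1, fun h4 => h3 (le_antisymm h4 ?_)⟩, fun j _ => h2 j⟩
      exact not_lt.1 (h2 i)
    · rintro ⟨⟨h1, h2⟩, h3⟩
      refine ⟨⟨h1, fun j => ?_⟩, fun h4 => h2 (sphere_subset_closedBall h4)⟩
      by_cases hj : j = i
      · subst hj
        exact fun h4 => h2 (ball_subset_closedBall h4)
      · exact h3 j hj
  rw [heq]
  refine isPreconnected_sdiff_iUnion_ball (c := fun j : {j // j ≠ i} => c j)
    (r := fun j : {j // j ≠ i} => r j)
    (isPreconnected_sdiff_closedBall hΩ.1 hΩ.2.isPreconnected (h.1 i) (h.2.1 i))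
    (fun j => h.1 j) (fun j z hz => ⟨h.2.1 j hz, fun hz' => j.2 (h.eq_of_mem hz hz')⟩)
    (fun j k hjk => h.2.2 fun e => hjk (Subtype.ext e)) fun ρ hρ => ?_
  exact Set.Finite.preimage (f := fun j : {j // j ≠ i} => (j : I))
    Subtype.val_injective.injOn (h.finite_le_radius hb hρ)

namespace IsSchottkyHomeo

lemma symm (h : IsSchottkyHomeo Ω Ω' c r c' r' f g) : IsSchottkyHomeo Ω' Ω c' r' c r g f :=
  ⟨h.domain', h.domain, h.bdd', h.bdd, h.frontier_preconnected', h.frontier_preconnected,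
    h.family', h.family, h.cont', h.cont, h.mapsTo', h.mapsTo, h.rightInv, h.leftInv⟩

lemma injOn (h : IsSchottkyHomeo Ω Ω' c r c' r' f g) : InjOn f (discResidual Ω c r) :=
  fun x hx y hy hxy => by rw [← h.leftInv x hx, hxy, h.leftInv y hy]

lemma exists_sphere_subset (h : IsSchottkyHomeo Ω Ω' c r c' r' f g) (i : I) :
    ∃ j, sphere (c' j) (r' j) ⊆ f '' sphere (c i) (r i) := by
  have hsp := h.family.sphere_subset i
  have hcont := h.cont.mono hsp
  set γ := f '' sphere (c i) (r i) with hγ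
  have hγc : IsCompact γ := (isCompact_sphere _ _).image_of_continuousOn hcont
  have hγT : γ ⊆ discResidual Ω' c' r' := by
    rintro _ ⟨z, hz, rfl⟩
    exact h.mapsTo (hsp hz)
  obtain ⟨V, hVo, hVc, hVne, hVb, hVf, hVγ⟩ := hγc.exists_bounded_component
    (not_isPreconnected_compl_image_sphere (h.family.1 i) hcont (h.injOn.mono hsp))
  have hVΩ : V ⊆ Ω' := subset_of_frontier_subset h.domain'.1 h.bdd' h.frontier_preconnected' hVo
    hVc hVne hVb (hVf.trans (hγT.trans fun _ hz => hz.1))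
  have hball : ∀ j, (ball (c' j) (r' j) ∩ V).Nonempty → ball (c' j) (r' j) ⊆ V := fun j hj =>
    (convex_ball _ _).isPreconnected.subset_of_disjoint_frontier hj fun z hz hzV =>
      (hγT (hVf hzV)).2 (mem_iUnion.2 ⟨j, hz⟩)
  set P := discResidual Ω' c' r' \ γ with hP
  have hPc : IsPreconnected P := by
    have : P = f '' (discResidual Ω c r \ sphere (c i) (r i)) := by
      apply Subset.antisymm
      · rintro z ⟨hz, hzγ⟩
        exact ⟨g z, ⟨h.mapsTo' hz, fun hs => hzγ ⟨g z, hs, h.rightInv z hz⟩⟩, h.rightInv z hz⟩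
      · rintro _ ⟨z, ⟨hz, hzs⟩, rfl⟩
        refine ⟨h.mapsTo hz, ?_⟩
        rintro ⟨w, hw, hwz⟩
        exact hzs (h.injOn (hsp hw) hz hwz ▸ hw)
    rw [this]
    exact (h.family.isPreconnected_residual_sdiff_sphere h.domain h.bdd i).image f
      (h.cont.mono sdiff_subset)
  by_cases hPV : (P ∩ V).Nonempty
  · have hPsub : P ⊆ V := hPc.subset_of_disjoint_frontier hPV fun z hz hzV => hz.2 (hVf hzV)
    have hnot : ¬ Ω' ⊆ V ∪ γ := by
      intro hsub
      have hcl : closure Ω' ⊆ Ω' := by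
        refine (closure_mono hsub).trans ?_
        rw [closure_union, hγc.isClosed.closure_eq, closure_eq_self_union_frontier]
        exact union_subset (union_subset hVΩ (hVf.trans fun z hz => (hγT hz).1))
          fun z hz => (hγT hz).1
      obtain ⟨z, hz⟩ := h.bdd'.nonempty_frontier h.domain'.2.nonempty
      rw [h.domain'.1.frontier_eq] at hz
      exact hz.2 (hcl hz.1)
    obtain ⟨x, hxΩ, hx⟩ := not_subset.1 hnot
    have hxT : x ∉ discResidual Ω' c' r' := fun hxT =>
      hx (or_iff_not_imp_right.2 fun hxγ => hPsub ⟨hxT, hxγ⟩)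
    obtain ⟨j, hj⟩ := (mem_residual_or_mem_ball hxΩ).resolve_left hxT
    have hdisj : Disjoint V (closure (ball (c' j) (r' j))) := by
      refine Disjoint.closure_right (Set.disjoint_left.2 fun z hz hzj => ?_) hVo
      exact hx (Or.inl (hball j ⟨z, hzj, hz⟩ hj))
    rw [closure_ball _ (h.family'.1 j).ne'] at hdisj
    refine ⟨j, fun z hz => by_contra fun hzγ => ?_⟩
    exact Set.disjoint_left.1 hdisj (hPsub ⟨h.family'.sphere_subset j hz, hzγ⟩)
      (sphere_subset_closedBall hz)
  · have hVT : ∀ z ∈ V, z ∉ discResidual Ω' c' r' := fun z hz hzT =>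
      hPV ⟨z, ⟨hzT, hVγ z hz⟩, hz⟩
    obtain ⟨x, hx⟩ := hVne
    obtain ⟨j, hj⟩ := (mem_residual_or_mem_ball (hVΩ hx)).resolve_left (hVT x hx)
    have hsub1 : V ⊆ ball (c' j) (r' j) :=
      hVc.subset_of_disjoint_frontier ⟨x, hx, hj⟩ fun z hz hzf => by
        rw [frontier_ball _ (h.family'.1 j).ne'] at hzf
        exact hVT z hz (h.family'.sphere_subset j hzf)
    have heq : V = ball (c' j) (r' j) := hsub1.antisymm (hball j ⟨x, hj, hx⟩)
    refine ⟨j, ?_⟩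
    rwa [heq, frontier_ball _ (h.family'.1 j).ne'] at hVf

lemma exists_circle (h : IsSchottkyHomeo Ω Ω' c r c' r' f g) (i : I) :
    ∃ j, MapsTo f (sphere (c i) (r i)) (sphere (c' j) (r' j)) ∧
      MapsTo g (sphere (c' j) (r' j)) (sphere (c i) (r i)) := by
  obtain ⟨j, hj⟩ := h.exists_sphere_subset i
  obtain ⟨k, hk⟩ := h.symm.exists_sphere_subset j
  have hg : MapsTo g (sphere (c' j) (r' j)) (sphere (c i) (r i)) := by
    intro w hw
    obtain ⟨z, hz, rfl⟩ := hj hw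
    rwa [h.leftInv z (h.family.sphere_subset i hz)]
  have hki : k = i := by
    obtain ⟨z, hz⟩ : (sphere (c k) (r k)).Nonempty :=
      NormedSpace.sphere_nonempty.2 (h.family.1 k).le
    obtain ⟨w, hw, rfl⟩ := hk hz
    exact h.family.eq_of_mem (sphere_subset_closedBall hz) (sphere_subset_closedBall (hg hw))
  subst hki
  refine ⟨j, fun z hz => ?_, hg⟩
  obtain ⟨w, hw, rfl⟩ := hk hz
  rwa [h.rightInv w (h.family'.sphere_subset j hw)]

/-- A homeomorphism of Schottky sets permutes the peripheral circles. -/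
lemma exists_isSchottkyMap (h : IsSchottkyHomeo Ω Ω' c r c' r' f g) :
    ∃ σ : I → I', discResidual Ω' (c' ∘ σ) (r' ∘ σ) = discResidual Ω' c' r' ∧
      IsSchottkyMap Ω Ω' c r (c' ∘ σ) (r' ∘ σ) f g := by
  choose σ hσ hσ' using h.exists_circle
  have hsurj : Function.Surjective σ := by
    intro j
    obtain ⟨i, hi, -⟩ := h.symm.exists_circle j
    obtain ⟨w, hw⟩ : (sphere (c' j) (r' j)).Nonempty :=
      NormedSpace.sphere_nonempty.2 (h.family'.1 j).le
    refine ⟨i, h.family'.eq_of_mem (sphere_subset_closedBall (hσ i (hi hw))) ?_⟩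
    rw [h.rightInv w (h.family'.sphere_subset j hw)]
    exact sphere_subset_closedBall hw
  have hinj : Function.Injective σ := by
    intro i k hik
    obtain ⟨w, hw⟩ : (sphere (c' (σ i)) (r' (σ i))).Nonempty :=
      NormedSpace.sphere_nonempty.2 (h.family'.1 _).le
    exact h.family.eq_of_mem (sphere_subset_closedBall (hσ' i hw))
      (sphere_subset_closedBall (hσ' k (hik ▸ hw)))
  have hres : discResidual Ω' (c' ∘ σ) (r' ∘ σ) = discResidual Ω' c' r' := by
    rw [discResidual, discResidual]
    congr 1
    exact hsurj.iUnion_comp fun j => ball (c' j) (r' j)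
  refine ⟨σ, hres, ⟨h.domain, h.domain', h.bdd, h.bdd', h.family,
    ⟨fun i => h.family'.1 _, fun i => h.family'.2.1 _, fun i k hik =>
      h.family'.2.2 (hinj.ne hik)⟩, h.cont, ?_, ?_, ?_, h.leftInv, ?_, hσ, hσ'⟩⟩
  all_goals rw [hres]
  exacts [h.cont', h.mapsTo, h.mapsTo', h.rightInv]

end IsSchottkyHomeo

end Circles

lemma IsJordanDomain.isPreconnected_frontier {Ω : Set ℂ} (h : IsJordanDomain Ω) :
    IsPreconnected (frontier Ω) := by
  obtain ⟨-, -, ⟨γ, hγ, -, himg⟩, -⟩ := h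
  rw [← himg]
  exact (isPreconnected_sphere_complex 0 1).image γ hγ

/-- A homeomorphism between subsets of the plane is given by mutually inverse plane maps. -/
lemma IsHomeoOn.exists_inverse {f : ℂ → ℂ} {S T : Set ℂ} (h : IsHomeoOn f S T) :
    ContinuousOn f S ∧ MapsTo f S T ∧ ∃ g : ℂ → ℂ, ContinuousOn g T ∧ MapsTo g T S ∧
      (∀ z ∈ S, g (f z) = z) ∧ ∀ z ∈ T, f (g z) = z := by
  classical
  obtain ⟨e, he⟩ := h
  have hfT : MapsTo f S T := fun z hz => he ⟨z, hz⟩ ▸ (e ⟨z, hz⟩).2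
  have hg : ∀ z : T, (if h : (z : ℂ) ∈ T then (e.symm ⟨z, h⟩ : ℂ) else 0) = e.symm z := fun z =>
    dif_pos z.2
  refine ⟨?_, hfT, fun z => if h : z ∈ T then (e.symm ⟨z, h⟩ : ℂ) else 0, ?_, ?_, ?_, ?_⟩
  · rw [continuousOn_iff_continuous_domRestrict]
    exact (continuous_subtype_val.comp e.continuous).congr he
  · rw [continuousOn_iff_continuous_domRestrict]
    exact (continuous_subtype_val.comp e.symm.continuous).congr fun z => (hg z).symm
  · intro z hz
    have := hg ⟨z, hz⟩
    simp only at this ⊢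
    rw [this]
    exact (e.symm ⟨z, hz⟩).2
  · intro z hz
    have := hg (e ⟨z, hz⟩)
    rw [he, e.symm_apply_apply] at this
    exact this
  · intro z hz
    have := hg ⟨z, hz⟩
    simp only at this ⊢
    rw [this, ← he, e.apply_symm_apply]

lemma exists_pos_apply_lt (η : ℝ≥0 ≃ₜ ℝ≥0) {ε : ℝ≥0} (hε : 0 < ε) : ∃ t, 0 < t ∧ η t < ε := by
  have h2 : ε / 2 < ε := NNReal.half_lt_self hε.ne'
  by_cases h0 : η.symm (ε / 2) = 0
  · refine ⟨η.symm 0, pos_iff_ne_zero.2 fun h => ?_, by simpa using hε⟩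
    have := η.symm.injective (h0.trans h.symm)
    exact (half_pos hε).ne' this
  · exact ⟨η.symm (ε / 2), pos_iff_ne_zero.2 h0, by simpa using h2⟩

/-- The inverse of a locally quasisymmetric map is locally weakly quasisymmetric. -/
lemma LocallyQuasisymmetricOn.inverse_weakly {f g : ℂ → ℂ} {S T : Set ℂ}
    (h : LocallyQuasisymmetricOn f S) (hg : ContinuousOn g T) (hgS : MapsTo g T S)
    (hfg : ∀ z ∈ T, f (g z) = z) : LocallyWeaklyQuasisymmetricOn g T := by
  intro K hK hKc C hC
  obtain ⟨η, hη⟩ := h (g '' K) ((image_mono hK).trans hgS.image_subset)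
    (hKc.image_of_continuousOn (hg.mono hK))
  obtain ⟨t, ht, hηt⟩ := exists_pos_apply_lt η (ε := (1 / C).toNNReal) (by positivity)
  have hηC : (η t : ℝ) * C < 1 := by
    rw [← lt_div_iff₀ hC]
    exact Real.lt_toNNReal_iff_coe_lt.1 hηt
  have ht' : (0 : ℝ) < t := ht
  refine ⟨max 1 (1 / t), le_max_left _ _, fun s hs l hl z hz hd => ?_⟩
  by_contra! hcon
  have h1 : dist (g s) (g l) ≤ t * dist (g s) (g z) := by
    have h2 : 1 / (t : ℝ) * dist (g l) (g s) ≤ dist (g z) (g s) :=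
      (mul_le_mul_of_nonneg_right (le_max_right _ _) dist_nonneg).trans hcon.le
    rw [dist_comm (g s), dist_comm (g s)]
    rw [one_div, inv_mul_le_iff₀ ht'] at h2
    exact h2
  have h3 := hη _ (mem_image_of_mem g hs) _ (mem_image_of_mem g hl) _ (mem_image_of_mem g hz) t h1
  rw [hfg s (hK hs), hfg l (hK hl), hfg z (hK hz), dist_comm s l, dist_comm s z] at h3
  have h4 : dist l s ≤ (η t : ℝ) * C * dist l s := by
    rw [mul_assoc]
    exact h3.trans (mul_le_mul_of_nonneg_left hd (η t).2)
  have h5 : dist l s = 0 := by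
    have h6 : 0 ≤ dist l s := dist_nonneg
    nlinarith
  have h7 : z = s := by
    rw [h5, mul_zero] at hd
    exact dist_le_zero.1 hd
  rw [h7, dist_self] at hcon
  have : 0 ≤ max 1 (1 / (t : ℝ)) * dist (g l) (g s) := by positivity
  linarith

lemma dimH_image_le_of_locally_dist_le {f : ℂ → ℂ} {A : Set ℂ}
    (h : ∀ x ∈ A, ∃ U ∈ 𝓝[A] x, ∃ C : ℝ, 0 ≤ C ∧
      ∀ y ∈ U, ∀ z ∈ U, dist (f y) (f z) ≤ C * dist y z) : dimH (f '' A) ≤ dimH A := by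
  refine dimH_image_le_of_locally_lipschitzOn fun x hx => ?_
  obtain ⟨U, hU, C, hC, hUC⟩ := h x hx
  refine ⟨C.toNNReal, U, hU, LipschitzOnWith.of_dist_le_mul fun y hy z hz => ?_⟩
  rw [Real.coe_toNNReal C hC]
  exact hUC y hy z hz

/-- A locally bi-Lipschitz bijection preserves the Hausdorff dimension of subsets. -/
lemma dimH_image_eq_of_locally_biLipschitz {f g : ℂ → ℂ} {S T : Set ℂ} (hf : ContinuousOn f S)
    (hfT : MapsTo f S T) (hgf : ∀ z ∈ S, g (f z) = z)
    (h : ∀ p ∈ T, ∃ U ∈ 𝓝[T] p, ∃ A > 0, ∃ B > 0, ∀ x ∈ U, ∀ y ∈ T,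
      A * dist x y ≤ dist (g x) (g y) ∧ dist (g x) (g y) ≤ B * dist x y)
    {A : Set ℂ} (hA : A ⊆ S) : dimH (f '' A) = dimH A := by
  have hfA : f '' A ⊆ T := (image_mono hA).trans hfT.image_subset
  apply le_antisymm
  · refine dimH_image_le_of_locally_dist_le fun x hx => ?_
    obtain ⟨U, hU, a, ha, b, -, hUab⟩ := h (f x) (hfT (hA hx))
    have hpre : f ⁻¹' U ∈ 𝓝[S] x :=
      (tendsto_nhdsWithin_iff.2 ⟨(hf x (hA hx)).tendsto,
        eventually_mem_nhdsWithin.mono fun z hz => hfT hz⟩) hU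
    refine ⟨f ⁻¹' U ∩ A, inter_mem (nhdsWithin_mono _ hA hpre) self_mem_nhdsWithin, 1 / a,
      by positivity, fun y hy z hz => ?_⟩
    have := (hUab (f y) hy.1 (f z) (hfT (hA hz.2))).1
    rw [hgf y (hA hy.2), hgf z (hA hz.2)] at this
    rw [one_div, ← div_eq_inv_mul, le_div_iff₀ ha, mul_comm]
    exact this
  · have hgA : g '' (f '' A) = A := by
      rw [← image_comp]
      exact (image_congr fun z hz => hgf z (hA hz)).trans (image_id A)
    conv_lhs => rw [← hgA]
    refine dimH_image_le_of_locally_dist_le fun x hx => ?_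
    obtain ⟨U, hU, a, -, b, hb, hUab⟩ := h x (hfA hx)
    exact ⟨U ∩ f '' A, inter_mem (nhdsWithin_mono _ hfA hU) self_mem_nhdsWithin, b, le_of_lt hb,
      fun y hy z hz => (hUab y hy.1 z (hfA hz.2)).2⟩

/-- A locally quasisymmetric homeomorphism from a measure-zero relative
Schottky set in a Jordan domain onto a relative Schottky set in a Jordan domain preserves
Hausdorff dimension. -/
theorem quasisymmetric_schottky_preserves_dimH
    (Ω Ωt S St : Set ℂ) (f : ℂ → ℂ)
    (hΩ : IsJordanDomain Ω) (hΩt : IsJordanDomain Ωt)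
    (hS : IsRelativeSchottkySet Ω S) (hS0 : volume S = 0)
    (hSt : IsRelativeSchottkySet Ωt St)
    (hf : IsHomeoOn f S St) (hqs : LocallyQuasisymmetricOn f S) :
    (∀ A ⊆ S, dimH (f '' A) = dimH A) ∧ dimH St = dimH S := by
  obtain ⟨hfc, hfT, g, hgc, hgS, hgf, hfg⟩ := hf.exists_inverse
  have hmain : ∀ A ⊆ S, dimH (f '' A) = dimH A := by
    have hW := hqs.inverse_weakly hgc hgS hfg
    obtain ⟨hd, I, c, r, hfam, rfl⟩ := hS
    obtain ⟨hdt, It, ct, rt, hfamt, rfl⟩ := hSt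
    have hH : IsSchottkyHomeo Ωt Ω ct rt c r g f :=
      ⟨hdt, hd, hΩt.2.1, hΩ.2.1, hΩt.isPreconnected_frontier, hΩ.isPreconnected_frontier,
        hfamt, hfam, hgc, hfc, hgS, hfT, hfg, hgf⟩
    obtain ⟨σ, hσ, hmap⟩ := hH.exists_isSchottkyMap
    intro A hA
    exact dimH_image_eq_of_locally_biLipschitz hfc hfT hgf
      (fun p hp => hmap.exists_biLipschitz (by rw [hσ]; exact hS0) hW hp) hA
  refine ⟨hmain, ?_⟩
  have himg : f '' S = St := by
    refine hfT.image_subset.antisymm fun z hz => ⟨g z, hgS hz, hfg z hz⟩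
  rw [← himg]
  exact hmain S Subset.rfl
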